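/- arXiv:2002.01518 — 5 statements merged into one kernel-verified Lean document; each statement's English description precedes it below -/
import Mathlib

section
/- For all n ≥ 1 and k ≥ 1: (a) there exists a bijection between {μ ⊆ (k+1)×(2n−1) : s_{n−1}(μ) > 0} and {ν ⊆ (k−1)×(2n+1) : ν_{k−1} ≥ 2}, given by μ ↦ (μ₂+2, …, μ_k+2) with inverse ν ↦ (2n−1, ν₁−2, …, ν_{k−1}−2, 0); (b) there exists a bijection between B^X_{n+k,n} and C^X_{n+k,n}, sending μ = ((2n+1)^l, 2n, μ'', 0^l) with s_n(μ)=l>0 to ((2n+1)^{l−1}, μ'', 0^l); (c) there exists a bijection between B^Y_{n+k,n} and C^Y_{n+k,n}, sending μ = ((2n+1)^{l+1}, μ'', 0^l) with s_n(μ)=l>0 to ((2n+1)^{l−1}, μ'', 1, 0^{l−1}). -/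
open Finset

/-- The number of parts of `μ` (among the first `l` parts) equal to `v`. -/
def cnt (l : ℕ) (μ : ℕ → ℕ) (v : ℕ) : ℕ := ((Finset.range l).filter fun i => μ i = v).card

/-- `s_m(μ)` for a partition `μ` with `l` parts (`μ 0 = μ₁` is the largest part):
`min(#{i : μᵢ = 0}, #{i : μᵢ = 2m+1})` if `μ₁ = 2m+1`, and `0` otherwise. -/
def spart (m l : ℕ) (μ : ℕ → ℕ) : ℕ :=
  if μ 0 = 2 * m + 1 then min (cnt l μ 0) (cnt l μ (2 * m + 1)) else 0

/-- A partition contained in an `r × c` rectangle: a weakly decreasing function `ℕ → ℕ`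
with all parts at most `c`, vanishing from index `r` on (padding with zeros). -/
def IsRect (r c : ℕ) (μ : ℕ → ℕ) : Prop :=
  (∀ i j, i ≤ j → μ j ≤ μ i) ∧ (∀ i, μ i ≤ c) ∧ ∀ i, r ≤ i → μ i = 0

/-- `B̂_{n+k,n}`: partitions `μ ⊆ (k+1)×(2n+1)` with `s_n(μ) = 0` and `s_{n−1}(μ) = 0`. -/
def Bhat (n k : ℕ) : Set (ℕ → ℕ) :=
  {μ | IsRect (k + 1) (2 * n + 1) μ ∧ spart n (k + 1) μ = 0 ∧ spart (n - 1) (k + 1) μ = 0}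

/-- The index set for the family `B^ν`: partitions `ν ⊆ (k+1)×(2n−1)` with `s_{n−1}(ν) > 0`. -/
def Bidx (n k : ℕ) : Set (ℕ → ℕ) :=
  {ν | IsRect (k + 1) (2 * n - 1) ν ∧ 0 < spart (n - 1) (k + 1) ν}

/-- `B^ν_{n+k,n} = {((2n+1)^i, (2n−1)^{l−i}, ν') : 0 ≤ i ≤ l}` where `l = s_{n−1}(ν)`
and `ν = ((2n−1)^l, ν')`. -/
def Bfam (n k : ℕ) (ν : ℕ → ℕ) : Set (ℕ → ℕ) :=
  {μ | ∃ i ≤ spart (n - 1) (k + 1) ν, μ = fun j => if j < i then 2 * n + 1 else ν j}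

/-- `B^X_{n+k,n}`: partitions `μ ⊆ (k+1)×(2n+1)` with `s_n(μ) = l > 0` and
`μ = ((2n+1)^l, 2n, μ')`. -/
def BX (n k : ℕ) : Set (ℕ → ℕ) :=
  {μ | IsRect (k + 1) (2 * n + 1) μ ∧ ∃ l, 0 < l ∧ spart n (k + 1) μ = l ∧
    (∀ j < l, μ j = 2 * n + 1) ∧ μ l = 2 * n}

/-- `B^Y_{n+k,n}`: partitions `μ ⊆ (k+1)×(2n+1)` with `s_n(μ) = l > 0` and
`μ = ((2n+1)^{l+1}, μ')`. -/
def BY (n k : ℕ) : Set (ℕ → ℕ) :=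
  {μ | IsRect (k + 1) (2 * n + 1) μ ∧ ∃ l, 0 < l ∧ spart n (k + 1) μ = l ∧
    ∀ j < l + 1, μ j = 2 * n + 1}

/-- `s̄_n(ν) = min(#{i : νᵢ = 2}, #{i : νᵢ = 2n+1})` for `ν` with `k−1` parts. -/
def sbar (n k : ℕ) (ν : ℕ → ℕ) : ℕ := min (cnt (k - 1) ν 2) (cnt (k - 1) ν (2 * n + 1))

/-- The index set for the family `C^ν`: partitions `ν ⊆ (k−1)×(2n+1)` with all parts `≥ 2`
(i.e. `ν_{k−1} ≥ 2`). -/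
def Cidx (n k : ℕ) : Set (ℕ → ℕ) :=
  {ν | IsRect (k - 1) (2 * n + 1) ν ∧ ∀ i < k - 1, 2 ≤ ν i}

/-- `C^ν_{n+k,n} = {(ν', 2^{l−i}, 0^i) : 0 ≤ i ≤ l}` where `l = s̄_n(ν)` and `ν = (ν', 2^l)`. -/
def Cfam (n k : ℕ) (ν : ℕ → ℕ) : Set (ℕ → ℕ) :=
  {μ | ∃ i ≤ sbar n k ν, μ = fun j => if j < (k - 1) - i then ν j else 0}

/-- `C^X_{n+k,n}`: partitions `ν ⊆ (k−1)×(2n+1)` with `s_n(ν) = l` and `ν = (ν', 0^{l+1})`. -/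
def CX (n k : ℕ) : Set (ℕ → ℕ) :=
  {ν | IsRect (k - 1) (2 * n + 1) ν ∧ ∃ l, spart n (k - 1) ν = l ∧ l + 1 ≤ k - 1 ∧
    ∀ j, (k - 1) - (l + 1) ≤ j → ν j = 0}

/-- `C^Y_{n+k,n}`: partitions `ν ⊆ (k−1)×(2n+1)` with `s_n(ν) = l` and `ν = (ν', 1, 0^l)`. -/
def CY (n k : ℕ) : Set (ℕ → ℕ) :=
  {ν | IsRect (k - 1) (2 * n + 1) ν ∧ ∃ l, spart n (k - 1) ν = l ∧ l + 1 ≤ k - 1 ∧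
    ν ((k - 1) - (l + 1)) = 1 ∧ ∀ j, (k - 1) - l ≤ j → ν j = 0}

/-- The map of Proposition `bi`(a): `μ = (μ₁, μ₂, …, μ_{k+1}) ↦ (μ₂+2, …, μ_k+2)`. -/
def phiA (k : ℕ) (μ : ℕ → ℕ) : ℕ → ℕ :=
  fun j => if j < k - 1 then μ (j + 1) + 2 else 0

/-- The inverse map of Proposition `bi`(a): `ν ↦ (2n−1, ν₁−2, …, ν_{k−1}−2, 0)`. -/
def psiA (n k : ℕ) (ν : ℕ → ℕ) : ℕ → ℕ :=
  fun j => if j = 0 then 2 * n - 1 else if j < k then ν (j - 1) - 2 else 0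

/-- The map of Proposition `bi`(b): with `l = s_n(μ)`,
`μ = ((2n+1)^l, 2n, μ'', 0^l) ↦ ((2n+1)^{l−1}, μ'', 0^l)`. -/
def phiB (n k : ℕ) (μ : ℕ → ℕ) : ℕ → ℕ := fun j =>
  let l := spart n (k + 1) μ
  if j < l - 1 then 2 * n + 1 else if j < k - l - 1 then μ (j + 2) else 0

/-- The map of Proposition `bi`(c): with `l = s_n(μ)`,
`μ = ((2n+1)^{l+1}, μ'', 0^l) ↦ ((2n+1)^{l−1}, μ'', 1, 0^{l−1})`. -/
def phiC (n k : ℕ) (μ : ℕ → ℕ) : ℕ → ℕ := fun j =>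
  let l := spart n (k + 1) μ
  if j < l - 1 then 2 * n + 1
  else if j < k - l - 1 then μ (j + 2)
  else if j = k - l - 1 then 1 else 0

/-- `l ≤ s_n(μ)` in terms of the shape of `μ`. -/
theorem le_spart_iff {n r l : ℕ} {μ : ℕ → ℕ} (h : IsRect r (2 * n + 1) μ) (hl : 0 < l) :
    l ≤ spart n r μ ↔
      l ≤ r ∧ (∀ j < l, μ j = 2 * n + 1) ∧ ∀ j, r - l ≤ j → μ j = 0 := by
  obtain ⟨h1, h2, h3⟩ := h
  constructor
  · intro hs
    unfold spart at hs
    split_ifs at hs with h0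
    · have ha : l ≤ cnt r μ 0 := le_trans hs (min_le_left _ _)
      have hb : l ≤ cnt r μ (2 * n + 1) := le_trans hs (min_le_right _ _)
      have hr : cnt r μ 0 ≤ r := by
        unfold cnt
        exact (Finset.card_filter_le _ _).trans (by simp)
      refine ⟨by omega, ?_, ?_⟩
      · intro j hj
        by_contra hne
        have hsub : ((Finset.range r).filter fun i => μ i = 2 * n + 1) ⊆ Finset.range j := by
          intro i hi
          simp only [Finset.mem_filter, Finset.mem_range] at hi ⊢
          by_contra hij
          have e1 := h1 j i (by omega)
          have e2 := h2 j
          omega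
        have := Finset.card_le_card hsub
        simp only [Finset.card_range] at this
        unfold cnt at hb
        omega
      · intro j hj
        by_contra hne
        have hjr : j < r := by
          by_contra hh
          exact hne (h3 j (by omega))
        have hsub : ((Finset.range r).filter fun i => μ i = 0) ⊆ Finset.Ico (j + 1) r := by
          intro i hi
          simp only [Finset.mem_filter, Finset.mem_range, Finset.mem_Ico] at hi ⊢
          refine ⟨?_, hi.1⟩
          by_contra hij
          have e1 := h1 i j (by omega)
          omega
        have := Finset.card_le_card hsub
        simp only [Nat.card_Ico] at this
        unfold cnt at ha
        omega
    · omega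
  · rintro ⟨hr, ht, hz⟩
    unfold spart
    rw [if_pos (ht 0 hl)]
    refine le_min ?_ ?_
    · have hsub : Finset.Ico (r - l) r ⊆ ((Finset.range r).filter fun i => μ i = 0) := by
        intro i hi
        simp only [Finset.mem_filter, Finset.mem_range, Finset.mem_Ico] at hi ⊢
        exact ⟨hi.2, hz i hi.1⟩
      have := Finset.card_le_card hsub
      simp only [Nat.card_Ico] at this
      unfold cnt
      omega
    · have hsub : Finset.range l ⊆ ((Finset.range r).filter fun i => μ i = 2 * n + 1) := by
        intro i hi
        simp only [Finset.mem_filter, Finset.mem_range] at hi ⊢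
        exact ⟨by omega, ht i hi⟩
      have := Finset.card_le_card hsub
      simp only [Finset.card_range] at this
      unfold cnt
      omega

/-- The shape of `μ` when `s_n(μ) = l`. -/
theorem spart_shape {n r l : ℕ} {μ : ℕ → ℕ} (h : IsRect r (2 * n + 1) μ)
    (hs : spart n r μ = l) :
    l ≤ r ∧ (∀ j < l, μ j = 2 * n + 1) ∧ ∀ j, r - l ≤ j → μ j = 0 := by
  rcases Nat.eq_zero_or_pos l with rfl | hl
  · exact ⟨by omega, by intro j hj; omega, fun j hj => h.2.2 j (by omega)⟩
  · exact (le_spart_iff h hl).1 hs.ge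

/-- Computing `s_n(μ)` from the shape; the last condition says it cannot be larger. -/
theorem spart_eq {n r l : ℕ} {μ : ℕ → ℕ} (h : IsRect r (2 * n + 1) μ)
    (hr : l ≤ r) (ht : ∀ j < l, μ j = 2 * n + 1) (hz : ∀ j, r - l ≤ j → μ j = 0)
    (hlast : μ l ≠ 2 * n + 1 ∨ μ (r - (l + 1)) ≠ 0) : spart n r μ = l := by
  apply le_antisymm
  · by_contra hh
    have := (le_spart_iff h (Nat.succ_pos l)).1 (by omega)
    rcases hlast with hc | hc
    · exact hc (this.2.1 l (by omega))
    · exact hc (this.2.2 _ le_rfl)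
  · rcases Nat.eq_zero_or_pos l with rfl | hl
    · omega
    · exact (le_spart_iff h hl).2 ⟨hr, ht, hz⟩

/-- Inverse of `phiB`. -/
def psiB (n k : ℕ) (ν : ℕ → ℕ) : ℕ → ℕ := fun j =>
  if j < spart n (k - 1) ν + 1 then 2 * n + 1
  else if j = spart n (k - 1) ν + 1 then 2 * n else ν (j - 2)

/-- Inverse of `phiC`. -/
def psiC (n k : ℕ) (ν : ℕ → ℕ) : ℕ → ℕ := fun j =>
  if j < spart n (k - 1) ν + 2 then 2 * n + 1
  else if j < k - spart n (k - 1) ν then ν (j - 2) else 0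

theorem mem_Bidx {n k : ℕ} (hn : 1 ≤ n) (μ : ℕ → ℕ) :
    μ ∈ Bidx n k ↔ IsRect (k + 1) (2 * n - 1) μ ∧ μ 0 = 2 * n - 1 ∧ μ k = 0 := by
  have e : 2 * n - 1 = 2 * (n - 1) + 1 := by omega
  unfold Bidx
  rw [Set.mem_ofPred_eq, e]
  refine and_congr_right fun h => ?_
  have := le_spart_iff h (Nat.zero_lt_one)
  rw [Nat.lt_iff_add_one_le, zero_add, this]
  constructor
  · rintro ⟨_, a, b⟩
    exact ⟨a 0 (by omega), b k (by omega)⟩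
  · rintro ⟨a, b⟩
    refine ⟨by omega, ?_, ?_⟩
    · intro j hj
      have : j = 0 := by omega
      rw [this, a]
    · intro j hj
      have := h.1 k j (by omega)
      omega

theorem partA (n k : ℕ) (hn : 1 ≤ n) (hk : 1 ≤ k) :
    Set.BijOn (phiA k) (Bidx n k) (Cidx n k) ∧
      Set.InvOn (psiA n k) (phiA k) (Bidx n k) (Cidx n k) := by
  have hinv : Set.InvOn (psiA n k) (phiA k) (Bidx n k) (Cidx n k) := by
    constructor
    · intro μ hμ
      obtain ⟨⟨h1, h2, h3⟩, h0, hz⟩ := (mem_Bidx hn μ).1 hμ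
      funext j
      have := h1 k j
      unfold psiA phiA
      grind
    · rintro ν ⟨⟨h1, h2, h3⟩, h4⟩
      funext j
      have := h3 j
      have := h4 j
      unfold psiA phiA
      grind
  refine ⟨hinv.bijOn ?_ ?_, hinv⟩
  · intro μ hμ
    obtain ⟨⟨h1, h2, h3⟩, h0, hz⟩ := (mem_Bidx hn μ).1 hμ
    refine ⟨⟨?_, ?_, ?_⟩, ?_⟩
    · intro i j hij
      have := h1 (i + 1) (j + 1)
      unfold phiA
      grind
    · intro i
      have := h2 (i + 1)
      unfold phiA
      grind
    · intro i hi
      unfold phiA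
      grind
    · intro i hi
      unfold phiA
      grind
  · rintro ν ⟨⟨h1, h2, h3⟩, h4⟩
    rw [mem_Bidx hn]
    refine ⟨⟨?_, ?_, ?_⟩, ?_, ?_⟩
    · intro i j hij
      have := h1 (i - 1) (j - 1)
      have := h2 (j - 1)
      unfold psiA
      grind
    · intro i
      have := h2 (i - 1)
      unfold psiA
      grind
    · intro i hi
      unfold psiA
      grind
    · simp [psiA]
    · unfold psiA
      grind

theorem phiB_apply {n k l : ℕ} {μ : ℕ → ℕ} (h : spart n (k + 1) μ = l) (j : ℕ) :
    phiB n k μ j =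
      if j < l - 1 then 2 * n + 1 else if j < k - l - 1 then μ (j + 2) else 0 := by
  subst h; rfl

theorem phiC_apply {n k l : ℕ} {μ : ℕ → ℕ} (h : spart n (k + 1) μ = l) (j : ℕ) :
    phiC n k μ j =
      if j < l - 1 then 2 * n + 1 else if j < k - l - 1 then μ (j + 2)
      else if j = k - l - 1 then 1 else 0 := by
  subst h; rfl

theorem psiB_apply {n k l : ℕ} {ν : ℕ → ℕ} (h : spart n (k - 1) ν = l) (j : ℕ) :
    psiB n k ν j =
      if j < l + 1 then 2 * n + 1 else if j = l + 1 then 2 * n else ν (j - 2) := by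
  subst h; rfl

theorem psiC_apply {n k l : ℕ} {ν : ℕ → ℕ} (h : spart n (k - 1) ν = l) (j : ℕ) :
    psiC n k ν j =
      if j < l + 2 then 2 * n + 1 else if j < k - l then ν (j - 2) else 0 := by
  subst h; rfl

/-- Everything we need about the image of `μ ∈ BX`. -/
theorem phiB_spec {n k l : ℕ} (hn : 1 ≤ n) {μ : ℕ → ℕ}
    (h : IsRect (k + 1) (2 * n + 1) μ) (hl : 0 < l) (hs : spart n (k + 1) μ = l)
    (hm : μ l = 2 * n) :
    2 * l ≤ k ∧ IsRect (k - 1) (2 * n + 1) (phiB n k μ) ∧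
      spart n (k - 1) (phiB n k μ) = l - 1 := by
  obtain ⟨s1, s2, s3⟩ := spart_shape h hs
  obtain ⟨h1, h2, h3⟩ := h
  have hk : 2 * l ≤ k := by
    by_contra hh
    have := s3 l (by omega)
    omega
  have hR : IsRect (k - 1) (2 * n + 1) (phiB n k μ) := by
    refine ⟨?_, ?_, ?_⟩
    · intro i j hij
      have := h1 (i + 2) (j + 2)
      have := h2 (j + 2)
      rw [phiB_apply hs, phiB_apply hs]
      grind
    · intro i
      have := h2 (i + 2)
      rw [phiB_apply hs]
      grind
    · intro i hi
      rw [phiB_apply hs]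
      grind
  refine ⟨hk, hR, spart_eq hR (by omega) ?_ ?_ (Or.inl ?_)⟩
  · intro j hj
    rw [phiB_apply hs, if_pos hj]
  · intro j hj
    rw [phiB_apply hs]
    grind
  · rw [phiB_apply hs]
    have := h1 l (l - 1 + 2) (by omega)
    grind

theorem psiB_spec {n k l : ℕ} (hn : 1 ≤ n) {ν : ℕ → ℕ}
    (h : IsRect (k - 1) (2 * n + 1) ν) (hs : spart n (k - 1) ν = l) (hlk : l + 1 ≤ k - 1)
    (hz : ∀ j, (k - 1) - (l + 1) ≤ j → ν j = 0) :
    2 * l + 2 ≤ k ∧ IsRect (k + 1) (2 * n + 1) (psiB n k ν) ∧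
      spart n (k + 1) (psiB n k ν) = l + 1 := by
  obtain ⟨s1, s2, s3⟩ := spart_shape h hs
  have htop : ν l ≤ 2 * n := by
    by_contra hh
    have e : ν l = 2 * n + 1 := by have := h.2.1 l; omega
    have : l + 1 ≤ spart n (k - 1) ν := by
      refine (le_spart_iff h (Nat.succ_pos l)).2 ⟨hlk, ?_, hz⟩
      intro j hj
      have := h.1 j l (by omega)
      have := h.2.1 j
      omega
    omega
  obtain ⟨h1, h2, h3⟩ := h
  have hk : 2 * l + 2 ≤ k := by
    by_contra hh
    have := hz (l - 1) (by omega)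
    have := s2 (l - 1) (by omega)
    omega
  have hR : IsRect (k + 1) (2 * n + 1) (psiB n k ν) := by
    refine ⟨?_, ?_, ?_⟩
    · intro i j hij
      have := h1 (i - 2) (j - 2)
      have := h2 (j - 2)
      have := h1 l (j - 2)
      rw [psiB_apply hs, psiB_apply hs]
      grind
    · intro i
      have := h2 (i - 2)
      rw [psiB_apply hs]
      grind
    · intro i hi
      rw [psiB_apply hs]
      have := hz (i - 2) (by omega)
      grind
  refine ⟨hk, hR, spart_eq hR (by omega) ?_ ?_ (Or.inl ?_)⟩
  · intro j hj
    rw [psiB_apply hs, if_pos hj]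
  · intro j hj
    have := hz (j - 2)
    rw [psiB_apply hs]
    grind
  · rw [psiB_apply hs]
    grind

theorem partB (n k : ℕ) (hn : 1 ≤ n) :
    Set.BijOn (phiB n k) (BX n k) (CX n k) := by
  have hinv : Set.InvOn (psiB n k) (phiB n k) (BX n k) (CX n k) := by
    constructor
    · rintro μ ⟨h, l, hl, hs, ht, hm⟩
      obtain ⟨p1, p2, p3⟩ := phiB_spec hn h hl hs hm
      obtain ⟨s1, s2, s3⟩ := spart_shape h hs
      funext j
      rw [psiB_apply p3, phiB_apply hs]
      have := s2 j
      have := s3 j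
      by_cases c1 : j < l
      · rw [if_pos (by omega), ht j c1]
      by_cases c2 : j = l
      · rw [if_neg (by omega), if_pos (by omega), c2, hm]
      have e : j - 2 + 2 = j := by omega
      rw [e]
      grind
    · rintro ν ⟨h, l, hs, hlk, hz⟩
      obtain ⟨p1, p2, p3⟩ := psiB_spec hn h hs hlk hz
      obtain ⟨s1, s2, s3⟩ := spart_shape h hs
      funext j
      rw [phiB_apply p3, psiB_apply hs]
      have := s2 j
      have := hz j
      have e : j + 2 - 2 = j := by omega
      rw [e]
      grind
  refine hinv.bijOn ?_ ?_
  · rintro μ ⟨h, l, hl, hs, ht, hm⟩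
    obtain ⟨p1, p2, p3⟩ := phiB_spec hn h hl hs hm
    refine ⟨p2, l - 1, p3, by omega, ?_⟩
    intro j hj
    rw [phiB_apply hs]
    grind
  · rintro ν ⟨h, l, hs, hlk, hz⟩
    obtain ⟨p1, p2, p3⟩ := psiB_spec hn h hs hlk hz
    refine ⟨p2, l + 1, by omega, p3, ?_, ?_⟩
    · intro j hj
      rw [psiB_apply hs, if_pos hj]
    · rw [psiB_apply hs]
      grind

theorem phiC_spec {n k l : ℕ} (hn : 1 ≤ n) {μ : ℕ → ℕ}
    (h : IsRect (k + 1) (2 * n + 1) μ) (hl : 0 < l) (hs : spart n (k + 1) μ = l)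
    (ht : ∀ j < l + 1, μ j = 2 * n + 1) :
    2 * l ≤ k ∧ μ (k - l) ≠ 0 ∧ IsRect (k - 1) (2 * n + 1) (phiC n k μ) ∧
      spart n (k - 1) (phiC n k μ) = l - 1 := by
  obtain ⟨s1, s2, s3⟩ := spart_shape h hs
  have hk : 2 * l ≤ k := by
    by_contra hh
    have := s3 l (by omega)
    have := ht l (by omega)
    omega
  have hnz : μ (k - l) ≠ 0 := by
    intro hh
    have : l + 1 ≤ spart n (k + 1) μ := by
      refine (le_spart_iff h (Nat.succ_pos l)).2 ⟨by omega, ht, ?_⟩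
      intro j hj
      have := h.1 (k - l) j (by omega)
      omega
    omega
  obtain ⟨h1, h2, h3⟩ := h
  have hR : IsRect (k - 1) (2 * n + 1) (phiC n k μ) := by
    refine ⟨?_, ?_, ?_⟩
    · intro i j hij
      have := h1 (i + 2) (j + 2)
      have := h2 (j + 2)
      have := h1 (i + 2) (k - l)
      rw [phiC_apply hs, phiC_apply hs]
      grind
    · intro i
      have := h2 (i + 2)
      rw [phiC_apply hs]
      grind
    · intro i hi
      rw [phiC_apply hs]
      grind
  refine ⟨hk, hnz, hR, spart_eq hR (by omega) ?_ ?_ (Or.inr ?_)⟩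
  · intro j hj
    rw [phiC_apply hs, if_pos hj]
  · intro j hj
    rw [phiC_apply hs]
    grind
  · rw [phiC_apply hs]
    grind

theorem psiC_spec {n k l : ℕ} (hn : 1 ≤ n) {ν : ℕ → ℕ}
    (h : IsRect (k - 1) (2 * n + 1) ν) (hs : spart n (k - 1) ν = l) (hlk : l + 1 ≤ k - 1)
    (hone : ν ((k - 1) - (l + 1)) = 1) :
    2 * l + 2 ≤ k ∧ IsRect (k + 1) (2 * n + 1) (psiC n k ν) ∧
      spart n (k + 1) (psiC n k ν) = l + 1 := by
  obtain ⟨s1, s2, s3⟩ := spart_shape h hs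
  obtain ⟨h1, h2, h3⟩ := h
  have hk : 2 * l + 2 ≤ k := by
    by_contra hh
    have := s2 (k - 1 - (l + 1)) (by omega)
    omega
  have hR : IsRect (k + 1) (2 * n + 1) (psiC n k ν) := by
    refine ⟨?_, ?_, ?_⟩
    · intro i j hij
      have := h1 (i - 2) (j - 2)
      have := h2 (j - 2)
      rw [psiC_apply hs, psiC_apply hs]
      grind
    · intro i
      have := h2 (i - 2)
      rw [psiC_apply hs]
      grind
    · intro i hi
      rw [psiC_apply hs]
      grind
  refine ⟨hk, hR, spart_eq hR (by omega) ?_ ?_ (Or.inr ?_)⟩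
  · intro j hj
    rw [psiC_apply hs, if_pos (by omega)]
  · intro j hj
    rw [psiC_apply hs]
    grind
  · rw [psiC_apply hs]
    have := h1 (k + 1 - (l + 1 + 1) - 2) (k - 1 - (l + 1)) (by omega)
    grind

theorem partC (n k : ℕ) (hn : 1 ≤ n) :
    Set.BijOn (phiC n k) (BY n k) (CY n k) := by
  have hinv : Set.InvOn (psiC n k) (phiC n k) (BY n k) (CY n k) := by
    constructor
    · rintro μ ⟨h, l, hl, hs, ht⟩
      obtain ⟨p1, p0, p2, p3⟩ := phiC_spec hn h hl hs ht
      obtain ⟨s1, s2, s3⟩ := spart_shape h hs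
      funext j
      rw [psiC_apply p3, phiC_apply hs]
      have := s3 j
      by_cases c1 : j < l + 1
      · rw [if_pos (by omega), ht j c1]
      have e : j - 2 + 2 = j := by omega
      rw [e]
      grind
    · rintro ν ⟨h, l, hs, hlk, h1, hz⟩
      obtain ⟨p1, p2, p3⟩ := psiC_spec hn h hs hlk h1
      obtain ⟨s1, s2, s3⟩ := spart_shape h hs
      funext j
      rw [phiC_apply p3, psiC_apply hs]
      have := s2 j
      have := hz j
      have e : j + 2 - 2 = j := by omega
      rw [e]
      by_cases c : j = k - 1 - (l + 1)
      · rw [← c] at h1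
        grind
      grind
  refine hinv.bijOn ?_ ?_
  · rintro μ ⟨h, l, hl, hs, ht⟩
    obtain ⟨p1, p0, p2, p3⟩ := phiC_spec hn h hl hs ht
    refine ⟨p2, l - 1, p3, by omega, ?_, ?_⟩
    · rw [phiC_apply hs]
      grind
    · intro j hj
      rw [phiC_apply hs]
      grind
  · rintro ν ⟨h, l, hs, hlk, h1, hz⟩
    obtain ⟨p1, p2, p3⟩ := psiC_spec hn h hs hlk h1
    refine ⟨p2, l + 1, by omega, p3, ?_⟩
    intro j hj
    rw [psiC_apply hs, if_pos (by omega)]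

/-- **Proposition `bi`.** For `n, k ≥ 1`:
(a) `μ ↦ (μ₂+2, …, μ_k+2)` is a bijection from
`{μ ⊆ (k+1)×(2n−1) : s_{n−1}(μ) > 0}` to `{ν ⊆ (k−1)×(2n+1) : ν_{k−1} ≥ 2}`,
with inverse `ν ↦ (2n−1, ν₁−2, …, ν_{k−1}−2, 0)`;
(b) `phiB` is a bijection from `B^X_{n+k,n}` to `C^X_{n+k,n}`;
(c) `phiC` is a bijection from `B^Y_{n+k,n}` to `C^Y_{n+k,n}`. -/
theorem partition_bijections (n k : ℕ) (hn : 1 ≤ n) (hk : 1 ≤ k) :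
    (Set.BijOn (phiA k) (Bidx n k) (Cidx n k) ∧
      Set.InvOn (psiA n k) (phiA k) (Bidx n k) (Cidx n k)) ∧
    Set.BijOn (phiB n k) (BX n k) (CX n k) ∧
    Set.BijOn (phiC n k) (BY n k) (CY n k) := by
  exact ⟨partA n k hn hk, partB n k hn, partC n k hn⟩
end

section
/- For nonnegative integers n, a, b, let T(n,a,b) be the set of pairs (S₁,S₂) with S₁ ⊆ {0,…,n+a−1}, |S₁| = a, and S₂ ⊆ {0,…,n+a+b−1}, |S₂| = b. Define the map ψ_{n,a,b} on T(n,a,b) as follows: given (A₁,B₁) ∈ T(n,a,b) with A₁ = {i₁<⋯<i_a}, B₁ ∩ {n+b,…,n+b+a−1} = {n+b+a−j_k < ⋯ < n+b+a−j₁} and μ = λ_{A₁}, set A₂ = {i_m : m ∉ {j₁,…,j_k}} ∪ {n+a+b−(B₁(μ_{j_l}+l)−(i_{j_l}−j_l)) : l = 1,…,k} and B₂ = (B₁ ∩ {0,…,n+b−1}) ∪ {B₁(μ_{j_l}+l) : l = 1,…,k}, and put ψ_{n,a,b}(A₁,B₁) = (B₂,A₂). Then (B₂,A₂) ∈ T(n,b,a),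 Σ A₁ + Σ B₁ = Σ A₂ + Σ B₂, and ψ_{n,b,a}(ψ_{n,a,b}(A₁,B₁)) = (A₁,B₁); in particular ψ_{n,a,b} is a sum-preserving bijection from T(n,a,b) to T(n,b,a). -/
open Finset

/-- `S(k)`: the `k`-th smallest element (1-indexed) of `ℤ_{≥0} ∖ S`. -/
noncomputable def nthCompl (S : Finset ℕ) (k : ℕ) : ℕ := Nat.nth (fun x => x ∉ S) (k - 1)

/-- `λ_S(j)`: the `j`-th entry (1-indexed) of `λ_S = (i₁, i₂−1, …, i_s−s+1)`
for `S = {i₁ < ⋯ < i_s}`. -/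
def lamSet (S : Finset ℕ) (j : ℕ) : ℕ := (S.sort (· ≤ ·)).getD (j - 1) 0 - (j - 1)

/-- Membership in `T(n,a,b)`: pairs `(S₁,S₂)` with `S₁ ⊆ {0,…,n+a−1}`, `|S₁| = a`,
`S₂ ⊆ {0,…,n+a+b−1}`, `|S₂| = b`. -/
def Tmem (n a b : ℕ) (p : Finset ℕ × Finset ℕ) : Prop :=
  p.1 ⊆ Finset.range (n + a) ∧ p.1.card = a ∧
    p.2 ⊆ Finset.range (n + a + b) ∧ p.2.card = b

/-- The map `ψ_{n,a,b} : (A₁, B₁) ↦ (B₂, A₂)` of Definition `bijection1`.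
Here `A₁ = {i₁ < ⋯ < i_a}`, `B₁ ∩ {n+b, …, n+b+a−1} = {n+b+a−j_k < ⋯ < n+b+a−j₁}`,
`μ = λ_{A₁}`, and
`A₂ = {i_m : m ∉ {j₁,…,j_k}} ∪ {n+a+b − (B₁(μ_{j_l}+l) − (i_{j_l}−j_l)) : l = 1,…,k}`,
`B₂ = (B₁ ∩ {0,…,n+b−1}) ∪ {B₁(μ_{j_l}+l) : l = 1,…,k}`. -/
noncomputable def psiMap (n a b : ℕ) (A B : Finset ℕ) : Finset ℕ × Finset ℕ :=
  let AL := A.sort (· ≤ ·)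
  let L := ((B.filter fun x => n + b ≤ x).sort (· ≤ ·)).reverse
  let k := L.length
  -- `jOf l0 = j_{l0+1}`, where `L.getD l0 0 = n+b+a−j_{l0+1}` is the `(l0+1)`-th largest
  -- element of `B ∩ {n+b,…,n+b+a−1}`
  let jOf : ℕ → ℕ := fun l0 => n + a + b - L.getD l0 0
  let Jset : Finset ℕ := (Finset.range k).image jOf
  -- `newB l0 = B(μ_{j_l} + l)` for `l = l0 + 1`
  let newB : ℕ → ℕ := fun l0 =>
    nthCompl B (lamSet A (jOf l0) + (l0 + 1))
  -- `newA l0 = n+a+b − (B(μ_{j_l}+l) − (i_{j_l} − j_l)) = (n+a+b+i_{j_l}) − (B(μ_{j_l}+l)+j_l)`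
  let newA : ℕ → ℕ := fun l0 =>
    n + a + b + AL.getD (jOf l0 - 1) 0 - (newB l0 + jOf l0)
  let A2 : Finset ℕ :=
    ((Finset.range a).filter fun m0 => m0 + 1 ∉ Jset).image (fun m0 => AL.getD m0 0)
      ∪ (Finset.range k).image newA
  let B2 : Finset ℕ := B.filter (fun x => x < n + b) ∪ (Finset.range k).image newB
  (B2, A2)


/-- number of elements of `S` below `x` -/
def cn (S : Finset ℕ) (x : ℕ) : ℕ := Nat.count (fun y => y ∈ S) x

/-- number of non-elements of `S` below `x` -/
def cc (S : Finset ℕ) (x : ℕ) : ℕ := Nat.count (fun y => y ∉ S) x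

/-- 0-indexed enumeration of `S` -/
noncomputable def nt (S : Finset ℕ) (m : ℕ) : ℕ := Nat.nth (fun y => y ∈ S) m

/-- 0-indexed enumeration of the complement of `S` -/
noncomputable def nc (S : Finset ℕ) (m : ℕ) : ℕ := Nat.nth (fun y => y ∉ S) m

lemma fin_mem (S : Finset ℕ) : (Set.ofPred (fun y => y ∈ S)).Finite := S.finite_toSet

lemma fin_mem_toFinset (S : Finset ℕ) : (fin_mem S).toFinset = S := by
  ext x
  rw [Set.Finite.mem_toFinset]
  rfl

lemma inf_compl (S : Finset ℕ) : (Set.ofPred (fun y => y ∉ S)).Infinite :=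
  S.finite_toSet.infinite_compl

lemma cc_add_cn (S : Finset ℕ) (x : ℕ) : cc S x + cn S x = x := by
  unfold cc cn
  induction x with
  | zero => simp
  | succ x ih =>
    rw [Nat.count_succ, Nat.count_succ]
    by_cases h : x ∈ S <;> simp [h] <;> omega

lemma cn_union (S T : Finset ℕ) (h : Disjoint S T) (x : ℕ) : cn (S ∪ T) x = cn S x + cn T x := by
  unfold cn
  induction x with
  | zero => simp
  | succ x ih =>
    rw [Nat.count_succ, Nat.count_succ, Nat.count_succ, ih]
    by_cases h1 : x ∈ S
    · have h2 : x ∉ T := Finset.disjoint_left.1 h h1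
      simp [h1, h2]; omega
    · by_cases h2 : x ∈ T <;> simp [h1, h2]; omega

lemma cn_eq_card (S : Finset ℕ) (x : ℕ) : cn S x = (S.filter (fun y => y < x)).card := by
  unfold cn
  rw [Nat.count_eq_card_filter_range]
  congr 1
  ext y
  simp [and_comm]

lemma cn_full (S : Finset ℕ) (N : ℕ) (h : S ⊆ range N) : cn S N = S.card := by
  rw [cn_eq_card, Finset.filter_true_of_mem]
  intro y hy
  exact mem_range.1 (h hy)

lemma cn_lt_card (S : Finset ℕ) (x : ℕ) (h : x ∈ S) : cn S x < S.card := by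
  have := Nat.count_lt_card (p := fun y => y ∈ S) (fin_mem S) h
  rwa [fin_mem_toFinset] at this

lemma cn_inj {S : Finset ℕ} {x y : ℕ} (hx : x ∈ S) (hy : y ∈ S) (h : cn S x = cn S y) : x = y :=
  Nat.count_injective (p := fun y => y ∈ S) hx hy h

lemma cn_strict {S : Finset ℕ} {x y : ℕ} (hx : x ∈ S) (h : x < y) : cn S x < cn S y :=
  Nat.count_strict_mono (p := fun y => y ∈ S) hx h

lemma cc_strict {S : Finset ℕ} {x y : ℕ} (hx : x ∉ S) (h : x < y) : cc S x < cc S y :=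
  Nat.count_strict_mono (p := fun y => y ∉ S) hx h

lemma cc_mono (S : Finset ℕ) {x y : ℕ} (h : x ≤ y) : cc S x ≤ cc S y :=
  Nat.count_monotone (fun y => y ∉ S) h

lemma nt_cn {S : Finset ℕ} {x : ℕ} (hx : x ∈ S) : nt S (cn S x) = x :=
  Nat.nth_count (p := fun y => y ∈ S) hx

lemma nc_cc {S : Finset ℕ} {x : ℕ} (hx : x ∉ S) : nc S (cc S x) = x :=
  Nat.nth_count (p := fun y => y ∉ S) hx

lemma cc_nc (S : Finset ℕ) (m : ℕ) : cc S (nc S m) = m :=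
  Nat.count_nth_of_infinite (p := fun y => y ∉ S) (inf_compl S) m

lemma nc_not_mem (S : Finset ℕ) (m : ℕ) : nc S m ∉ S :=
  Nat.nth_mem_of_infinite (p := fun y => y ∉ S) (inf_compl S) m

lemma cn_nt {S : Finset ℕ} {m : ℕ} (h : m < S.card) : cn S (nt S m) = m :=
  Nat.count_nth_of_lt_card_finite (p := fun y => y ∈ S) (fin_mem S)
    (by rwa [fin_mem_toFinset])

lemma nt_mem {S : Finset ℕ} {m : ℕ} (h : m < S.card) : nt S m ∈ S :=
  Nat.nth_mem_of_lt_card (p := fun y => y ∈ S) (fin_mem S)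
    (by rwa [fin_mem_toFinset])

lemma sort_getD (S : Finset ℕ) (m : ℕ) : (S.sort (· ≤ ·)).getD m 0 = nt S m := by
  unfold nt
  rw [Nat.nth_eq_getD_sort (fin_mem S), fin_mem_toFinset]

lemma image_range_nt (S : Finset ℕ) (f : ℕ → ℕ) :
    (range S.card).image (fun l => f (nt S l)) = S.image f := by
  ext y
  simp only [mem_image, mem_range]
  constructor
  · rintro ⟨l, hl, rfl⟩
    exact ⟨_, nt_mem hl, rfl⟩
  · rintro ⟨x, hx, rfl⟩
    exact ⟨cn S x, cn_lt_card S x hx, by rw [nt_cn hx]⟩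

/-- reversed sort of an antitone image -/
lemma sort_anti_image (C : Finset ℕ) (f : ℕ → ℕ)
    (hf : ∀ x ∈ C, ∀ y ∈ C, x < y → f y < f x) :
    ((C.image f).sort (· ≤ ·)).reverse = (C.sort (· ≤ ·)).map f := by
  have hpw : ((C.sort (· ≤ ·)).map f).Pairwise (· > ·) := by
    rw [List.pairwise_map]
    have h1 : (C.sort (· ≤ ·)).Pairwise (· < ·) := (Finset.sortedLT_sort C).pairwise
    refine List.Pairwise.imp_of_mem ?_ h1
    intro x y hx hy hxy
    exact hf x ((Finset.mem_sort _).1 hx) y ((Finset.mem_sort _).1 hy) hxy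
  have hnd : ((C.sort (· ≤ ·)).map f).reverse.Nodup := by
    rw [List.nodup_reverse]
    exact hpw.imp (fun h => ne_of_gt h)
  have hs : ((C.sort (· ≤ ·)).map f).reverse.toFinset = C.image f := by
    ext y
    simp
  have := (List.toFinset_sort (· ≤ ·) hnd).2 (by
    rw [List.pairwise_reverse]
    exact hpw.imp (fun h => le_of_lt h))
  rw [← hs, this, List.reverse_reverse]

/-- the transfer map -/
noncomputable def phi (A0 B0 : Finset ℕ) (x : ℕ) : ℕ := nc B0 (cc A0 x)

/-- large element attached to an element of `A` -/
def big (N : ℕ) (A : Finset ℕ) (x : ℕ) : ℕ := N - 1 - cn A x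

/-- the data behind an element of `T(n,a,b)` -/
structure Dat (n a b : ℕ) (A0 C B0 : Finset ℕ) : Prop where
  disj : Disjoint A0 C
  subA : A0 ⊆ range (n + a)
  subC : C ⊆ range (n + a)
  cardA : A0.card + C.card = a
  subB : B0 ⊆ range (n + b)
  cardB : B0.card + C.card = b

section
variable {n a b : ℕ} {A0 C B0 : Finset ℕ}

lemma Dat.notA (h : Dat n a b A0 C B0) {x : ℕ} (hx : x ∈ C) : x ∉ A0 :=
  Finset.disjoint_right.1 h.disj hx

lemma Dat.phi_lt (h : Dat n a b A0 C B0) {x : ℕ} (hx : x ∈ C) : phi A0 B0 x < n + b := by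
  have h1 := cc_strict (h.notA hx) (mem_range.1 (h.subC hx))
  have h2 := cc_add_cn A0 (n + a)
  have h3 := cc_add_cn B0 (n + b)
  rw [cn_full _ _ h.subA] at h2
  rw [cn_full _ _ h.subB] at h3
  have := h.cardA
  have := h.cardB
  by_contra hc
  have h4 := cc_mono B0 (not_lt.1 hc)
  unfold phi at h4
  rw [cc_nc] at h4
  omega

lemma phi_not_mem (A0 B0 : Finset ℕ) (x : ℕ) : phi A0 B0 x ∉ B0 := nc_not_mem _ _

lemma cc_phi (A0 B0 : Finset ℕ) (x : ℕ) : cc B0 (phi A0 B0 x) = cc A0 x := cc_nc _ _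

lemma Dat.phi_phi (h : Dat n a b A0 C B0) {x : ℕ} (hx : x ∈ C) :
    phi B0 A0 (phi A0 B0 x) = x := by
  rw [phi, cc_phi, nc_cc (h.notA hx)]

lemma Dat.phi_strict (h : Dat n a b A0 C B0) {x y : ℕ} (hx : x ∈ C) (hxy : x < y) :
    phi A0 B0 x < phi A0 B0 y := by
  have h1 := cc_strict (h.notA hx) hxy
  by_contra hc
  have h2 := cc_mono B0 (not_lt.1 hc)
  rw [cc_phi, cc_phi] at h2
  omega

lemma Dat.phi_injOn (h : Dat n a b A0 C B0) : Set.InjOn (phi A0 B0) C := by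
  intro x hx y hy hxy
  rw [← h.phi_phi hx, ← h.phi_phi hy, hxy]

lemma Dat.swap (h : Dat n a b A0 C B0) : Dat n b a B0 (C.image (phi A0 B0)) A0 where
  disj := by
    rw [Finset.disjoint_right]
    intro y hy
    obtain ⟨x, hx, rfl⟩ := mem_image.1 hy
    exact phi_not_mem _ _ _
  subA := h.subB
  subC := by
    intro y hy
    obtain ⟨x, hx, rfl⟩ := mem_image.1 hy
    exact mem_range.2 (h.phi_lt hx)
  cardA := by rw [card_image_of_injOn h.phi_injOn]; exact h.cardB
  subB := h.subA
  cardB := by rw [card_image_of_injOn h.phi_injOn]; exact h.cardA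

lemma Dat.image_image (h : Dat n a b A0 C B0) :
    (C.image (phi A0 B0)).image (phi B0 A0) = C := by
  rw [Finset.image_image]
  ext y
  simp only [mem_image, Function.comp]
  constructor
  · rintro ⟨x, hx, rfl⟩
    rwa [h.phi_phi hx]
  · intro hy
    exact ⟨y, hy, h.phi_phi hy⟩

lemma Dat.cn_image (h : Dat n a b A0 C B0) {x : ℕ} (hx : x ∈ C) :
    cn (C.image (phi A0 B0)) (phi A0 B0 x) = cn C x := by
  rw [cn_eq_card, cn_eq_card, Finset.filter_image,
    card_image_of_injOn (h.phi_injOn.mono (Finset.coe_subset.2 (filter_subset _ _)))]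
  congr 1
  ext y
  simp only [mem_filter]
  refine and_congr_right fun hy => ⟨fun hlt => ?_, fun hlt => h.phi_strict hy hlt⟩
  by_contra hc
  rcases (not_lt.1 hc).lt_or_eq with h1 | h1
  · have := h.phi_strict hx h1
    omega
  · subst h1
    omega

/-- the balance identity -/
lemma Dat.balance (h : Dat n a b A0 C B0) {x : ℕ} (hx : x ∈ C) :
    x + cn (B0 ∪ C.image (phi A0 B0)) (phi A0 B0 x) = phi A0 B0 x + cn (A0 ∪ C) x := by
  rw [cn_union _ _ h.disj, cn_union _ _ h.swap.disj, h.cn_image hx]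
  have h1 := cc_add_cn A0 x
  have h2 := cc_add_cn B0 (phi A0 B0 x)
  rw [cc_phi] at h2
  omega

lemma Dat.cn_lt (h : Dat n a b A0 C B0) {x : ℕ} (hx : x ∈ C) : cn (A0 ∪ C) x < a := by
  have := cn_lt_card (A0 ∪ C) x (mem_union_right _ hx)
  rwa [card_union_of_disjoint h.disj, h.cardA] at this

lemma Dat.big_anti (h : Dat n a b A0 C B0) {x : ℕ} (hx : x ∈ C) {y : ℕ} (hy : y ∈ C)
    (hxy : x < y) : big (n + a + b) (A0 ∪ C) y < big (n + a + b) (A0 ∪ C) x := by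
  have h1 := cn_strict (S := A0 ∪ C) (mem_union_right _ hx) hxy
  have h2 := h.cn_lt hy
  unfold big
  omega

lemma Dat.big_ge (h : Dat n a b A0 C B0) {x : ℕ} (hx : x ∈ C) :
    n + b ≤ big (n + a + b) (A0 ∪ C) x ∧ big (n + a + b) (A0 ∪ C) x < n + a + b := by
  have h2 := h.cn_lt hx
  unfold big
  omega

lemma Dat.big_injOn (h : Dat n a b A0 C B0) : Set.InjOn (big (n + a + b) (A0 ∪ C)) C := by
  intro x hx y hy hxy
  rcases lt_trichotomy x y with h1 | h1 | h1
  · have := h.big_anti hx hy h1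
    omega
  · exact h1
  · have := h.big_anti hy hx h1
    omega

lemma Dat.disjB (h : Dat n a b A0 C B0) :
    Disjoint B0 (C.image (big (n + a + b) (A0 ∪ C))) := by
  rw [Finset.disjoint_right]
  intro y hy hy2
  obtain ⟨x, hx, rfl⟩ := mem_image.1 hy
  have := mem_range.1 (h.subB hy2)
  have := (h.big_ge hx).1
  omega

lemma Dat.tmem (h : Dat n a b A0 C B0) :
    Tmem n a b (A0 ∪ C, B0 ∪ C.image (big (n + a + b) (A0 ∪ C))) := by
  refine ⟨union_subset h.subA h.subC, ?_, union_subset ?_ ?_, ?_⟩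
  · simp only
    rw [card_union_of_disjoint h.disj, h.cardA]
  · intro x hx
    have := mem_range.1 (h.subB hx)
    exact mem_range.2 (by omega)
  · intro y hy
    obtain ⟨x, hx, rfl⟩ := mem_image.1 hy
    exact mem_range.2 (h.big_ge hx).2
  · simp only
    rw [card_union_of_disjoint h.disjB, card_image_of_injOn h.big_injOn, h.cardB]

lemma Dat.filter_ge (h : Dat n a b A0 C B0) :
    ((B0 ∪ C.image (big (n + a + b) (A0 ∪ C))).filter fun x => n + b ≤ x)
      = C.image (big (n + a + b) (A0 ∪ C)) := by
  ext y
  simp only [mem_filter, mem_union]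
  constructor
  · rintro ⟨h1 | h1, h2⟩
    · have := mem_range.1 (h.subB h1)
      omega
    · exact h1
  · intro hy
    refine ⟨Or.inr hy, ?_⟩
    obtain ⟨x, hx, rfl⟩ := mem_image.1 hy
    exact (h.big_ge hx).1

lemma Dat.filter_lt (h : Dat n a b A0 C B0) :
    ((B0 ∪ C.image (big (n + a + b) (A0 ∪ C))).filter fun x => x < n + b) = B0 := by
  ext y
  simp only [mem_filter, mem_union]
  constructor
  · rintro ⟨h1 | h1, h2⟩
    · exact h1
    · obtain ⟨x, hx, rfl⟩ := mem_image.1 h1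
      have := (h.big_ge hx).1
      omega
  · intro hy
    exact ⟨Or.inl hy, mem_range.1 (h.subB hy)⟩

lemma Dat.newB (h : Dat n a b A0 C B0) {x : ℕ} (hx : x ∈ C) :
    nc (B0 ∪ C.image (big (n + a + b) (A0 ∪ C))) (cc A0 x) = phi A0 B0 x := by
  have hlt := h.phi_lt hx
  have hnot : phi A0 B0 x ∉ B0 ∪ C.image (big (n + a + b) (A0 ∪ C)) := by
    rw [mem_union, not_or]
    refine ⟨phi_not_mem _ _ _, fun hm => ?_⟩
    obtain ⟨z, hz, hzz⟩ := mem_image.1 hm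
    have := (h.big_ge hz).1
    omega
  have h0 : cn (C.image (big (n + a + b) (A0 ∪ C))) (phi A0 B0 x) = 0 := by
    rw [cn_eq_card, card_eq_zero, filter_eq_empty_iff]
    intro y hy
    obtain ⟨z, hz, rfl⟩ := mem_image.1 hy
    have := (h.big_ge hz).1
    omega
  have h1 := cc_add_cn (B0 ∪ C.image (big (n + a + b) (A0 ∪ C))) (phi A0 B0 x)
  rw [cn_union _ _ h.disjB, h0] at h1
  have h2 := cc_add_cn B0 (phi A0 B0 x)
  rw [cc_phi] at h2
  have h3 : cc A0 x = cc (B0 ∪ C.image (big (n + a + b) (A0 ∪ C))) (phi A0 B0 x) := by omega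
  rw [h3, nc_cc hnot]

lemma Dat.psi (h : Dat n a b A0 C B0) :
    psiMap n a b (A0 ∪ C) (B0 ∪ C.image (big (n + a + b) (A0 ∪ C))) =
      (B0 ∪ C.image (phi A0 B0),
        A0 ∪ (C.image (phi A0 B0)).image
          (big (n + b + a) (B0 ∪ C.image (phi A0 B0)))) := by
  unfold psiMap
  simp only [h.filter_ge, h.filter_lt]
  rw [sort_anti_image C _ (fun x hx y hy hxy => h.big_anti hx hy hxy)]
  simp only [List.length_map, Finset.length_sort, sort_getD]
  have hL : ∀ l ∈ range C.card,
      n + a + b - (List.map (big (n + a + b) (A0 ∪ C)) (C.sort (· ≤ ·))).getD l 0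
        = cn (A0 ∪ C) (nt C l) + 1 := by
    intro l hl
    have hl' := mem_range.1 hl
    have e : (List.map (big (n + a + b) (A0 ∪ C)) (C.sort (· ≤ ·))).getD l 0
        = big (n + a + b) (A0 ∪ C) (nt C l) := by
      rw [← sort_getD]
      simp [List.getD, hl']
    rw [e]
    have := h.cn_lt (nt_mem hl')
    unfold big
    omega
  have hB : ∀ l ∈ range C.card,
      nthCompl (B0 ∪ C.image (big (n + a + b) (A0 ∪ C)))
        (lamSet (A0 ∪ C)
          (n + a + b - (List.map (big (n + a + b) (A0 ∪ C)) (C.sort (· ≤ ·))).getD l 0)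
            + (l + 1)) = phi A0 B0 (nt C l) := by
    intro l hl
    have hl' := mem_range.1 hl
    rw [hL l hl, ← h.newB (nt_mem hl')]
    unfold nthCompl lamSet
    rw [sort_getD, Nat.add_sub_cancel, nt_cn (mem_union_right _ (nt_mem hl'))]
    have h1 := cc_add_cn A0 (nt C l)
    have h2 := cn_union _ _ h.disj (nt C l)
    have h3 := cn_nt hl'
    have h4 := cc_add_cn (A0 ∪ C) (nt C l)
    have h5 : nt C l - cn (A0 ∪ C) (nt C l) + (l + 1) - 1 = cc A0 (nt C l) := by omega
    rw [h5]
    rfl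
  have hJ : (range C.card).image (fun l =>
      n + a + b - (List.map (big (n + a + b) (A0 ∪ C)) (C.sort (· ≤ ·))).getD l 0)
      = C.image (fun x => cn (A0 ∪ C) x + 1) := by
    refine Eq.trans ?_ (image_range_nt C _)
    exact image_congr fun l hl => hL l hl
  have hcard : (A0 ∪ C).card = a := by rw [card_union_of_disjoint h.disj, h.cardA]
  refine Prod.ext ?_ ?_
  · simp only
    congr 1
    refine Eq.trans ?_ (image_range_nt C _)
    exact image_congr fun l hl => hB l hl
  · simp only
    congr 1
    · rw [hJ]
      ext y
      simp only [mem_image, mem_filter, mem_range, not_exists, not_and]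
      constructor
      · rintro ⟨m, ⟨hm, hm2⟩, rfl⟩
        rw [← hcard] at hm
        rcases mem_union.1 (nt_mem hm) with h1 | h1
        · exact h1
        · exact absurd (by rw [cn_nt hm]) (hm2 _ h1)
      · intro hy
        have hy' := mem_union_left C hy
        refine ⟨cn (A0 ∪ C) y, ⟨?_, ?_⟩, nt_cn hy'⟩
        · rw [← hcard]
          exact cn_lt_card _ _ hy'
        · intro x hx hxy
          have := cn_inj (mem_union_right _ hx) hy' (Nat.succ_injective hxy)
          subst this
          exact h.notA hx hy
    · rw [Finset.image_image]
      refine Eq.trans ?_ (image_range_nt C _)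
      refine image_congr fun l hl => ?_
      have hl' := mem_range.1 hl
      simp only [Function.comp]
      rw [hB l hl, hL l hl, Nat.add_sub_cancel, nt_cn (mem_union_right _ (nt_mem hl'))]
      have h1 := h.balance (nt_mem hl')
      unfold big
      omega

lemma Dat.sum (h : Dat n a b A0 C B0) :
    (∑ x ∈ A0 ∪ C, x) + (∑ x ∈ B0 ∪ C.image (big (n + a + b) (A0 ∪ C)), x) =
      (∑ x ∈ A0 ∪ (C.image (phi A0 B0)).image
          (big (n + b + a) (B0 ∪ C.image (phi A0 B0))), x)
        + (∑ x ∈ B0 ∪ C.image (phi A0 B0), x) := by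
  rw [sum_union h.disj, sum_union h.disjB, sum_union h.swap.disjB, sum_union h.swap.disj,
    sum_image h.big_injOn, sum_image h.swap.big_injOn, sum_image h.phi_injOn,
    sum_image h.phi_injOn]
  have key : (∑ x ∈ C, x) + (∑ x ∈ C, big (n + a + b) (A0 ∪ C) x) =
      (∑ x ∈ C, big (n + b + a) (B0 ∪ C.image (phi A0 B0)) (phi A0 B0 x))
        + ∑ x ∈ C, phi A0 B0 x := by
    rw [← sum_add_distrib, ← sum_add_distrib]
    refine sum_congr rfl fun x hx => ?_
    have h1 := h.balance hx
    have h2 := h.cn_lt hx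
    have h3 := h.swap.cn_lt (mem_image_of_mem _ hx)
    unfold big
    omega
  omega

end

lemma exists_dat {n a b : ℕ} {A B : Finset ℕ} (h : Tmem n a b (A, B)) :
    ∃ A0 C B0, Dat n a b A0 C B0 ∧ A = A0 ∪ C ∧
      B = B0 ∪ C.image (big (n + a + b) (A0 ∪ C)) := by
  obtain ⟨hA, hAc, hB, hBc⟩ := h
  simp only at hA hAc hB hBc
  set E := B.filter (fun x => n + b ≤ x) with hE
  set g : ℕ → ℕ := fun e => nt A (n + a + b - 1 - e) with hg
  have hEb : ∀ e ∈ E, n + a + b - 1 - e < A.card ∧ e < n + a + b := by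
    intro e he
    have h1 := mem_filter.1 he
    have h2 := mem_range.1 (hB h1.1)
    have := h1.2
    omega
  have hgb : ∀ e ∈ E, big (n + a + b) A (g e) = e := by
    intro e he
    have h1 := hEb e he
    simp only [hg, big]
    rw [cn_nt h1.1]
    omega
  have hCA : E.image g ⊆ A := by
    intro y hy
    obtain ⟨e, he, rfl⟩ := mem_image.1 hy
    exact nt_mem (hEb e he).1
  have hCc : (E.image g).card = E.card := by
    refine card_image_of_injOn fun x hx y hy hxy => ?_
    rw [← hgb x hx, ← hgb y hy, hxy]
  have hAu : A \ E.image g ∪ E.image g = A := sdiff_union_of_subset hCA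
  refine ⟨A \ E.image g, E.image g, B.filter (fun x => ¬ (n + b ≤ x)), ⟨?_, ?_, ?_, ?_, ?_, ?_⟩,
    hAu.symm, ?_⟩
  · exact sdiff_disjoint
  · exact sdiff_subset.trans hA
  · exact hCA.trans hA
  · rw [card_sdiff_add_card_eq_card hCA, hAc]
  · intro y hy
    have := (mem_filter.1 hy).2
    exact mem_range.2 (by omega)
  · rw [hCc, add_comm, hE, card_filter_add_card_filter_not, hBc]
  · rw [hAu, Finset.image_image]
    have : E.image (big (n + a + b) A ∘ g) = E := by
      conv_rhs => rw [← image_id (s := E)]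
      exact image_congr fun e he => hgb e he
    rw [this, hE, union_comm, filter_union_filter_not_eq]

lemma psi_main (n a b : ℕ) (A B : Finset ℕ) (h : Tmem n a b (A, B)) :
    Tmem n b a (psiMap n a b A B) ∧
    (∑ x ∈ A, x) + (∑ x ∈ B, x) =
      (∑ x ∈ (psiMap n a b A B).2, x) + (∑ x ∈ (psiMap n a b A B).1, x) ∧
    psiMap n b a (psiMap n a b A B).1 (psiMap n a b A B).2 = (A, B) := by
  obtain ⟨A0, C, B0, hd, rfl, rfl⟩ := exists_dat h
  rw [hd.psi]
  refine ⟨hd.swap.tmem, hd.sum, ?_⟩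
  simp only
  rw [hd.swap.psi, hd.image_image]

/-- **Statement 10 (bijective proof of identity (9)).** For `(A₁,B₁) ∈ T(n,a,b)`,
`ψ_{n,a,b}(A₁,B₁) = (B₂,A₂) ∈ T(n,b,a)`, the total sum of elements is preserved,
and `ψ_{n,b,a}(B₂,A₂) = (A₁,B₁)`; in particular `ψ_{n,a,b}` is a sum-preserving bijection
from `T(n,a,b)` onto `T(n,b,a)`. -/
theorem psi_bijection (n a b : ℕ) (A B : Finset ℕ) (h : Tmem n a b (A, B)) :
    Tmem n b a (psiMap n a b A B) ∧
    (∑ x ∈ A, x) + (∑ x ∈ B, x) =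
      (∑ x ∈ (psiMap n a b A B).2, x) + (∑ x ∈ (psiMap n a b A B).1, x) ∧
    psiMap n b a (psiMap n a b A B).1 (psiMap n a b A B).2 = (A, B) ∧
    Set.BijOn (fun p : Finset ℕ × Finset ℕ => psiMap n a b p.1 p.2)
      {p | Tmem n a b p} {p | Tmem n b a p} := by
  obtain ⟨h1, h2, h3⟩ := psi_main n a b A B h
  refine ⟨h1, h2, h3, ?_⟩
  refine Set.InvOn.bijOn (f' := fun p : Finset ℕ × Finset ℕ => psiMap n b a p.1 p.2)
    ⟨?_, ?_⟩ ?_ ?_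
  · rintro ⟨p, q⟩ hp
    exact (psi_main n a b p q hp).2.2
  · rintro ⟨p, q⟩ hp
    exact (psi_main n b a p q hp).2.2
  · rintro ⟨p, q⟩ hp
    exact (psi_main n a b p q hp).1
  · rintro ⟨p, q⟩ hp
    exact (psi_main n b a p q hp).1
end

section
/- Regard M_n^μ(b) as a polynomial in ℤ[q] in independent indeterminates Y₀, Y₁, …. Let E ⊆ {0,…,n+b−1} with |E| = b, and let μ = (ν₁^{e₁},…,ν_p^{e_p}) with 0 ≤ ν₁ < ⋯ < ν_p ≤ n and all e_i > 0. For each i, let f_i ≥ 0 be the multiplicity of ν_i as an entry of λ_E, and let c_i, c_i+1, …, c_i+f_i−1 be the corresponding elements of E. Then the coefficient of the monomial ∏_{i∈E} Y_i in M_n^μ(b) equals Σ_{k₁,…,k_p} ∏_{i=1}^{p} q^{k_i(d_i+k_i−1)} · binom_q(e_i,k_i) · binom_q(f_i,k_i), where d_i = (n+b+Σ_{j=i+1}^{p} e_j) − (c_i+f_i−1) and each k_i ranges over 0 ≤ k_i ≤ min(e_i, f_i). -/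
noncomputable section

open Finset

/-- The ring `ℤ[q][Y₀, Y₁, …]`: polynomials in independent commuting indeterminates
`Y₀, Y₁, …` with coefficients in `ℤ[q]`. -/
abbrev R11 : Type := MvPolynomial ℕ (Polynomial ℤ)

/-- The variable `q` of the coefficient ring `ℤ[q]`. -/
def q11 : Polynomial ℤ := Polynomial.X

/-- The indeterminate `Y_i`. -/
def Y11 (i : ℕ) : R11 := MvPolynomial.X i

/-- The Gaussian (q-)binomial coefficient in `ℤ[q]`. -/
def qb : ℕ → ℕ → Polynomial ℤ
  | _, 0 => 1
  | 0, _ + 1 => 0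
  | n + 1, k + 1 => qb n k + q11 ^ (k + 1) * qb n (k + 1)

/-- `B(m)`: the `m`-th smallest element (1-indexed, `m ≥ 1`) of `ℤ_{≥0} ∖ B`. -/
def Sel11 (B : Finset ℕ) (m : ℕ) : ℕ := Nat.nth (fun x => x ∉ B) (m - 1)

/-- `m_n^μ(B)` for a weakly increasing sequence `μ` of nonnegative integers and
`B ⊆ {0,…,n+a+b−1}` with `|B| = b`, `a = μ.length`: writing
`B ∩ {n+b,…,n+b+a−1} = {n+b+a−j_k < ⋯ < n+b+a−j₁}`,
`m_n^μ(B) = (∏_{i∈B∩{0,…,n+b−1}} Y_i)(∏_{l=1}^{k} q^{(n+b+a−j_l)−B(μ_{j_l}+l)} Y_{B(μ_{j_l}+l)})`. -/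
def mSmall11 (n b : ℕ) (μ : List ℕ) (B : Finset ℕ) : R11 :=
  let a := μ.length
  let L := ((B.filter fun x => n + b ≤ x).sort (· ≤ ·)).reverse
  (∏ i ∈ B.filter (fun x => x < n + b), Y11 i) *
    ∏ l ∈ Finset.range L.length,
      MvPolynomial.C
          (q11 ^ (L.getD l 0 - Sel11 B (μ.getD (n + a + b - L.getD l 0 - 1) 0 + (l + 1)))) *
        Y11 (Sel11 B (μ.getD (n + a + b - L.getD l 0 - 1) 0 + (l + 1)))

/-- The generalized q-binomial coefficient `M_n^μ(b) = Σ_B m_n^μ(B)`. -/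
def Mgen11 (n b : ℕ) (μ : List ℕ) : R11 :=
  ∑ B ∈ Finset.powersetCard b (Finset.range (n + μ.length + b)), mSmall11 n b μ B

theorem sum_single_apply11 (S : Finset ℕ) (x : ℕ) :
    (∑ i ∈ S, Finsupp.single i 1 : ℕ →₀ ℕ) x = if x ∈ S then 1 else 0 := by
  simp [Finsupp.finsetSum_apply, Finsupp.single_apply]

theorem sort_strict11 (S : Finset ℕ) :
    ∀ i j, i < j → j < S.card → (S.sort (· ≤ ·)).getD i 0 < (S.sort (· ≤ ·)).getD j 0 := by
  intro i j hij hj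
  have hj' : j < (S.sort (· ≤ ·)).length := by simpa using hj
  rw [List.getD_eq_getElem _ _ (by omega), List.getD_eq_getElem _ _ hj']
  exact (S.sortedLT_sort).strictMono_get (a := ⟨i, by omega⟩) (b := ⟨j, hj'⟩) hij

theorem sort_image11 (S : Finset ℕ) :
    S = (range S.card).image (fun i => (S.sort (· ≤ ·)).getD i 0) := by
  ext x
  simp only [mem_image, mem_range]
  constructor
  · intro hx
    have : x ∈ S.sort (· ≤ ·) := by simpa using hx
    obtain ⟨i, hi, rfl⟩ := List.mem_iff_getElem.1 this
    exact ⟨i, by simpa using hi, List.getD_eq_getElem _ _ hi⟩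
  · rintro ⟨i, hi, rfl⟩
    have hi' : i < (S.sort (· ≤ ·)).length := by simpa using hi
    rw [List.getD_eq_getElem _ _ hi']
    exact (Finset.mem_sort (· ≤ ·)).1 (List.getElem_mem hi')

theorem rank11 (k : ℕ) (s : ℕ → ℕ) (hs : ∀ i j, i < j → j < k → s i < s j) (l : ℕ) (hl : l < k) :
    (((range k).image s).filter (fun t => t < s l)).card = l := by
  have : ((range k).image s).filter (fun t => t < s l) = (range l).image s := by
    ext x
    simp only [mem_filter, mem_image, mem_range]
    constructor
    · rintro ⟨⟨i, hi, rfl⟩, h⟩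
      refine ⟨i, ?_, rfl⟩
      by_contra hc
      rcases Nat.lt_or_ge l i with h1 | h1
      · have := hs l i h1 hi; omega
      · have : i = l := by omega
        subst this; omega
    · rintro ⟨i, hi, rfl⟩
      exact ⟨⟨i, by omega, rfl⟩, hs i l hi hl⟩
  rw [this, card_image_of_injOn, card_range]
  intro i hi j hj hij
  simp only [coe_range, Set.mem_Iio] at hi hj
  rcases lt_trichotomy i j with h | h | h
  · have := hs i j h (by omega); omega
  · exact h
  · have := hs j i h (by omega); omega

theorem count_add11 (E B : Finset ℕ) (M : ℕ) (hB : ∀ x ∈ B, x < M → x ∈ E) (x : ℕ) (hx : x ≤ M) :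
    Nat.count (fun y => y ∉ B) x =
      Nat.count (fun y => y ∉ E) x + ((E \ B).filter (fun t => t < x)).card := by
  rw [Nat.count_eq_card_filter_range, Nat.count_eq_card_filter_range, ← card_union_of_disjoint]
  · congr 1
    ext y
    simp only [mem_filter, mem_range, mem_union, mem_sdiff]
    constructor
    · rintro ⟨h1, h2⟩
      by_cases h : y ∈ E <;> simp [*]
    · rintro (⟨h1, h2⟩ | ⟨⟨h1, h2⟩, h3⟩)
      · exact ⟨h1, fun h => h2 (hB y h (by omega))⟩
      · exact ⟨h3, h2⟩
  · rw [Finset.disjoint_left]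
    intro y
    simp only [mem_filter, mem_range, mem_sdiff]
    tauto

theorem infc11 (B : Finset ℕ) : {y | y ∉ B}.Infinite := by
  have := B.finite_toSet.infinite_compl
  exact this

/-- validity of `B` with respect to `E` -/
def Valid11 (M : ℕ) (m : ℕ → ℕ) (E B : Finset ℕ) : Prop :=
  (∀ x ∈ B, x < M → x ∈ E) ∧
    ∀ v, ((E \ B).filter (fun t => Nat.count (fun y => y ∉ E) t = v)).card =
      ((B.filter (fun x => M ≤ x)).filter (fun x => m x = v)).card

theorem rev_getD11 (S : Finset ℕ) (l : ℕ) (hl : l < S.card) :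
    (S.sort (· ≤ ·)).reverse.getD l 0 = (S.sort (· ≤ ·)).getD (S.card - 1 - l) 0 := by
  have h1 : l < (S.sort (· ≤ ·)).reverse.length := by simpa using hl
  have h2 : S.card - 1 - l < (S.sort (· ≤ ·)).length := by simp; omega
  rw [List.getD_eq_getElem _ _ h1, List.getD_eq_getElem _ _ h2, List.getElem_reverse]
  congr 1
  simp

theorem rev_strict11 (S : Finset ℕ) (i j : ℕ) (hij : i < j) (hj : j < S.card) :
    (S.sort (· ≤ ·)).reverse.getD j 0 < (S.sort (· ≤ ·)).reverse.getD i 0 := by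
  rw [rev_getD11 S i (by omega), rev_getD11 S j hj]
  exact sort_strict11 S _ _ (by omega) (by omega)

theorem rev_image11 (S : Finset ℕ) :
    S = (range S.card).image (fun i => (S.sort (· ≤ ·)).reverse.getD i 0) := by
  conv_lhs => rw [sort_image11 S]
  ext x
  simp only [mem_image, mem_range]
  constructor
  · rintro ⟨i, hi, rfl⟩
    refine ⟨S.card - 1 - i, by omega, ?_⟩
    rw [rev_getD11 S _ (by omega)]
    congr 1; omega
  · rintro ⟨i, hi, rfl⟩
    exact ⟨S.card - 1 - i, by omega, (rev_getD11 S _ hi).symm⟩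

theorem inj_of_strict11 (k : ℕ) (s : ℕ → ℕ) (hs : ∀ i j, i < j → j < k → s i < s j) :
    Set.InjOn s (range k : Set ℕ) := by
  intro i hi j hj hij
  simp only [coe_range, Set.mem_Iio] at hi hj
  rcases lt_trichotomy i j with h | h | h
  · have := hs i j h (by omega); omega
  · exact h
  · have := hs j i h (by omega); omega

theorem inj_of_anti11 (k : ℕ) (s : ℕ → ℕ) (hs : ∀ i j, i < j → j < k → s j < s i) :
    Set.InjOn s (range k : Set ℕ) := by
  intro i hi j hj hij
  simp only [coe_range, Set.mem_Iio] at hi hj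
  rcases lt_trichotomy i j with h | h | h
  · have := hs i j h (by omega); omega
  · exact h
  · have := hs j i h (by omega); omega

theorem fiber_card11 (k : ℕ) (s g : ℕ → ℕ) (hs : Set.InjOn s (range k : Set ℕ)) (v : ℕ) :
    (((range k).image s).filter (fun t => g t = v)).card =
      ((range k).filter (fun l => g (s l) = v)).card := by
  rw [filter_image, card_image_of_injOn]
  exact hs.mono (by intro x; simp; tauto)

/-- if two weakly increasing sequences have the same fibre sizes they agree -/
theorem seq_eq11 (k : ℕ) (u w : ℕ → ℕ) (hu : ∀ i j, i < j → j < k → u i ≤ u j)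
    (hw : ∀ i j, i < j → j < k → w i ≤ w j)
    (h : ∀ v, ((range k).filter (fun l => u l = v)).card = ((range k).filter (fun l => w l = v)).card) :
    ∀ l < k, u l = w l := by
  have key : ∀ g : ℕ → ℕ, (∀ i j, i < j → j < k → g i ≤ g j) →
      ((List.range k).map g).Pairwise (· ≤ ·) := by
    intro g hg
    rw [List.pairwise_iff_getElem]
    intro i j hi hj hij
    simp at hi hj ⊢
    exact hg i j hij hj
  have hp : ((List.range k).map u).Perm ((List.range k).map w) := by
    rw [← Multiset.coe_eq_coe]
    ext v
    have := h v
    have conv : ∀ g : ℕ → ℕ, Multiset.count v (((List.range k).map g : List ℕ) : Multiset ℕ) =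
      ((range k).filter (fun l => g l = v)).card := by
      intro g
      rw [← Multiset.map_coe, Multiset.count_map]
      simp only [eq_comm (a := v)]
      rfl
    rw [conv, conv, this]
  have := hp.eq_of_pairwise (fun a b _ _ h1 h2 => le_antisymm h1 h2) (key u hu) (key w hw)
  intro l hl
  have h2 := congrArg (fun L => L.getD l 0) this
  simpa [hl] using h2

theorem coreD11 (M k : ℕ) (m : ℕ → ℕ) (E B : Finset ℕ) (hE : ∀ x ∈ E, x < M)
    (h s : ℕ → ℕ) (hanti : ∀ i j, i < j → j < k → h j < h i)
    (him : B.filter (fun x => M ≤ x) = (range k).image h)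
    (hm : ∀ i j, i < j → j < k → m (h i) ≤ m (h j))
    (hs : ∀ l, s l = Nat.nth (fun y => y ∉ B) (m (h l) + l)) :
    ((∑ i ∈ B.filter (fun x => x < M), Finsupp.single i 1 + ∑ l ∈ range k, Finsupp.single (s l) 1 : ℕ →₀ ℕ)
      = ∑ i ∈ E, Finsupp.single i 1) ↔ Valid11 M m E B := by
  have hsm : ∀ i j, i < j → j < k → s i < s j := by
    intro i j hij hj
    rw [hs, hs]
    apply Nat.nth_strictMono (infc11 B)
    have := hm i j hij hj
    omega
  have hinj := inj_of_strict11 k s hsm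
  have hinjh := inj_of_anti11 k h hanti
  have himg : (∑ l ∈ range k, Finsupp.single (s l) 1 : ℕ →₀ ℕ) =
      ∑ i ∈ (range k).image s, Finsupp.single i 1 := by
    rw [sum_image hinj]
  have hsB : ∀ l, s l ∉ B := by
    intro l; rw [hs]; exact Nat.nth_mem_of_infinite (infc11 B) _
  rw [himg]
  constructor
  · intro heq
    have ev : ∀ x, (if x ∈ B.filter (fun x => x < M) then 1 else 0) +
        (if x ∈ (range k).image s then 1 else 0) = if x ∈ E then 1 else 0 := by
      intro x
      have := DFunLike.congr_fun heq x
      rwa [Finsupp.add_apply, sum_single_apply11, sum_single_apply11, sum_single_apply11] at this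
    have h1 : ∀ x ∈ B, x < M → x ∈ E := by
      intro x hx hxM
      have := ev x
      by_contra hc
      simp [hx, hxM, hc] at this
    have hT : E \ B = (range k).image s := by
      ext x
      have := ev x
      rw [mem_sdiff]
      constructor
      · rintro ⟨hxE, hxB⟩
        by_contra hc
        rw [if_neg hc, if_pos hxE, if_neg (by simp [hxB])] at this
        omega
      · intro hx
        refine ⟨?_, ?_⟩
        · by_contra hc
          rw [if_pos hx, if_neg hc] at this
          omega
        · obtain ⟨l, -, rfl⟩ := mem_image.1 hx
          exact hsB l
    refine ⟨h1, fun v => ?_⟩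
    rw [hT, him, fiber_card11 k s _ hinj, fiber_card11 k h _ hinjh]
    congr 1
    apply filter_congr
    intro l hl
    have hl' := mem_range.1 hl
    have hslE : s l ∈ E := by
      have : s l ∈ E \ B := hT ▸ mem_image_of_mem s hl
      exact (mem_sdiff.1 this).1
    have hc := count_add11 E B M h1 (s l) (hE _ hslE).le
    rw [hT, rank11 k s hsm l hl'] at hc
    have : Nat.count (fun y => y ∉ B) (s l) = m (h l) + l := by
      rw [hs]; exact Nat.count_nth_of_infinite (infc11 B) _
    have : Nat.count (fun y => y ∉ E) (s l) = m (h l) := by omega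
    rw [this]
  · rintro ⟨h1, h2⟩
    have hcard : (E \ B).card = k := by
      have e1 := card_eq_sum_card_fiberwise (s := E \ B) (f := fun t => Nat.count (fun y => y ∉ E) t)
        (t := ((E \ B).image fun t => Nat.count (fun y => y ∉ E) t) ∪ ((B.filter (fun x => M ≤ x)).image m))
        (by intro x hx; simp only [coe_union, Set.mem_union, mem_coe]; left; exact mem_image_of_mem _ hx)
      have e2 := card_eq_sum_card_fiberwise (s := B.filter (fun x => M ≤ x)) (f := m)
        (t := ((E \ B).image fun t => Nat.count (fun y => y ∉ E) t) ∪ ((B.filter (fun x => M ≤ x)).image m))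
        (by intro x hx; simp only [coe_union, Set.mem_union, mem_coe]; right; exact mem_image_of_mem _ hx)
      rw [e1]
      simp only [h2]
      rw [← e2, him, card_image_of_injOn hinjh, card_range]
    set t : ℕ → ℕ := fun i => ((E \ B).sort (· ≤ ·)).getD i 0 with ht
    have htm : ∀ i j, i < j → j < k → t i < t j := by
      rw [← hcard]; exact sort_strict11 (E \ B)
    have hti : E \ B = (range k).image t := by
      have := sort_image11 (E \ B)
      rwa [hcard] at this
    have htmem : ∀ l < k, t l ∈ E ∧ t l ∉ B := by
      intro l hl
      rw [← mem_sdiff, hti]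
      exact mem_image_of_mem t (mem_range.2 hl)
    have hseq := seq_eq11 k (fun l => Nat.count (fun y => y ∉ E) (t l)) (fun l => m (h l))
      (by intro i j hij hj; exact Nat.count_monotone _ (htm i j hij hj).le) hm
      (by
        intro v
        have := h2 v
        rw [hti, him, fiber_card11 k t _ (inj_of_strict11 k t htm), fiber_card11 k h _ hinjh] at this
        exact this)
    have hst : ∀ l < k, s l = t l := by
      intro l hl
      have hc := count_add11 E B M h1 (t l) (hE _ (htmem l hl).1).le
      rw [hti, rank11 k t htm l hl] at hc
      have := hseq l hl
      rw [this] at hc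
      rw [hs, ← hc]
      exact Nat.nth_count (p := fun y => y ∉ B) (htmem l hl).2
    have hT : E \ B = (range k).image s := by
      rw [hti]
      apply image_congr
      intro l hl
      exact (hst l (by simpa using hl)).symm
    rw [← hT, ← sum_union]
    · congr 1
      ext x
      simp only [mem_union, mem_filter, mem_sdiff]
      constructor
      · rintro (⟨a, b⟩ | ⟨a, b⟩)
        · exact h1 x a b
        · exact a
      · intro hx
        have := hE x hx
        tauto
    · rw [Finset.disjoint_left]
      intro y
      simp only [mem_filter, mem_sdiff]
      tauto

theorem coreEq11 (M k : ℕ) (m : ℕ → ℕ) (E B : Finset ℕ)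
    (h s : ℕ → ℕ) (hanti : ∀ i j, i < j → j < k → h j < h i)
    (him : B.filter (fun x => M ≤ x) = (range k).image h)
    (hm : ∀ i j, i < j → j < k → m (h i) ≤ m (h j))
    (hs : ∀ l, s l = Nat.nth (fun y => y ∉ B) (m (h l) + l)) (hE : ∀ x ∈ E, x < M)
    (heq : (∑ i ∈ B.filter (fun x => x < M), Finsupp.single i 1 + ∑ l ∈ range k, Finsupp.single (s l) 1 : ℕ →₀ ℕ)
      = ∑ i ∈ E, Finsupp.single i 1) :
    ∑ l ∈ range k, (h l - s l) = ∑ x ∈ B.filter (fun x => M ≤ x), (x - M) + ∑ t ∈ E \ B, (M - t) := by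
  have hsm : ∀ i j, i < j → j < k → s i < s j := by
    intro i j hij hj
    rw [hs, hs]
    apply Nat.nth_strictMono (infc11 B)
    have := hm i j hij hj
    omega
  have hinj := inj_of_strict11 k s hsm
  have hinjh := inj_of_anti11 k h hanti
  have hsB : ∀ l, s l ∉ B := by
    intro l; rw [hs]; exact Nat.nth_mem_of_infinite (infc11 B) _
  rw [← sum_image hinj (f := fun i => Finsupp.single i 1)] at heq
  have hT : E \ B = (range k).image s := by
    ext x
    have := DFunLike.congr_fun heq x
    rw [Finsupp.add_apply, sum_single_apply11, sum_single_apply11, sum_single_apply11] at this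
    rw [mem_sdiff]
    constructor
    · rintro ⟨hxE, hxB⟩
      by_contra hc
      rw [if_neg hc, if_pos hxE, if_neg (by simp [hxB])] at this
      omega
    · intro hx
      refine ⟨?_, ?_⟩
      · by_contra hc
        rw [if_pos hx, if_neg hc] at this
        omega
      · obtain ⟨l, -, rfl⟩ := mem_image.1 hx
        exact hsB l
  rw [hT, him, sum_image hinj, sum_image hinjh, ← sum_add_distrib]
  apply sum_congr rfl
  intro l hl
  have h1 : s l < M := hE _ (by
    have : s l ∈ E \ B := hT ▸ mem_image_of_mem s hl
    exact (mem_sdiff.1 this).1)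
  have h2 : M ≤ h l := by
    have : h l ∈ B.filter (fun x => M ≤ x) := him ▸ mem_image_of_mem h hl
    exact (mem_filter.1 this).2
  omega

open Classical in
theorem coeff_mSmall11 (n b : ℕ) (μ : List ℕ) (E B : Finset ℕ) (hE : E ⊆ range (n + b))
    (hB : B ⊆ range (n + μ.length + b))
    (hμ : ∀ i j, i ≤ j → j < μ.length → μ.getD i 0 ≤ μ.getD j 0) :
    MvPolynomial.coeff (∑ i ∈ E, Finsupp.single i 1) (mSmall11 n b μ B) =
      if Valid11 (n + b) (fun x => μ.getD (n + μ.length + b - x - 1) 0) E B then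
        q11 ^ (∑ x ∈ B.filter (fun x => n + b ≤ x), (x - (n + b)) + ∑ t ∈ E \ B, (n + b - t))
      else 0 := by
  set m : ℕ → ℕ := fun x => μ.getD (n + μ.length + b - x - 1) 0 with hmdef
  set S := B.filter (fun x => n + b ≤ x) with hS
  set h : ℕ → ℕ := fun l => (S.sort (· ≤ ·)).reverse.getD l 0 with hh
  set s : ℕ → ℕ := fun l => Nat.nth (fun y => y ∉ B) (m (h l) + l) with hs
  have hanti : ∀ i j, i < j → j < S.card → h j < h i := rev_strict11 S
  have him : S = (range S.card).image h := rev_image11 S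
  have hE' : ∀ x ∈ E, x < n + b := fun x hx => mem_range.1 (hE hx)
  have hm : ∀ i j, i < j → j < S.card → m (h i) ≤ m (h j) := by
    intro i j hij hj
    have h1 := hanti i j hij hj
    have h2 : h j ∈ S := him ▸ mem_image_of_mem h (mem_range.2 hj)
    have h3 : h i ∈ S := him ▸ mem_image_of_mem h (mem_range.2 (hij.trans hj))
    rw [hS, mem_filter] at h2 h3
    have h4 := mem_range.1 (hB h2.1)
    have h5 := mem_range.1 (hB h3.1)
    apply hμ <;> omega
  have hmono : mSmall11 n b μ B = MvPolynomial.monomial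
      (∑ i ∈ B.filter (fun x => x < n + b), Finsupp.single i 1 +
        ∑ l ∈ range S.card, Finsupp.single (s l) 1)
      (q11 ^ ∑ l ∈ range S.card, (h l - s l)) := by
    have e1 : mSmall11 n b μ B = (∏ i ∈ B.filter (fun x => x < n + b), Y11 i) *
        ∏ l ∈ range S.card, (MvPolynomial.C (q11 ^ (h l - s l)) * Y11 (s l)) := by
      simp only [mSmall11, List.length_reverse, length_sort]
      rfl
    rw [e1]
    have e2 : ∀ l, MvPolynomial.C (q11 ^ (h l - s l)) * Y11 (s l) =
        MvPolynomial.monomial (Finsupp.single (s l) 1) (q11 ^ (h l - s l)) := by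
      intro l
      rw [Y11, MvPolynomial.X, MvPolynomial.C_mul_monomial, mul_one]
    simp only [e2]
    have e3 : ∀ i, Y11 i = MvPolynomial.monomial (Finsupp.single i 1) (1 : Polynomial ℤ) := fun i => rfl
    simp only [e3]
    rw [← MvPolynomial.monomial_sum_one, ← prod_pow_eq_pow_sum]
    have e4 : ∏ l ∈ range S.card, (MvPolynomial.monomial (Finsupp.single (s l) 1) (q11 ^ (h l - s l)))
      = MvPolynomial.monomial (∑ l ∈ range S.card, Finsupp.single (s l) 1)
        (∏ l ∈ range S.card, q11 ^ (h l - s l)) := by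
      induction range S.card using Finset.induction_on with
      | empty => simp
      | insert a t ha ih => rw [prod_insert ha, sum_insert ha, prod_insert ha, ih, MvPolynomial.monomial_mul]
    rw [e4, MvPolynomial.monomial_mul, one_mul]
  rw [hmono, MvPolynomial.coeff_monomial]
  have hiff := coreD11 (n + b) S.card m E B hE' h s hanti him hm (fun l => rfl)
  by_cases hv : Valid11 (n + b) m E B
  · rw [if_pos hv, if_pos (hiff.2 hv)]
    rw [coreEq11 (n + b) S.card m E B h s hanti him hm (fun l => rfl) hE' (hiff.2 hv)]
  · rw [if_neg hv, if_neg (fun h => hv (hiff.1 h))]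

theorem gauss11 (m : ℕ) : ∀ (k D : ℕ) (S : Finset ℕ) (g φ : ℕ → ℕ)
    (_ : Set.InjOn φ (range m : Set ℕ)) (_ : S = (range m).image φ)
    (_ : ∀ j < m, g (φ j) = D + j),
    ∑ T ∈ powersetCard k S, q11 ^ (∑ t ∈ T, g t) = q11 ^ (k * D + k.choose 2) * qb m k := by
  induction m with
  | zero =>
    intro k D S g φ _ hS _
    simp at hS
    subst hS
    cases k with
    | zero => simp [qb]
    | succ k => rw [powersetCard_eq_empty.2 (by simp)]; simp [qb]
  | succ m ih =>
    intro k D S g φ hφ hS hg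
    cases k with
    | zero => simp [qb]
    | succ k =>
      have hinj : Set.InjOn (fun j => φ (j + 1)) (range m : Set ℕ) := by
        intro i hi j hj hij
        simp only [coe_range, Set.mem_Iio] at hi hj
        have := hφ (by simpa using hi) (by simpa using hj) hij
        omega
      have hg' : ∀ j < m, g ((fun j => φ (j + 1)) j) = (D + 1) + j := by
        intro j hj
        simp only
        rw [hg (j + 1) (by omega)]; ring
      set S' := (range m).image (fun j => φ (j + 1)) with hS'
      have hins : S = insert (φ 0) S' := by
        rw [hS, hS', range_add_one', image_insert, map_eq_image, image_image]
        rfl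
      have hni : φ 0 ∉ S' := by
        intro hc
        obtain ⟨j, hj, h⟩ := mem_image.1 hc
        have := hφ (by simpa using mem_range.1 hj) (by simp) h
        omega
      have hT : ∀ T ∈ powersetCard k S', φ 0 ∉ T := fun T hT h => hni ((mem_powersetCard.1 hT).1 h)
      rw [hins, powersetCard_succ_insert hni, sum_union, sum_image]
      · rw [ih (k + 1) (D + 1) S' g _ hinj hS' hg']
        have : ∑ T ∈ powersetCard k S', q11 ^ (∑ t ∈ insert (φ 0) T, g t) =
            q11 ^ D * ∑ T ∈ powersetCard k S', q11 ^ (∑ t ∈ T, g t) := by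
          rw [mul_sum]
          apply sum_congr rfl
          intro T h
          rw [sum_insert (hT T h), hg 0 (by omega), pow_add]; simp
        rw [this, ih k (D + 1) S' g _ hinj hS' hg', qb]
        have hch : (k + 1).choose 2 = k + k.choose 2 := by
          rw [Nat.choose_succ_succ' k 1, Nat.choose_one_right]
        rw [hch]
        ring
      · intro T1 h1 T2 h2 h
        have := congrArg (fun Z => Z.erase (φ 0)) h
        simpa [erase_insert (hT T1 h1), erase_insert (hT T2 h2)] using this
      · rw [Finset.disjoint_left]
        intro T h1 h2
        obtain ⟨T', _, rfl⟩ := mem_image.1 h2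
        exact hni ((mem_powersetCard.1 h1).1 (mem_insert_self _ _))

theorem pair11 (A U : Finset ℕ) (gA gU : ℕ → ℕ) (e f : ℕ) (hA : A.card = f) (hU : U.card = e) :
    ∑ P ∈ (A.powerset ×ˢ U.powerset).filter (fun P => P.1.card = P.2.card),
      q11 ^ (∑ x ∈ P.2, gU x + ∑ t ∈ P.1, gA t) =
    ∑ k ∈ range (min e f + 1), (∑ T ∈ powersetCard k A, q11 ^ (∑ t ∈ T, gA t)) *
      ∑ T ∈ powersetCard k U, q11 ^ (∑ t ∈ T, gU t) := by
  rw [← sum_fiberwise_of_maps_to (t := range (min e f + 1)) (g := fun P => P.1.card)]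
  · apply sum_congr rfl
    intro k _
    rw [sum_mul_sum, ← sum_product']
    apply sum_congr
    · ext P
      simp only [mem_filter, mem_product, mem_powerset, mem_powersetCard]
      constructor
      · rintro ⟨⟨⟨a, b⟩, c⟩, d⟩
        exact ⟨⟨a, d⟩, b, by omega⟩
      · rintro ⟨⟨a, d⟩, b, c⟩
        exact ⟨⟨⟨a, b⟩, by omega⟩, d⟩
    · intro P _
      rw [pow_add, mul_comm]
  · intro P hP
    simp only [mem_filter, mem_product, mem_powerset] at hP
    have h1 := card_le_card hP.1.1
    have h2 := card_le_card hP.1.2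
    rw [mem_range]
    omega

theorem bi_filter11 {p : ℕ} (lam : ℕ → ℕ) (ν : Fin p → ℕ) (hν : Function.Injective ν)
    (g : Fin p → Finset ℕ) (hg : ∀ i, ∀ x ∈ g i, lam x = ν i) (i : Fin p) :
    (univ.biUnion g).filter (fun x => lam x = ν i) = g i := by
  ext x
  simp only [mem_filter, mem_biUnion, mem_univ, true_and]
  constructor
  · rintro ⟨⟨j, hj⟩, h⟩
    have := hg j x hj
    have : j = i := hν (by omega)
    exact this ▸ hj
  · intro h
    exact ⟨⟨i, h⟩, hg i x h⟩

theorem filter_bi11 {p : ℕ} (lam : ℕ → ℕ) (ν : Fin p → ℕ)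
    (T : Finset ℕ) (hT : ∀ x ∈ T, ∃ i, lam x = ν i) :
    univ.biUnion (fun i => T.filter (fun x => lam x = ν i)) = T := by
  ext x
  simp only [mem_filter, mem_biUnion, mem_univ, true_and]
  constructor
  · rintro ⟨i, h, _⟩; exact h
  · intro h
    obtain ⟨i, hi⟩ := hT x h
    exact ⟨i, h, hi⟩

theorem filter_sum11 {p : ℕ} (lam : ℕ → ℕ) (ν : Fin p → ℕ) (hν : Function.Injective ν)
    (T : Finset ℕ) (hT : ∀ x ∈ T, ∃ i, lam x = ν i) (g : ℕ → ℕ) :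
    ∑ i, ∑ x ∈ T.filter (fun x => lam x = ν i), g x = ∑ x ∈ T, g x := by
  conv_rhs => rw [← filter_bi11 lam ν T hT]
  rw [sum_biUnion]
  intro i _ j _ hij
  rw [Function.onFun, Finset.disjoint_left]
  intro x h1 h2
  simp only [mem_filter] at h1 h2
  exact hij (hν (by omega))

open Classical in
theorem factor11 {p : ℕ} (lam m : ℕ → ℕ) (ν : Fin p → ℕ) (hν : Function.Injective ν)
    (E U : Finset ℕ) (hU : ∀ x ∈ U, ∃ i, m x = ν i) (gA gU : ℕ → ℕ) :
    ∑ P ∈ (E.powerset ×ˢ U.powerset).filter (fun P => ∀ v,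
        (P.1.filter (fun x => lam x = v)).card = (P.2.filter (fun x => m x = v)).card),
      q11 ^ (∑ x ∈ P.2, gU x + ∑ t ∈ P.1, gA t) =
    ∏ i, ∑ P ∈ ((E.filter (fun x => lam x = ν i)).powerset ×ˢ
        (U.filter (fun x => m x = ν i)).powerset).filter (fun P => P.1.card = P.2.card),
      q11 ^ (∑ x ∈ P.2, gU x + ∑ t ∈ P.1, gA t) := by
  rw [prod_univ_sum]
  have key : ∀ P ∈ (E.powerset ×ˢ U.powerset).filter (fun P => ∀ v,
        (P.1.filter (fun x => lam x = v)).card = (P.2.filter (fun x => m x = v)).card),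
      (∀ x ∈ P.1, ∃ i, lam x = ν i) ∧ (∀ x ∈ P.2, ∃ i, m x = ν i) := by
    intro P hP
    simp only [mem_filter, mem_product, mem_powerset] at hP
    refine ⟨?_, fun x hx => hU x (hP.1.2 hx)⟩
    intro x hx
    have h1 : 0 < (P.1.filter (fun y => lam y = lam x)).card :=
      card_pos.2 ⟨x, by simp [hx]⟩
    rw [hP.2] at h1
    obtain ⟨y, hy⟩ := card_pos.1 h1
    rw [mem_filter] at hy
    obtain ⟨i, hi⟩ := hU y (hP.1.2 hy.1)
    exact ⟨i, by omega⟩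
  have key2 : ∀ g ∈ Fintype.piFinset (fun i => ((E.filter (fun x => lam x = ν i)).powerset ×ˢ
        (U.filter (fun x => m x = ν i)).powerset).filter (fun P => P.1.card = P.2.card)),
      (∀ i, ∀ x ∈ (g i).1, lam x = ν i) ∧ (∀ i, ∀ x ∈ (g i).2, m x = ν i) := by
    intro g hg
    simp only [Fintype.mem_piFinset, mem_filter, mem_product, mem_powerset] at hg
    exact ⟨fun i x hx => (mem_filter.1 ((hg i).1.1 hx)).2,
      fun i x hx => (mem_filter.1 ((hg i).1.2 hx)).2⟩
  refine sum_bij' (fun P _ i => (P.1.filter (fun x => lam x = ν i), P.2.filter (fun x => m x = ν i)))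
    (fun g _ => (univ.biUnion (fun i => (g i).1), univ.biUnion (fun i => (g i).2))) ?_ ?_ ?_ ?_ ?_
  · intro P hP
    simp only [mem_filter, mem_product, mem_powerset] at hP
    simp only [Fintype.mem_piFinset, mem_filter, mem_product, mem_powerset]
    intro i
    exact ⟨⟨filter_subset_filter _ hP.1.1, filter_subset_filter _ hP.1.2⟩, hP.2 _⟩
  · intro g hg
    obtain ⟨k1, k2⟩ := key2 g hg
    simp only [Fintype.mem_piFinset, mem_filter, mem_product, mem_powerset] at hg
    simp only [mem_filter, mem_product, mem_powerset]
    refine ⟨⟨?_, ?_⟩, ?_⟩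
    · rw [biUnion_subset]
      intro i _
      exact (hg i).1.1.trans (filter_subset _ _)
    · rw [biUnion_subset]
      intro i _
      exact (hg i).1.2.trans (filter_subset _ _)
    · intro v
      by_cases hv : ∃ i, v = ν i
      · obtain ⟨i, rfl⟩ := hv
        rw [bi_filter11 lam ν hν _ k1, bi_filter11 m ν hν _ k2]
        exact (hg i).2
      · rw [filter_eq_empty_iff.2, filter_eq_empty_iff.2]
        · intro x hx h
          simp only [mem_biUnion, mem_univ, true_and] at hx
          obtain ⟨i, hi⟩ := hx
          exact hv ⟨i, by rw [← h]; exact k2 i x hi⟩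
        · intro x hx h
          simp only [mem_biUnion, mem_univ, true_and] at hx
          obtain ⟨i, hi⟩ := hx
          exact hv ⟨i, by rw [← h]; exact k1 i x hi⟩
  · intro P hP
    obtain ⟨k1, k2⟩ := key P hP
    simp only
    rw [filter_bi11 lam ν _ k1, filter_bi11 m ν _ k2]
  · intro g hg
    obtain ⟨k1, k2⟩ := key2 g hg
    funext i
    simp only
    rw [bi_filter11 lam ν hν _ k1, bi_filter11 m ν hν _ k2]
  · intro P hP
    obtain ⟨k1, k2⟩ := key P hP
    simp only
    rw [prod_pow_eq_pow_sum, sum_add_distrib, filter_sum11 lam ν hν _ k1, filter_sum11 m ν hν _ k2]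

theorem card_of_fibers11 (T H : Finset ℕ) (g m : ℕ → ℕ)
    (h : ∀ v, (T.filter (fun x => g x = v)).card = (H.filter (fun x => m x = v)).card) :
    T.card = H.card := by
  have e1 := card_eq_sum_card_fiberwise (s := T) (f := g) (t := T.image g ∪ H.image m)
    (by intro x hx; simp only [coe_union, Set.mem_union, mem_coe]; left; exact mem_image_of_mem _ hx)
  have e2 := card_eq_sum_card_fiberwise (s := H) (f := m) (t := T.image g ∪ H.image m)
    (by intro x hx; simp only [coe_union, Set.mem_union, mem_coe]; right; exact mem_image_of_mem _ hx)
  rw [e1, e2]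
  exact sum_congr rfl (fun v _ => h v)

open Classical in
theorem bij11 (n b a : ℕ) (m : ℕ → ℕ) (E : Finset ℕ) (hE : E ⊆ range (n + b)) (hEc : E.card = b) :
    ∑ B ∈ powersetCard b (range (n + a + b)), (if Valid11 (n + b) m E B then
        q11 ^ (∑ x ∈ B.filter (fun x => n + b ≤ x), (x - (n + b)) + ∑ t ∈ E \ B, (n + b - t))
      else 0) =
    ∑ P ∈ (E.powerset ×ˢ (Ico (n + b) (n + b + a)).powerset).filter (fun P => ∀ v,
        (P.1.filter (fun x => Nat.count (fun y => y ∉ E) x = v)).card =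
          (P.2.filter (fun x => m x = v)).card),
      q11 ^ (∑ x ∈ P.2, (x - (n + b)) + ∑ t ∈ P.1, (n + b - t)) := by
  rw [← sum_filter]
  have hE' : ∀ x ∈ E, x < n + b := fun x hx => mem_range.1 (hE hx)
  have key : ∀ T H : Finset ℕ, T ⊆ E → H ⊆ Ico (n + b) (n + b + a) →
      E \ (E \ T ∪ H) = T ∧ (E \ T ∪ H).filter (fun x => n + b ≤ x) = H := by
    intro T H hT hH
    constructor
    · ext x
      simp only [mem_sdiff, mem_union]
      constructor
      · intro h; by_contra hc; tauto
      · intro h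
        refine ⟨hT h, ?_⟩
        rintro (h1 | h1)
        · exact h1.2 h
        · have := mem_Ico.1 (hH h1)
          have := hE' x (hT h)
          omega
    · ext x
      simp only [mem_filter, mem_sdiff, mem_union]
      constructor
      · rintro ⟨h1 | h1, h2⟩
        · have := hE' x h1.1
          omega
        · exact h1
      · intro h
        exact ⟨Or.inr h, (mem_Ico.1 (hH h)).1⟩
  refine sum_bij' (fun B _ => (E \ B, B.filter (fun x => n + b ≤ x)))
    (fun P _ => (E \ P.1) ∪ P.2) ?_ ?_ ?_ ?_ ?_
  · intro B hB
    simp only [mem_filter, mem_powersetCard] at hB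
    simp only [mem_filter, mem_product, mem_powerset]
    refine ⟨⟨sdiff_subset, ?_⟩, hB.2.2⟩
    intro x hx
    rw [mem_filter] at hx
    have := mem_range.1 (hB.1.1 hx.1)
    rw [mem_Ico]; omega
  · intro P hP
    simp only [mem_filter, mem_product, mem_powerset] at hP
    obtain ⟨⟨h1, h2⟩, h3⟩ := hP
    obtain ⟨k1, k2⟩ := key _ _ h1 h2
    simp only [mem_filter, mem_powersetCard]
    refine ⟨⟨?_, ?_⟩, ?_, ?_⟩
    · intro x hx
      rw [mem_range]
      rcases mem_union.1 hx with h | h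
      · have := hE' x (mem_sdiff.1 h).1; omega
      · have := mem_Ico.1 (h2 h); omega
    · rw [card_union_of_disjoint, card_sdiff_of_subset h1, card_of_fibers11 _ _ _ _ h3, hEc]
      · have := card_le_card h1
        rw [card_of_fibers11 _ _ _ _ h3] at this
        omega
      · rw [Finset.disjoint_left]
        intro x hx hx2
        have := hE' x (mem_sdiff.1 hx).1
        have := mem_Ico.1 (h2 hx2)
        omega
    · intro x hx hxM
      rcases mem_union.1 hx with h | h
      · exact (mem_sdiff.1 h).1
      · have := mem_Ico.1 (h2 h); omega
    · rw [k1, k2]; exact h3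
  · intro B hB
    simp only [mem_filter, mem_powersetCard] at hB
    ext x
    have h1 := hB.2.1 x
    simp only [mem_union, mem_sdiff, mem_filter]
    constructor
    · rintro (h | h)
      · by_contra hc; tauto
      · exact h.1
    · intro h
      rcases Nat.lt_or_ge x (n + b) with h2 | h2
      · left; have := h1 h h2; tauto
      · right; exact ⟨h, h2⟩
  · intro P hP
    simp only [mem_filter, mem_product, mem_powerset] at hP
    obtain ⟨k1, k2⟩ := key _ _ hP.1.1 hP.1.2
    simp only [k1, k2]
  · intro B hB
    rfl

theorem mu_length11 (p : ℕ) (e ν : ℕ → ℕ) :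
    ((List.range p).flatMap fun i => List.replicate (e i) (ν i)).length = ∑ j ∈ range p, e j := by
  induction p with
  | zero => simp
  | succ p ih => rw [List.range_succ, List.flatMap_append, List.length_append, ih, sum_range_succ]; simp

theorem mu_get11 (p : ℕ) (e ν : ℕ → ℕ) (i r : ℕ) (hi : i < p) (hr : r < e i) :
    ((List.range p).flatMap fun i => List.replicate (e i) (ν i)).getD (∑ j ∈ range i, e j + r) 0 = ν i := by
  induction p with
  | zero => omega
  | succ p ih =>
    rw [List.range_succ, List.flatMap_append]
    rcases Nat.lt_or_ge i p with h | h
    · rw [List.getD_append]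
      · exact ih h
      · rw [mu_length11]
        have : ∑ j ∈ range (i + 1), e j ≤ ∑ j ∈ range p, e j :=
          sum_le_sum_of_subset (by intro x; simp only [mem_range]; omega)
        rw [sum_range_succ] at this
        omega
    · have : i = p := by omega
      subst this
      rw [List.getD_append_right _ _ _ _ (by rw [mu_length11]; omega), mu_length11]
      simp [hr]

theorem mu_ex11 (p : ℕ) (e : ℕ → ℕ) (x : ℕ) (hx : x < ∑ j ∈ range p, e j) :
    ∃ i < p, ∃ r < e i, x = ∑ j ∈ range i, e j + r := by
  induction p with
  | zero => simp at hx
  | succ p ih =>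
    rcases Nat.lt_or_ge x (∑ j ∈ range p, e j) with h | h
    · obtain ⟨i, hi, r, hr⟩ := ih h
      exact ⟨i, by omega, r, hr⟩
    · rw [sum_range_succ] at hx
      exact ⟨p, by omega, x - ∑ j ∈ range p, e j, by omega, by omega⟩

theorem two_choose11 (k : ℕ) : k.choose 2 + k.choose 2 = k * (k - 1) := by
  have := Nat.triangle_succ
  rw [Nat.choose_two_right]
  have := Nat.div_mul_cancel (Nat.even_mul_pred_self k).two_dvd
  omega

/-- **Statement 11 (Proposition `Coeff`).** Let `E ⊆ {0,…,n+b−1}` with `|E| = b` and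
`μ = (ν₁^{e₁},…,ν_p^{e_p})` with `0 ≤ ν₁ < ⋯ < ν_p ≤ n`, all `eᵢ > 0`.  Let `fᵢ` be the
multiplicity of `νᵢ` as an entry of `λ_E` and `cᵢ, …, cᵢ+fᵢ−1` the corresponding elements
of `E` (with `λ_E` read off the sorted list `EL` of `E`: its `(m+1)`-th entry is
`EL[m] − m`).  Then the coefficient of `∏_{i∈E} Yᵢ` in `M_n^μ(b)` is
`Σ_{k₁,…,k_p} ∏_{i=1}^{p} q^{kᵢ(dᵢ+kᵢ−1)} binom_q(eᵢ,kᵢ) binom_q(fᵢ,kᵢ)`,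
where `dᵢ = (n+b+Σ_{j>i} e_j) − (cᵢ+fᵢ−1)` and `0 ≤ kᵢ ≤ min(eᵢ,fᵢ)`. -/
theorem Mgen_monomial_coefficient (n b p : ℕ) (hp : 0 < p)
    (ν e f c : ℕ → ℕ)
    (hν : ∀ i j, i < j → j < p → ν i < ν j) (hνn : ν (p - 1) ≤ n) (he : ∀ i < p, 0 < e i)
    (E : Finset ℕ) (hE : E ⊆ Finset.range (n + b)) (hEc : E.card = b)
    -- `fᵢ` is the multiplicity of `νᵢ` as an entry of `λ_E`
    (hf : ∀ i < p,
      f i = ((Finset.range b).filter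
        (fun m => (E.sort (· ≤ ·)).getD m 0 - m = ν i)).card)
    -- the elements of `E` corresponding to the entries of `λ_E` equal to `νᵢ` are
    -- exactly `cᵢ, …, cᵢ+fᵢ−1`
    (hc : ∀ i < p, ∀ m < b,
      ((E.sort (· ≤ ·)).getD m 0 - m = ν i ↔
        c i ≤ (E.sort (· ≤ ·)).getD m 0 ∧ (E.sort (· ≤ ·)).getD m 0 < c i + f i)) :
    letI μL : List ℕ := (List.range p).flatMap fun i => List.replicate (e i) (ν i)
    letI d : ℕ → ℕ := fun i => (n + b + ∑ j ∈ Finset.Ico (i + 1) p, e j) - (c i + f i - 1)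
    MvPolynomial.coeff (∑ i ∈ E, Finsupp.single i 1) (Mgen11 n b μL) =
      ∑ kf ∈ (Finset.univ : Finset ((i : Fin p) → Fin (min (e i) (f i) + 1))),
        ∏ i : Fin p,
          q11 ^ ((kf i : ℕ) * (d (i : ℕ) + (kf i : ℕ) - 1)) *
            qb (e i) (kf i) * qb (f i) (kf i) := by
  classical
  set μL : List ℕ := (List.range p).flatMap fun i => List.replicate (e i) (ν i) with hμL
  set d : ℕ → ℕ := fun i => (n + b + ∑ j ∈ Finset.Ico (i + 1) p, e j) - (c i + f i - 1) with hd0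
  have hlen : μL.length = ∑ j ∈ range p, e j := mu_length11 p e ν
  set a := ∑ j ∈ range p, e j with ha
  have hmono : ∀ i j, i ≤ j → j < μL.length → μL.getD i 0 ≤ μL.getD j 0 := by
    intro x y hxy hy
    rw [hlen] at hy
    obtain ⟨i, hi, r, hr, rfl⟩ := mu_ex11 p e x (by omega)
    obtain ⟨j, hj, s, hs, rfl⟩ := mu_ex11 p e y hy
    rw [mu_get11 p e ν i r hi hr, mu_get11 p e ν j s hj hs]
    rcases lt_trichotomy i j with h | h | h
    · exact (hν i j h hj).le
    · rw [h]
    · have : ∑ t ∈ range (j + 1), e t ≤ ∑ t ∈ range i, e t :=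
        sum_le_sum_of_subset (by intro x; simp only [mem_range]; omega)
      rw [sum_range_succ] at this
      omega
  set m : ℕ → ℕ := fun x => μL.getD (n + μL.length + b - x - 1) 0 with hm
  have step1 : MvPolynomial.coeff (∑ i ∈ E, Finsupp.single i 1) (Mgen11 n b μL) =
    ∑ P ∈ (E.powerset ×ˢ (Ico (n + b) (n + b + μL.length)).powerset).filter (fun P => ∀ v,
        (P.1.filter (fun x => Nat.count (fun y => y ∉ E) x = v)).card =
          (P.2.filter (fun x => m x = v)).card),
      q11 ^ (∑ x ∈ P.2, (x - (n + b)) + ∑ t ∈ P.1, (n + b - t)) := by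
    rw [← bij11 n b μL.length m E hE hEc, Mgen11, MvPolynomial.coeff_sum]
    apply sum_congr rfl
    intro B hB
    exact coeff_mSmall11 n b μL E B hE (mem_powersetCard.1 hB).1 hmono
  have hνinj' : ∀ i j, i < p → j < p → ν i = ν j → i = j := by
    intro i j hi hj h
    rcases lt_trichotomy i j with h1 | h1 | h1
    · have := hν i j h1 hj; omega
    · exact h1
    · have := hν j i h1 hi; omega
  have hνinj : Function.Injective (fun i : Fin p => ν i) := by
    intro i j h
    exact Fin.ext (hνinj' i j i.2 j.2 h)
  have hsplit : ∀ i < p, ∑ j ∈ range i, e j + e i + ∑ j ∈ Ico (i + 1) p, e j = a := by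
    intro i hi
    rw [← sum_range_succ, sum_range_add_sum_Ico _ (by omega)]
  have hUex : ∀ x ∈ Ico (n + b) (n + b + μL.length), ∃ i, ∃ _ : i < p, ∃ r < e i,
      n + μL.length + b - x - 1 = ∑ j ∈ range i, e j + r ∧ m x = ν i := by
    intro x hx
    rw [mem_Ico] at hx
    obtain ⟨i, hi, r, hr, h⟩ := mu_ex11 p e (n + μL.length + b - x - 1) (by omega)
    refine ⟨i, hi, r, hr, h, ?_⟩
    simp only [hm]
    rw [h]
    exact mu_get11 p e ν i r hi hr
  have hU : ∀ x ∈ Ico (n + b) (n + b + μL.length), ∃ i : Fin p, m x = ν i := by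
    intro x hx
    obtain ⟨i, hi, r, hr, h, h2⟩ := hUex x hx
    exact ⟨⟨i, hi⟩, h2⟩
  rw [step1, factor11 _ m (fun i : Fin p => ν i) hνinj E _ hU]
  have hR := prod_univ_sum (fun i : Fin p => (univ : Finset (Fin (min (e i) (f i) + 1))))
    (fun i k => q11 ^ ((k : ℕ) * (d (i : ℕ) + (k : ℕ) - 1)) * qb (e i) k * qb (f i) k)
  rw [Fintype.piFinset_univ] at hR
  rw [← hR]
  apply prod_congr rfl
  rintro ⟨i, hi⟩ -
  simp only
  -- the block of `U`
  have hUi : (Ico (n + b) (n + b + μL.length)).filter (fun x => m x = ν i) =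
      (range (e i)).image (fun j => n + b + ∑ j ∈ Ico (i + 1) p, e j + j) := by
    have hsp := hsplit i hi
    ext x
    simp only [mem_filter, mem_image, mem_range]
    constructor
    · rintro ⟨hx, hmx⟩
      obtain ⟨i', hi', r, hr, h, h2⟩ := hUex x hx
      have : i' = i := hνinj' i' i hi' hi (by omega)
      subst this
      rw [mem_Ico] at hx
      exact ⟨e i' - 1 - r, by omega, by omega⟩
    · rintro ⟨j, hj, rfl⟩
      refine ⟨by rw [mem_Ico]; omega, ?_⟩
      simp only [hm]
      rw [← mu_get11 p e ν i (e i - 1 - j) hi (by omega)]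
      congr 1
      omega
  have hUinj : Set.InjOn (fun j => n + b + ∑ j ∈ Ico (i + 1) p, e j + j) (range (e i) : Set ℕ) := by
    intro x _ y _ h
    simp only at h
    omega
  -- the block of `E`
  have hlam : ∀ l < b, Nat.count (fun y => y ∉ E) ((E.sort (· ≤ ·)).getD l 0) =
      (E.sort (· ≤ ·)).getD l 0 - l := by
    intro l hl
    have h1 := rank11 b (fun l => (E.sort (· ≤ ·)).getD l 0) (hEc ▸ sort_strict11 E) l hl
    have h2 := sort_image11 E
    rw [hEc] at h2
    rw [← h2] at h1
    have h3 := count_add11 E ∅ ((E.sort (· ≤ ·)).getD l 0) (by simp) _ le_rfl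
    rw [sdiff_empty, h1] at h3
    have h4 : Nat.count (fun y => y ∉ (∅ : Finset ℕ)) ((E.sort (· ≤ ·)).getD l 0) =
        (E.sort (· ≤ ·)).getD l 0 := by
      rw [Nat.count_eq_card_filter_range]; simp
    omega
  have hEi : E.filter (fun x => Nat.count (fun y => y ∉ E) x = ν i) = Ico (c i) (c i + f i) := by
    have h2 := sort_image11 E
    rw [hEc] at h2
    apply eq_of_subset_of_card_le
    · intro x hx
      rw [mem_filter] at hx
      have h3 := hx.1
      rw [h2] at h3
      obtain ⟨l, hl, rfl⟩ := mem_image.1 h3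
      rw [mem_range] at hl
      rw [mem_Ico, ← hc i hi l hl, ← hlam l hl]
      exact hx.2
    · rw [Nat.card_Ico, Nat.add_sub_cancel_left, hf i hi]
      have h5 := fiber_card11 b (fun l => (E.sort (· ≤ ·)).getD l 0)
        (fun x => Nat.count (fun y => y ∉ E) x)
        (inj_of_strict11 b _ (hEc ▸ sort_strict11 E)) (ν i)
      rw [← h2] at h5
      rw [h5]
      apply le_of_eq
      congr 1
      apply filter_congr
      intro l hl
      rw [hlam l (mem_range.1 hl)]
  have hEim : Ico (c i) (c i + f i) = (range (f i)).image (fun j => c i + f i - 1 - j) := by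
    ext x
    simp only [mem_Ico, mem_image, mem_range]
    constructor
    · intro h
      exact ⟨c i + f i - 1 - x, by omega, by omega⟩
    · rintro ⟨j, hj, rfl⟩
      omega
  have hEinj : Set.InjOn (fun j => c i + f i - 1 - j) (range (f i) : Set ℕ) := by
    intro x hx y hy h
    simp only [coe_range, Set.mem_Iio] at h hx hy
    omega
  have hbound : 0 < f i → c i + f i - 1 < n + b := by
    intro hfi
    have : c i + f i - 1 ∈ Ico (c i) (c i + f i) := by rw [mem_Ico]; omega
    rw [← hEi, mem_filter] at this
    exact mem_range.1 (hE this.1)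
  rw [pair11 _ _ (fun t => n + b - t) (fun x => x - (n + b)) (e i) (f i)
    (by rw [hEi]; simp) (by rw [hUi, card_image_of_injOn hUinj, card_range])]
  rw [Finset.sum_range]
  apply sum_congr rfl
  rintro ⟨k, hk⟩ -
  simp only
  rw [gauss11 (f i) k (n + b - (c i + f i - 1)) _ (fun t => n + b - t) _ hEinj (hEi.trans hEim)
      (by intro j hj; have := hbound (by omega); omega),
    gauss11 (e i) k (∑ j ∈ Ico (i + 1) p, e j) _ (fun x => x - (n + b)) _ hUinj hUi
      (by intro j hj; omega)]
  have hexp : k * (d i + k - 1) = (k * (n + b - (c i + f i - 1)) + k.choose 2) +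
      (k * (∑ j ∈ Ico (i + 1) p, e j) + k.choose 2) := by
    have h2 := two_choose11 k
    rcases Nat.eq_zero_or_pos k with h0 | h0
    · subst h0; simp
    · have hb := hbound (by omega)
      have hd : d i + k - 1 = (n + b - (c i + f i - 1)) + (∑ j ∈ Ico (i + 1) p, e j) + (k - 1) := by
        simp only [d]; omega
      rw [hd, mul_add, mul_add, ← h2]; ring
  rw [hexp]
  ring
end
end

section
/- Let ν = (τ₁^{e₁},…,τ_p^{e_p}) be a weakly increasing sequence with 0 ≤ τ₁ < ⋯ < τ_p ≤ n and all e_i > 0. Then [n+b+1+Σ_{i=1}^{p} e_i]_q · M_n^ν(b) = Σ_{i=1}^{p} q^{τ_i+Σ_{l=1}^{i−1} e_l} [e_i+1]_q · M_n^{ν(τ_i)}(b) + Σ_{l=0}^{τ₁−1} q^l · M_n^{ν(l)}(b) + Σ_{i=1}^{p−1} Σ_{l=τ_i+1}^{τ_{i+1}−1} q^{(Σ_{j=1}^{i} e_j)+l} · M_n^{ν(l)}(b) + Σ_{l=τ_p+1}^{n} q^{(Σ_{j=1}^{p} e_j)+l} · M_n^{ν(l)}(b). -/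
noncomputable section

open Finset

/-- The base ring `R = ℤ[α, β, ε₁, ε₂, q]`, with variables
`av = α`, `bv = β`, `e1v = ε₁`, `e2v = ε₂`, `qv = q`. -/
abbrev R : Type := MvPolynomial (Fin 5) ℤ

def av : R := MvPolynomial.X 0
def bv : R := MvPolynomial.X 1
def e1v : R := MvPolynomial.X 2
def e2v : R := MvPolynomial.X 3
def qv : R := MvPolynomial.X 4

/-- `[n]_q = 1 + q + ⋯ + q^(n-1)`. -/
def qnum (n : ℕ) : R := ∑ i ∈ Finset.range n, qv ^ i

/-- The Gaussian (q-)binomial coefficient. -/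
def qbinom : ℕ → ℕ → R
  | _, 0 => 1
  | 0, _ + 1 => 0
  | n + 1, k + 1 => qbinom n k + qv ^ (k + 1) * qbinom n (k + 1)

/-- `X_i = α q^i + ε₁ [i]_q`. -/
def Xv (i : ℕ) : R := av * qv ^ i + e1v * qnum i

/-- `Y_i = β q^i + ε₂ [i]_q`. -/
def Yv (i : ℕ) : R := bv * qv ^ i + e2v * qnum i

/-- `b_n = (α+β) q^n + (ε₁+ε₂)[n]_q`. -/
def bcoef (n : ℕ) : R := (av + bv) * qv ^ n + (e1v + e2v) * qnum n

/-- `λ_n = ε₁ε₂[n]_q[n-1]_q + (αε₂+βε₁) q^(n-1) [n]_q + αβ(q^(2n-1) - q^(n-1))` (for `n ≥ 1`). -/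
def lcoef (n : ℕ) : R :=
  e1v * e2v * qnum n * qnum (n - 1) + (av * e2v + bv * e1v) * qv ^ (n - 1) * qnum n
    + av * bv * (qv ^ (2 * n - 1) - qv ^ (n - 1))

/-- The transformed Al-Salam-Chihara polynomials. -/
def phat : ℕ → Polynomial R
  | 0 => 1
  | 1 => Polynomial.X + Polynomial.C (bcoef 0)
  | n + 2 => (Polynomial.X + Polynomial.C (bcoef (n + 1))) * phat (n + 1)
      - Polynomial.C (lcoef (n + 1)) * phat n

/-- `g m i` is the coefficient of `x^i` in `p̂_m(x)`. -/
def g (m i : ℕ) : R := (phat m).coeff i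

/-- `B(m)`: the `m`-th smallest element (1-indexed) of `ℤ_{≥0} ∖ B`, with the
convention `B(0) = −1`. -/
def Sel (B : Finset ℕ) (m : ℕ) : ℤ :=
  if m = 0 then -1 else (Nat.nth (fun x => x ∉ B) (m - 1) : ℤ)

/-- The factor `q^(e − B(idx)) · Y_{B(idx)}`, where `q^m Y₋₁` is interpreted as
`q^(m−1) (β − ε₂)`. -/
def mFactor (B : Finset ℕ) (e : ℕ) (idx : ℕ) : R :=
  if Sel B idx = -1 then qv ^ (e - 1) * (bv - e2v)
  else qv ^ (e - (Sel B idx).toNat) * Yv (Sel B idx).toNat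

/-- `m_n^μ(B)` for a weakly increasing sequence `μ` (a list of integers `≥ −1`) and a
set `B ⊆ {0,…,n+a+b−1}` with `|B| = b`, where `a = μ.length`.  Writing
`B ∩ {n+b,…,n+b+a−1} = {n+b+a−j_k < ⋯ < n+b+a−j₁}`,
`m_n^μ(B) = (∏_{i ∈ B∩{0,…,n+b−1}} Y_i) ∏_{l=1}^{k} q^{(n+b+a−j_l)−B(μ_{j_l}+l)} Y_{B(μ_{j_l}+l)}`. -/
def mSmall (n b : ℕ) (μ : List ℤ) (B : Finset ℕ) : R :=
  let a := μ.length
  let L := ((B.filter fun x => n + b ≤ x).sort (· ≤ ·)).reverse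
  (∏ i ∈ B.filter (fun x => x < n + b), Yv i) *
    ∏ l ∈ Finset.range L.length,
      mFactor B (L.getD l 0) ((μ.getD (n + a + b - L.getD l 0 - 1) 0 + (l + 1 : ℤ)).toNat)

/-- The generalized q-binomial coefficient `M_n^μ(b) = Σ_B m_n^μ(B)`, summed over all
`B ⊆ {0,…,n+a+b−1}` with `|B| = b`. -/
def Mgen (n b : ℕ) (μ : List ℤ) : R :=
  ∑ B ∈ Finset.powersetCard b (Finset.range (n + μ.length + b)), mSmall n b μ B


/-- number of non-elements of `C` below `c` -/
def gc (C : Finset ℕ) (c : ℕ) : ℕ := Nat.count (fun x => x ∉ C) c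

/-- the non-element of `C` number `m` (0-indexed) -/
def nz (C : Finset ℕ) (m : ℕ) : ℕ := Nat.nth (fun x => x ∉ C) m

/-- weighted count of order preserving matchings -/
def Wx (s : ℕ) (C : Finset ℕ) : List ℕ → ℕ → R
  | [], _ => 1
  | m :: μ, x => Wx s C μ x +
      ∑ c ∈ C.filter (fun c => x ≤ c ∧ gc C c = m), qv ^ (s + μ.length - c) * Wx s C μ (c + 1)

/-- block polynomial -/
def KK (P : ℕ) : ℕ → ℕ → R
  | _, 0 => 1
  | f, e + 1 => KK P f e + ∑ i ∈ Finset.range f, qv ^ (P + e + i + 1) * KK P i e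

lemma KK_zero (P e : ℕ) : KK P 0 e = 1 := by
  induction e with
  | zero => rfl
  | succ e ih => simp [KK, ih]

lemma KK_f_zero (P f : ℕ) : KK P f 0 = 1 := by
  simp [KK]

lemma KK_succ (P f e : ℕ) : KK P (f+1) (e+1) =
    KK P f (e+1) + KK P (f+1) e - KK P f e + qv ^ (P + e + f + 1) * KK P f e := by
  simp only [KK, Finset.sum_range_succ]; ring

lemma qnum_add (m k : ℕ) : qnum (m + k) = qnum m + qv ^ m * qnum k := by
  simp [qnum, Finset.sum_range_add, Finset.mul_sum, pow_add]

lemma qnum_zero : qnum 0 = 0 := by simp [qnum]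
lemma qnum_one : qnum 1 = 1 := by simp [qnum]

lemma KK_ident (P f : ℕ) : ∀ e, qnum (e+1) * KK P f (e+1) + qv^(e+1) * qnum P * KK (P+1) f e
    = qnum (e + f + P + 1) * KK P f e := by
  induction f with
  | zero =>
    intro e
    simp only [KK_zero]
    rw [show e + 0 + P + 1 = (e+1) + P by ring, qnum_add (e+1)]; ring
  | succ f ih =>
    have star : ∀ e, qnum P * (KK (P+1) (f+1) e - KK (P+1) f e) + qv^(P+f+1) * qnum e * KK P f e
        = qnum (P+f+1) * (KK P (f+1) e - KK P f e) := by
      intro e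
      induction e with
      | zero => simp [KK_f_zero, qnum_zero]
      | succ e ihe =>
        have h := ih e
        rw [KK_succ, KK_succ]
        have h1 : qnum (e + f + P + 1) = qnum e + qv^e * qnum (P+f+1) := by
          rw [← qnum_add]; congr 1; ring
        rw [h1] at h
        rw [show P + 1 + e + f + 1 = (P+f+1) + (e+1) by ring, show P + e + f + 1 = (P+f+1) + e by ring, pow_add, pow_add qv (P+f+1) e]
        linear_combination ihe + qv^(P+f+1) * h
    intro e
    have h := ih e
    have h2 := star e
    rw [KK_succ]
    have h1 : qnum (e + (f + 1) + P + 1) = qnum (e + f + P + 1) + qv ^ (e+f+P+1) := by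
      rw [show e + (f + 1) + P + 1 = (e + f + P + 1) + 1 by ring, qnum_add, qnum_one, mul_one]
    have h3 : qnum (e + (f + 1) + P + 1) = qnum (e+1) + qv^(e+1) * qnum (P+f+1) := by
      rw [← qnum_add]; congr 1; ring
    have h7 : qnum (e+1) = 1 + qv * qnum e := by
      rw [show e+1 = 1 + e by ring, qnum_add 1, qnum_one, pow_one]
    have h8 : qv^(P+e+f+1) = qv^(e+f+P+1) := by congr 1; ring
    have h9 : qv^(e+f+P+1) * qv = qv^(e+1) * qv^(P+f+1) := by ring
    rw [h8]
    linear_combination h + qv^(e+1) * h2 - KK P (f+1) e * h3 + KK P f e * h3 - KK P f e * h1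
      + KK P f e * qv^(e+f+P+1) * h7 + KK P f e * qnum e * h9

lemma gc_mono (C : Finset ℕ) {x y : ℕ} (h : x ≤ y) : gc C x ≤ gc C y := Nat.count_monotone _ h

lemma gc_succ_notMem (C : Finset ℕ) {x : ℕ} (h : x ∉ C) : gc C (x+1) = gc C x + 1 := by
  simp [gc, Nat.count_succ, h]

lemma gc_succ_mem (C : Finset ℕ) {x : ℕ} (h : x ∈ C) : gc C (x+1) = gc C x := by
  simp [gc, Nat.count_succ, h]

lemma setOf_notMem_infinite (C : Finset ℕ) : (Set.ofPred (fun x => x ∉ C)).Infinite :=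
  (Finset.finite_toSet C).infinite_compl

lemma nz_notMem (C : Finset ℕ) (m : ℕ) : nz C m ∉ C :=
  Nat.nth_mem_of_infinite (setOf_notMem_infinite C) m

lemma gc_nz (C : Finset ℕ) (m : ℕ) : gc C (nz C m) = m :=
  Nat.count_nth_of_infinite (setOf_notMem_infinite C) m

lemma nz_eq (C : Finset ℕ) {m c : ℕ} (h : c ∉ C) (h2 : gc C c = m) : nz C m = c := by
  subst h2; exact Nat.nth_count h

lemma gc_congr (C D : Finset ℕ) (c : ℕ) (h : ∀ x < c, (x ∈ C ↔ x ∈ D)) : gc C c = gc D c := by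
  induction c with
  | zero => simp [gc]
  | succ c ih =>
    have := ih (fun x hx => h x (by omega))
    have h2 := h c (by omega)
    simp only [gc, Nat.count_succ] at *
    rw [this]; simp [h2]

lemma gc_of_subset (C : Finset ℕ) (s : ℕ) (h : C ⊆ Finset.range s) : gc C s + C.card = s := by
  unfold gc
  rw [Nat.count_eq_card_filter_range]
  have : (Finset.range s).filter (fun x => x ∉ C) = Finset.range s \ C := by
    ext; simp
  rw [this, Finset.card_sdiff_of_subset h]
  have := Finset.card_le_card h
  simp at *; omega

lemma Wx_shift (s : ℕ) (C : Finset ℕ) (m : ℕ) (μ : List ℕ) : ∀ x y, x ≤ y →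
    (∀ l ∈ μ, m < l) → (∀ c ∈ C, c < y → gc C c ≤ m) → Wx s C μ x = Wx s C μ y := by
  induction μ with
  | nil => intros; rfl
  | cons l μ ih =>
    intro x y hxy hl hc
    simp only [Wx]
    rw [ih x y hxy (fun l hl' => hl l (by simp [hl'])) hc]
    congr 1
    apply Finset.sum_congr _ (fun _ _ => rfl)
    ext c
    simp only [Finset.mem_filter]
    have h0 := hl l (by simp)
    constructor
    · rintro ⟨h1, h2, h3⟩
      refine ⟨h1, ?_, h3⟩
      by_contra h
      have := hc c h1 (by omega)
      omega
    · rintro ⟨h1, h2, h3⟩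
      exact ⟨h1, by omega, h3⟩

lemma Wx_block (s : ℕ) (C : Finset ℕ) (v z : ℕ) (μ : List ℕ) (hμ : ∀ l ∈ μ, v < l) (hz : z ∉ C)
    (hgz : gc C z = v) (hzs : z ≤ s) (e : ℕ) : ∀ x ≤ z, gc C x = v →
    Wx s C (List.replicate e v ++ μ) x = KK (s + μ.length - z) (z - x) e * Wx s C μ z := by
  induction e with
  | zero =>
    intro x hx hgx
    simp only [List.replicate_zero, List.nil_append, KK_f_zero, one_mul]
    apply Wx_shift s C v μ x z hx hμ
    intro c _ hcz
    rw [← hgz]; exact gc_mono C hcz.le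
  | succ e ih =>
    intro x hx hgx
    have hset : C.filter (fun c => x ≤ c ∧ gc C c = v) = Finset.Ico x z := by
      ext c
      simp only [Finset.mem_filter, Finset.mem_Ico]
      constructor
      · rintro ⟨h1, h2, h3⟩
        refine ⟨h2, ?_⟩
        by_contra h
        have h4 : c ≠ z := by rintro rfl; exact hz h1
        have := gc_mono C (show z + 1 ≤ c by omega)
        rw [gc_succ_notMem C hz] at this
        omega
      · rintro ⟨h1, h2⟩
        have h3 := gc_mono C h1
        have h4 := gc_mono C h2.le
        have h5 : gc C c = v := by omega
        refine ⟨?_, h1, h5⟩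
        by_contra h
        have := gc_mono C (show c + 1 ≤ z by omega)
        rw [gc_succ_notMem C h] at this
        omega
    simp only [List.replicate_succ, List.cons_append, Wx, KK]
    rw [ih x hx hgx, hset, add_mul]
    congr 1
    rw [Finset.sum_mul]
    apply Finset.sum_bij' (fun c _ => z - 1 - c) (fun i _ => z - 1 - i)
    · intro c hc; simp at hc ⊢; omega
    · intro c hc; simp at hc ⊢; omega
    · intro c hc; simp at hc ⊢; omega
    · intro c hc; simp at hc ⊢; omega
    · intro c hc
      rw [← hset] at hc
      have hc2 := hc
      rw [hset] at hc
      simp only [Finset.mem_Ico, Finset.mem_filter] at hc hc2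
      rw [ih (c+1) (by omega) (by rw [gc_succ_mem C hc2.1]; exact hc2.2.2), ← mul_assoc]
      congr 3
      · simp; omega
      · omega

lemma orderedInsert_replicate (l v e : ℕ) (μ : List ℕ) (h : v < l) :
    List.orderedInsert (· ≤ ·) l (List.replicate e v ++ μ) =
      List.replicate e v ++ List.orderedInsert (· ≤ ·) l μ := by
  induction e with
  | zero => rfl
  | succ e ih =>
    simp only [List.replicate_succ, List.cons_append, List.orderedInsert]
    rw [if_neg (by omega), ih]

lemma orderedInsert_replicate_self (v e : ℕ) (μ : List ℕ) (h : ∀ l ∈ μ, v < l) :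
    List.orderedInsert (· ≤ ·) v (List.replicate e v ++ μ) =
      List.replicate (e+1) v ++ μ := by
  cases e with
  | zero =>
    cases μ with
    | nil => rfl
    | cons a μ =>
      have := h a (by simp)
      simp [this.le]
  | succ e =>
    simp [List.replicate_succ]

lemma sorted_split (v : ℕ) (μ : List ℕ) (hs : μ.Pairwise (· ≤ ·)) (hv : ∀ l ∈ μ, v ≤ l) :
    ∃ e μ', μ = List.replicate e v ++ μ' ∧ μ'.Pairwise (· ≤ ·) ∧ ∀ l ∈ μ', v < l := by
  induction μ with
  | nil => exact ⟨0, [], rfl, List.Pairwise.nil, by simp⟩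
  | cons a μ ih =>
    rw [List.pairwise_cons] at hs
    by_cases h : a = v
    · subst h
      obtain ⟨e, μ', h1, h2, h3⟩ := ih hs.2 (fun l hl => hv l (by simp [hl]))
      exact ⟨e+1, μ', by simp [List.replicate_succ, ← h1], h2, h3⟩
    · refine ⟨0, a :: μ, rfl, List.pairwise_cons.2 hs, ?_⟩
      have h0 := hv a (by simp)
      intro l hl
      rcases List.mem_cons.1 hl with rfl | hl
      · omega
      · have := hs.1 l hl; omega

lemma fixed_ident (s n : ℕ) (C : Finset ℕ) (hC : C ⊆ Finset.range s) (hn : n + C.card = s) (k : ℕ) :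
    ∀ v y (μ : List ℕ), v + k = n + 1 → gc C y = v → y ≤ s + 1 → μ.Pairwise (· ≤ ·) →
    (∀ l ∈ μ, v ≤ l) → (∀ l ∈ μ, l ≤ n) →
    ∑ l ∈ Finset.Ico v (n+1), qv ^ (l - v + μ.countP (· < l)) * qnum (μ.count l + 1) *
      Wx s C (List.orderedInsert (· ≤ ·) l μ) y = qnum (s + μ.length + 1 - y) * Wx s C μ y := by
  have hgs : gc C s = n := by have := gc_of_subset C s hC; omega
  have hsC : s ∉ C := fun h => by have := hC h; simp at this
  induction k with
  | zero =>
    intro v y μ hv hy hys hs h1 h2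
    have : μ = [] := by
      cases μ with
      | nil => rfl
      | cons a μ => have := h1 a (by simp); have := h2 a (by simp); omega
    subst this
    have : y = s + 1 := by
      by_contra h
      have := gc_mono C (show y ≤ s by omega)
      omega
    subst this
    rw [show v = n + 1 by omega]
    simp [qnum_zero]
  | succ k ih =>
    intro v y μ hv hy hys hs h1 h2
    obtain ⟨e, μ', rfl, hs', h3⟩ := sorted_split v μ hs h1
    obtain ⟨z, rfl⟩ : ∃ z, z = nz C v := ⟨_, rfl⟩
    have hz := nz_notMem C v
    have hgz := gc_nz C v
    generalize nz C v = z at hz hgz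
    have hzs : z ≤ s := by
      by_contra h
      have := gc_mono C (show s + 1 ≤ z by omega)
      rw [gc_succ_notMem C hsC] at this
      omega
    have hyz : y ≤ z := by
      by_contra h
      have := gc_mono C (show z + 1 ≤ y by omega)
      rw [gc_succ_notMem C hz] at this
      omega
    have hsh : ∀ μ'' : List ℕ, (∀ l ∈ μ'', v < l) → Wx s C μ'' z = Wx s C μ'' (z+1) := by
      intro μ'' h
      apply Wx_shift s C v μ'' z (z+1) (by omega) h
      intro c _ hcz
      rw [← hgz]; exact gc_mono C (by omega)
    have IH := ih (v+1) (z+1) μ' (by omega) (by rw [gc_succ_notMem C hz, hgz]) (by omega) hs'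
      (fun l hl => h3 l hl) (fun l hl => h2 l (by simp [hl]))
    rw [Finset.sum_eq_sum_Ico_succ_bot (by omega)]
    have hcount0 : μ'.count v = 0 := by
      rw [List.count_eq_zero]; intro h; have := h3 v h; omega
    have hcp0 : μ'.countP (· < v) = 0 := by
      rw [List.countP_eq_zero]; intro l h; have := h3 l h; simp; omega
    rw [orderedInsert_replicate_self v e μ' h3, Wx_block s C v z μ' h3 hz hgz hzs _ y hyz hy,
      Wx_block s C v z μ' h3 hz hgz hzs _ y hyz hy]
    have hrest : ∑ l ∈ Finset.Ico (v+1) (n+1), qv ^ (l - v + (List.replicate e v ++ μ').countP (· < l)) *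
        qnum ((List.replicate e v ++ μ').count l + 1) *
        Wx s C (List.orderedInsert (· ≤ ·) l (List.replicate e v ++ μ')) y
        = qv ^ (e+1) * KK (s + μ'.length - z + 1) (z - y) e *
         ∑ l ∈ Finset.Ico (v+1) (n+1), qv ^ (l - (v+1) + μ'.countP (· < l)) * qnum (μ'.count l + 1) *
          Wx s C (List.orderedInsert (· ≤ ·) l μ') (z+1) := by
      rw [Finset.mul_sum]
      apply Finset.sum_congr rfl
      intro l hl
      simp only [Finset.mem_Ico] at hl
      have hins : ∀ l' ∈ List.orderedInsert (· ≤ ·) l μ', v < l' := by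
        intro l' hl'
        rw [List.mem_orderedInsert] at hl'
        rcases hl' with rfl | h
        · omega
        · exact h3 _ h
      rw [orderedInsert_replicate l v e μ' (by omega), Wx_block s C v z _ hins hz hgz hzs _ y hyz hy,
        hsh _ hins, List.orderedInsert_length, List.countP_append, List.count_append,
        List.countP_replicate, List.count_replicate, if_pos (by simp; omega), if_neg (by simp; omega),
        show s + (μ'.length + 1) - z = s + μ'.length - z + 1 by omega,
        show l - v + (e + μ'.countP (· < l)) = (e + 1) + (l - (v+1) + μ'.countP (· < l)) by omega,
        pow_add _ (e+1), Nat.zero_add]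
      ring
    rw [hrest, IH, ← hsh μ' h3, List.countP_append, List.count_append, hcount0, hcp0,
      List.countP_replicate, List.count_replicate, if_neg (by simp), if_pos (by simp)]
    have key := KK_ident (s + μ'.length - z) (z - y) e
    rw [show e + (z - y) + (s + μ'.length - z) + 1 = s + (List.replicate e v ++ μ').length + 1 - y by
      simp; omega] at key
    rw [← mul_assoc (qnum _) (KK _ _ _), ← key, show s + μ'.length + 1 - (z+1) = s + μ'.length - z by omega]
    simp
    ring

lemma nz_insert_gt (C : Finset ℕ) {m t : ℕ} (h : nz C m < t) : nz (insert t C) m = nz C m := by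
  apply nz_eq
  · simp only [Finset.mem_insert, not_or]
    exact ⟨by omega, nz_notMem C m⟩
  · rw [gc_congr (insert t C) C, gc_nz]
    intro x hx
    simp only [Finset.mem_insert]
    constructor
    · rintro (h | h)
      · omega
      · exact h
    · exact Or.inr

lemma nz_lt_nz (C : Finset ℕ) {m m' : ℕ} (h : m < m') : nz C m < nz C m' :=
  Nat.nth_strictMono (setOf_notMem_infinite C) h

lemma nz_lt_of (C : Finset ℕ) {m t : ℕ} (h : m < gc C t) : nz C m < t :=
  Nat.nth_lt_of_lt_count h

/-- the full set `C` attached to `B` -/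
def CC (s : ℕ) : ℕ → List ℕ → Finset ℕ → Finset ℕ
  | _, [], B => B
  | k, m :: μ, B => if s + μ.length ∈ B then
      insert (nz (CC s (k+1) μ (B.erase (s + μ.length))) (m + k))
        (CC s (k+1) μ (B.erase (s + μ.length)))
      else CC s k μ B

lemma nz_CC (s j : ℕ) (μ : List ℕ) : ∀ (k n : ℕ) (B : Finset ℕ),
    B ⊆ Finset.range (s + μ.length) → n + B.card = s → j ≤ n → (∀ l ∈ μ, j < l + k) →
    nz (CC s k μ B) j = nz B j := by
  induction μ with
  | nil => intros; rfl
  | cons m μ ih =>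
    intro k n B hB hn hj hl
    simp only [CC]
    split_ifs with h
    · have h1 : B.erase (s + μ.length) ⊆ Finset.range (s + μ.length) := by
        intro x hx
        rw [Finset.mem_erase] at hx
        have := hB hx.2
        simp at this ⊢; omega
      have h2 := Finset.card_erase_of_mem h
      have h3 : 0 < B.card := Finset.card_pos.2 ⟨_, h⟩
      have IH := ih (k+1) (n+1) (B.erase (s + μ.length)) h1 (by omega) (by omega)
        (fun l hl' => by have := hl l (by simp [hl']); omega)
      have h0 := hl m (by simp)
      rw [nz_insert_gt _ (nz_lt_nz _ h0), IH]
      have h4 := gc_of_subset _ _ h1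
      rw [← nz_insert_gt (B.erase (s + μ.length)) (t := s + μ.length) (nz_lt_of _ (by omega)),
        Finset.insert_erase h]
    · apply ih k n B _ hn hj (fun l hl' => hl l (by simp [hl']))
      intro x hx
      have := hB hx
      have h5 : x ≠ s + μ.length := by rintro rfl; exact h hx
      simp at this ⊢; omega

lemma mFactor_succ (B : Finset ℕ) (e m : ℕ) :
    mFactor B e (m+1) = qv ^ (e - nz B m) * Yv (nz B m) := by
  have h : Sel B (m+1) = (nz B m : ℤ) := by simp [Sel, nz]
  unfold mFactor
  rw [h, if_neg (by omega)]
  simp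

lemma mSmall_skip (n b : ℕ) (m : ℤ) (μ : List ℤ) (B : Finset ℕ)
    (hB : B ⊆ Finset.range (n + b + μ.length)) : mSmall n b (m :: μ) B = mSmall n b μ B := by
  unfold mSmall
  simp only
  congr 1
  apply Finset.prod_congr rfl
  intro l hl
  set L := ((B.filter fun x => n + b ≤ x).sort (· ≤ ·)).reverse with hL
  have hl' : l < L.length := by simpa using hl
  have hLm : ∀ x ∈ L, x ∈ B := by
    intro x hx
    rw [hL] at hx
    simp only [List.mem_reverse, Finset.mem_sort, Finset.mem_filter] at hx
    exact hx.1
  have hmem : L.getD l 0 ∈ B := by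
    rw [List.getD_eq_getElem _ _ hl']
    exact hLm _ (List.getElem_mem hl')
  have := hB hmem
  rw [Finset.mem_range] at this
  rw [List.length_cons, show n + (μ.length + 1) + b - L.getD l 0 - 1 =
    (n + μ.length + b - L.getD l 0 - 1) + 1 by omega, List.getD_cons_succ]

lemma sort_insert_top (B : Finset ℕ) (t : ℕ) (h : ∀ x ∈ B, x < t) :
    ((insert t B).sort (· ≤ ·)).reverse = t :: (B.sort (· ≤ ·)).reverse := by
  have hB : t ∉ B := fun hh => lt_irrefl _ (h t hh)
  have : (insert t B).sort (· ≤ ·) = B.sort (· ≤ ·) ++ [t] := by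
    apply List.Perm.eq_of_pairwise (le := (· ≤ ·))
    · intro a b _ _ h1 h2; exact le_antisymm h1 h2
    · exact Finset.pairwise_sort _ _
    · rw [List.pairwise_append]
      refine ⟨Finset.pairwise_sort _ _, by simp, ?_⟩
      intro a ha b hb
      simp at ha hb
      subst hb
      exact (h a ha).le
    · rw [← Multiset.coe_eq_coe, Finset.sort_eq, ← Multiset.coe_add, Finset.sort_eq,
        Finset.insert_val_of_notMem hB]
      rw [Multiset.coe_singleton, add_comm]; rfl
  rw [this]; simp

lemma mSmall_take (n b k m : ℕ) (μ : List ℕ) (B : Finset ℕ) (t : ℕ) (ht : t = n + b + 1 + μ.length)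
    (hB : B ⊆ Finset.range t) (hb : B.card = b) (hm : m + k ≤ n) (hμ : ∀ l ∈ μ, l + k ≤ n) :
    mSmall n (b+1) ((m :: μ).map (fun x => ((x + k : ℕ) : ℤ))) (insert t B) =
      qv ^ (t - nz B (m+k)) * Yv (nz B (m+k)) *
        mSmall (n+1) b (μ.map (fun x => ((x + (k+1) : ℕ) : ℤ))) B := by
  unfold mSmall
  simp only
  have hlt : ∀ x ∈ B, x < t := fun x hx => by simpa using hB hx
  have hgc := gc_of_subset B t hB
  have hf1 : (insert t B).filter (fun x => x < n + (b+1)) = B.filter (fun x => x < n + 1 + b) := by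
    rw [Finset.filter_insert, if_neg (by omega)]
    apply Finset.filter_congr; intro x _; omega
  have hf2 : (insert t B).filter (fun x => n + (b+1) ≤ x) = insert t (B.filter (fun x => n + 1 + b ≤ x)) := by
    rw [Finset.filter_insert, if_pos (by omega)]
    congr 1
    apply Finset.filter_congr; intro x _; omega
  rw [hf1, hf2, sort_insert_top _ _ (fun x hx => hlt x (Finset.mem_filter.1 hx).1)]
  set L := ((B.filter fun x => n + 1 + b ≤ x).sort (· ≤ ·)).reverse with hL
  have hLlen : L.length ≤ μ.length := by
    rw [hL, List.length_reverse, Finset.length_sort]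
    have : B.filter (fun x => n + 1 + b ≤ x) ⊆ Finset.Ico (n+1+b) t := by
      intro x hx
      rw [Finset.mem_filter] at hx
      have := hlt x hx.1
      simp; omega
    have := Finset.card_le_card this
    simp at this; omega
  rw [List.length_cons, Finset.prod_range_succ']
  have h0 : mFactor (insert t B) ((t :: L).getD 0 0)
      ((((m :: μ).map (fun x => ((x + k : ℕ) : ℤ))).getD (n + ((m :: μ).map (fun x => ((x + k : ℕ) : ℤ))).length + (b+1) - (t :: L).getD 0 0 - 1) 0
        + (((0 : ℕ) : ℤ) + 1)).toNat) = qv ^ (t - nz B (m+k)) * Yv (nz B (m+k)) := by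
    rw [List.getD_cons_zero, show n + ((m :: μ).map (fun x => ((x + k : ℕ) : ℤ))).length + (b+1) - t - 1 = 0 by
      simp; omega, List.map_cons, List.getD_cons_zero,
      show (((m + k : ℕ) : ℤ) + (((0 : ℕ) : ℤ) + 1)).toNat = (m + k) + 1 by omega, mFactor_succ,
      nz_insert_gt B (nz_lt_of B (by omega))]
  rw [h0, mul_comm (∏ k ∈ _, _) (_ * Yv _), mul_left_comm]
  congr 2
  apply Finset.prod_congr rfl
  intro l hl
  have hl' : l < L.length := by simpa using hl
  have hLm : ∀ x ∈ L, x ∈ B.filter (fun x => n + 1 + b ≤ x) := by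
    intro x hx
    rw [hL] at hx
    simpa only [List.mem_reverse, Finset.mem_sort] using hx
  have hmem : L.getD l 0 ∈ B.filter (fun x => n + 1 + b ≤ x) := by
    rw [List.getD_eq_getElem _ _ hl']
    exact hLm _ (List.getElem_mem hl')
  rw [Finset.mem_filter] at hmem
  have h1 := hlt _ hmem.1
  rw [List.getD_cons_succ]
  generalize L.getD l 0 = e at hmem h1
  obtain ⟨i, hi⟩ : ∃ i, i = n + 1 + μ.length + b - e - 1 := ⟨_, rfl⟩
  have hilt : i < μ.length := by omega
  have hx := hμ _ (List.getElem_mem hilt)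
  rw [show n + ((m :: μ).map (fun x => ((x + k : ℕ) : ℤ))).length + (b+1) - e - 1 = i + 1 by
      simp; omega, show n + 1 + (μ.map (fun x => ((x + (k+1) : ℕ) : ℤ))).length + b - e - 1 = i by
      simp; omega, List.map_cons, List.getD_cons_succ,
      List.getD_eq_getElem _ _ (by simpa using hilt), List.getD_eq_getElem _ _ (by simpa using hilt),
      List.getElem_map, List.getElem_map]
  generalize μ[i] = x at hx
  rw [show (((x + k : ℕ) : ℤ) + (((l + 1 : ℕ) : ℤ) + 1)).toNat = (x + k + l + 1) + 1 by omega,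
    show (((x + (k+1) : ℕ) : ℤ) + ((l : ℤ) + 1)).toNat = (x + k + l + 1) + 1 by omega,
    mFactor_succ, mFactor_succ, nz_insert_gt B (nz_lt_of B (by omega))]

lemma gc_erase_le (C : Finset ℕ) (c x : ℕ) (h : x ≤ c) : gc (C.erase c) x = gc C x := by
  apply gc_congr
  intro y hy
  simp only [Finset.mem_erase]
  constructor
  · exact fun h => h.2
  · exact fun h => ⟨by omega, h⟩

lemma gc_erase_gt (C : Finset ℕ) (c x : ℕ) (hc : c ∈ C) (h : c < x) :
    gc (C.erase c) x = gc C x + 1 := by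
  induction x, h using Nat.le_induction with
  | base =>
    rw [gc_succ_notMem _ (by simp), gc_erase_le _ _ _ le_rfl, gc_succ_mem _ hc]
  | succ x hx ih =>
    by_cases h : x ∈ C
    · rw [gc_succ_mem C h, gc_succ_mem _ (by simp [h]; omega), ih]
    · rw [gc_succ_notMem C h, gc_succ_notMem _ (by simp [h]), ih]

lemma Wx_erase (s : ℕ) (C : Finset ℕ) (c k : ℕ) (hc : c ∈ C) (μ : List ℕ) : ∀ x, c < x →
    Wx s (C.erase c) (μ.map (· + (k+1))) x = Wx s C (μ.map (· + k)) x := by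
  induction μ with
  | nil => intros; rfl
  | cons m μ ih =>
    intro x hx
    simp only [List.map_cons, Wx, List.length_map]
    rw [ih x hx]
    congr 1
    have hset : (C.erase c).filter (fun c2 => x ≤ c2 ∧ gc (C.erase c) c2 = m + (k+1)) =
        C.filter (fun c2 => x ≤ c2 ∧ gc C c2 = m + k) := by
      ext c2
      simp only [Finset.mem_filter, Finset.mem_erase]
      constructor
      · rintro ⟨⟨h1, h2⟩, h3, h4⟩
        rw [gc_erase_gt C c c2 hc (by omega)] at h4
        exact ⟨h2, h3, by omega⟩
      · rintro ⟨h2, h3, h4⟩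
        refine ⟨⟨by omega, h2⟩, h3, ?_⟩
        rw [gc_erase_gt C c c2 hc (by omega)]; omega
    rw [hset]
    apply Finset.sum_congr rfl
    intro c2 hc2
    rw [Finset.mem_filter] at hc2
    rw [ih (c2+1) (by omega)]

lemma Wx_erase_zero (s : ℕ) (C : Finset ℕ) (c k m : ℕ) (hc : c ∈ C) (hg : gc C c = m + k)
    (μ : List ℕ) (hμ : ∀ l ∈ μ, m ≤ l) :
    Wx s (C.erase c) (μ.map (· + (k+1))) 0 = Wx s C (μ.map (· + k)) (c+1) := by
  rw [← Wx_erase s C c k hc μ (c+1) (by omega)]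
  apply Wx_shift s _ (m+k) _ 0 (c+1) (by omega)
  · intro l hl
    rw [List.mem_map] at hl
    obtain ⟨l', h1, rfl⟩ := hl
    have := hμ l' h1
    omega
  · intro c2 _ h
    rw [gc_erase_le C c c2 (by omega), ← hg]
    exact gc_mono C (by omega)

lemma CC_empty (s : ℕ) (μ : List ℕ) : ∀ k, CC s k μ ∅ = ∅ := by
  induction μ with
  | nil => intro k; rfl
  | cons m μ ih => intro k; simp [CC, ih]

lemma Wx_empty (s : ℕ) (μ : List ℕ) : ∀ x, Wx s ∅ μ x = 1 := by
  induction μ with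
  | nil => intro k; rfl
  | cons m μ ih => intro k; simp [Wx, ih]

lemma mSmall_empty (n b : ℕ) (μ : List ℤ) : mSmall n b μ ∅ = 1 := by
  simp [mSmall]

lemma mSmall_nil (n b : ℕ) (B : Finset ℕ) (hB : B ⊆ Finset.range (n+b)) :
    mSmall n b [] B = ∏ i ∈ B, Yv i := by
  have h1 : B.filter (fun x => x < n + b) = B := by
    apply Finset.filter_true_of_mem
    intro x hx; simpa using hB hx
  have h2 : B.filter (fun x => n + b ≤ x) = ∅ := by
    apply Finset.filter_false_of_mem
    intro x hx; have := hB hx; simp at this; omega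
  simp [mSmall, h1, h2]

lemma step1 (s : ℕ) (μ : List ℕ) : ∀ (k n b : ℕ) (h : Finset ℕ → R), n + b = s →
    μ.Pairwise (· ≤ ·) → (∀ l ∈ μ, l + k ≤ n) →
    ∑ B ∈ Finset.powersetCard b (Finset.range (s + μ.length)),
      mSmall n b (μ.map (fun x => ((x + k : ℕ) : ℤ))) B * h (CC s k μ B) =
    ∑ C ∈ Finset.powersetCard b (Finset.range s),
      (∏ i ∈ C, Yv i) * Wx s C (μ.map (· + k)) 0 * h C := by
  induction μ with
  | nil =>
    intro k n b h hs _ _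
    apply Finset.sum_congr rfl
    intro B hB
    rw [Finset.mem_powersetCard] at hB
    simp only [List.map_nil, Wx, CC, mul_one]
    rw [mSmall_nil _ _ _ (by rw [hs]; exact hB.1)]
  | cons m μ ih =>
    intro k n b h hs hp hl
    cases b with
    | zero =>
      simp [mSmall_empty, CC_empty, Wx_empty]
    | succ b =>
      rw [List.pairwise_cons] at hp
      have hm := hl m (by simp)
      have hl' : ∀ l ∈ μ, l + k ≤ n := fun l h => hl l (by simp [h])
      set t := s + μ.length with ht
      have hr : Finset.range (s + (m :: μ).length) = insert t (Finset.range t) := by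
        rw [← Finset.range_add_one]; rfl
      have htn : t ∉ Finset.range t := by simp
      rw [hr, Finset.powersetCard_succ_insert htn, Finset.sum_union, Finset.sum_image]
      · simp only [List.map_cons, Wx, mul_add, add_mul, List.length_map]
        rw [Finset.sum_add_distrib]
        congr 1
        · rw [← ih k n (b+1) h hs hp.2 hl']
          apply Finset.sum_congr rfl
          intro B hB
          rw [Finset.mem_powersetCard] at hB
          rw [mSmall_skip _ _ _ _ _ (by rw [hs, List.length_map]; exact hB.1)]
          have : t ∉ B := fun hh => htn (hB.1 hh)
          simp only [CC]
          rw [if_neg this]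
        · have IH := ih (k+1) (n+1) b (fun C' => qv ^ (t - nz C' (m+k)) * Yv (nz C' (m+k)) *
            h (insert (nz C' (m+k)) C')) (by omega) hp.2 (fun l h => by have := hl' l h; omega)
          trans (∑ B ∈ Finset.powersetCard b (Finset.range t),
            mSmall (n+1) b (μ.map (fun x => ((x + (k+1) : ℕ) : ℤ))) B *
            (fun C' => qv ^ (t - nz C' (m+k)) * Yv (nz C' (m+k)) *
            h (insert (nz C' (m+k)) C')) (CC s (k+1) μ B))
          · apply Finset.sum_congr rfl
            intro B hB
            rw [Finset.mem_powersetCard] at hB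
            have htB : t ∉ B := fun hh => htn (hB.1 hh)
            have := mSmall_take n b k m μ B t (by omega) hB.1 hB.2 hm hl'
            rw [List.map_cons] at this
            rw [this]
            simp only [CC]
            rw [if_pos (by simp [ht]), ← ht, Finset.erase_insert htB,
              nz_CC s (m+k) μ (k+1) (n+1) B hB.1 (by omega) (by omega)
                (fun l h => by have := hp.1 l h; omega)]
            ring
          · rw [IH]
            simp only [Finset.mul_sum, Finset.sum_mul]
            rw [Finset.sum_sigma']
            refine Finset.sum_bij' (fun C' _ => (⟨insert (nz C' (m+k)) C', nz C' (m+k)⟩ : (_ : Finset ℕ) × ℕ))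
              (fun p _ => p.1.erase p.2) ?_ ?_ ?_ ?_ ?_
            · intro C' hC'
              rw [Finset.mem_powersetCard] at hC'
              have hg := gc_of_subset C' s hC'.1
              have hlt : nz C' (m+k) < s := nz_lt_of C' (by omega)
              have hnm := nz_notMem C' (m+k)
              simp only [Finset.mem_sigma, Finset.mem_powersetCard, Finset.mem_filter,
                Finset.mem_insert, true_or, true_and, Nat.zero_le]
              refine ⟨⟨?_, ?_⟩, ?_⟩
              · intro x hx
                rcases Finset.mem_insert.1 hx with rfl | hx
                · simpa using hlt
                · exact hC'.1 hx
              · rw [Finset.card_insert_of_notMem hnm, hC'.2]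
              · rw [← gc_erase_le _ (nz C' (m+k)) _ le_rfl, Finset.erase_insert hnm, gc_nz]
            · intro p hp
              simp only [Finset.mem_sigma, Finset.mem_powersetCard, Finset.mem_filter] at hp
              rw [Finset.mem_powersetCard]
              refine ⟨(Finset.erase_subset _ _).trans hp.1.1, ?_⟩
              rw [Finset.card_erase_of_mem hp.2.1, hp.1.2]; rfl
            · intro C' hC'
              exact Finset.erase_insert (nz_notMem C' (m+k))
            · rintro ⟨C, c⟩ hp
              simp only [Finset.mem_sigma, Finset.mem_powersetCard, Finset.mem_filter] at hp
              have hnz : nz (C.erase c) (m+k) = c := by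
                apply nz_eq _ (by simp)
                rw [gc_erase_le _ _ _ le_rfl]; exact hp.2.2.2
              simp only [hnz]
              rw [Finset.insert_erase hp.2.1]
            · intro C' hC'
              have hnm := nz_notMem C' (m+k)
              have hgc : gc (insert (nz C' (m+k)) C') (nz C' (m+k)) = m + k := by
                rw [← gc_erase_le _ (nz C' (m+k)) _ le_rfl, Finset.erase_insert hnm, gc_nz]
              have := Wx_erase_zero s (insert (nz C' (m+k)) C') (nz C' (m+k)) k m (by simp) hgc μ hp.1
              rw [Finset.erase_insert hnm] at this
              simp only
              rw [← this, Finset.prod_insert hnm]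
              ring
      · intro B hB B' hB' heq
        simp only [Finset.mem_coe, Finset.mem_powersetCard] at hB hB'
        have h1 : t ∉ B := fun hh => htn (hB.1 hh)
        have h2 : t ∉ B' := fun hh => htn (hB'.1 hh)
        rw [← Finset.erase_insert h1, heq, Finset.erase_insert h2]
      · rw [Finset.disjoint_left]
        intro B hB hB2
        rw [Finset.mem_powersetCard] at hB
        rw [Finset.mem_image] at hB2
        obtain ⟨B', _, rfl⟩ := hB2
        exact htn (hB.1 (by simp))

lemma Mgen_eq (n b : ℕ) (μ : List ℕ) (hp : μ.Pairwise (· ≤ ·)) (hl : ∀ l ∈ μ, l ≤ n) :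
    Mgen n b (μ.map (fun x : ℕ => (x : ℤ))) = ∑ C ∈ Finset.powersetCard b (Finset.range (n+b)),
      (∏ i ∈ C, Yv i) * Wx (n+b) C μ 0 := by
  have := step1 (n+b) μ 0 n b (fun _ => 1) rfl hp (by simpa using hl)
  simp only [add_zero, List.map_id', mul_one] at this
  rw [← this, Mgen, List.length_map, show n + μ.length + b = n + b + μ.length by ring]

lemma Mgen_ident_nat (n b : ℕ) (μ : List ℕ) (hp : μ.Pairwise (· ≤ ·)) (hl : ∀ l ∈ μ, l ≤ n) :
    ∑ l ∈ Finset.range (n+1), qv ^ (l + μ.countP (· < l)) * qnum (μ.count l + 1) *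
      Mgen n b ((List.orderedInsert (· ≤ ·) l μ).map (fun x : ℕ => (x : ℤ))) =
    qnum (n + b + 1 + μ.length) * Mgen n b (μ.map (fun x : ℕ => (x : ℤ))) := by
  rw [Mgen_eq n b μ hp hl, Finset.mul_sum]
  have h1 : ∀ l ∈ Finset.range (n+1), qv ^ (l + μ.countP (· < l)) * qnum (μ.count l + 1) *
      Mgen n b ((List.orderedInsert (· ≤ ·) l μ).map (fun x : ℕ => (x : ℤ))) =
      ∑ C ∈ Finset.powersetCard b (Finset.range (n+b)), (∏ i ∈ C, Yv i) *
        (qv ^ (l - 0 + μ.countP (· < l)) * qnum (μ.count l + 1) *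
          Wx (n+b) C (List.orderedInsert (· ≤ ·) l μ) 0) := by
    intro l hl'
    rw [Finset.mem_range] at hl'
    rw [Mgen_eq n b _ (List.Pairwise.orderedInsert l μ hp), Finset.mul_sum]
    · apply Finset.sum_congr rfl
      intro C _
      rw [Nat.sub_zero]; ring
    · intro x hx
      rw [List.mem_orderedInsert] at hx
      rcases hx with rfl | hx
      · omega
      · exact hl x hx
  rw [Finset.sum_congr rfl h1, Finset.sum_comm]
  apply Finset.sum_congr rfl
  intro C hC
  rw [Finset.mem_powersetCard] at hC
  rw [← Finset.mul_sum, Finset.range_eq_Ico,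
    fixed_ident (n+b) n C hC.1 (by omega) (n+1) 0 0 μ (by omega) (by simp [gc]) (by omega) hp
      (by simp) hl, show n + b + μ.length + 1 - 0 = n + b + 1 + μ.length by omega]
  ring

/-- the sequence over the naturals -/
def nuN (p : ℕ) (τ e : ℕ → ℕ) : List ℕ := (List.range p).flatMap fun i => List.replicate (e i) (τ i)

lemma nuN_succ (p : ℕ) (τ e : ℕ → ℕ) :
    nuN (p+1) τ e = nuN p τ e ++ List.replicate (e p) (τ p) := by
  simp [nuN, List.range_succ]

lemma nuN_map (p : ℕ) (τ e : ℕ → ℕ) : (nuN p τ e).map (fun x : ℕ => (x : ℤ)) =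
    (List.range p).flatMap fun i => List.replicate (e i) ((τ i : ℤ)) := by
  simp [nuN, List.map_flatMap]

lemma nuN_length (p : ℕ) (τ e : ℕ → ℕ) : (nuN p τ e).length = ∑ i ∈ Finset.range p, e i := by
  induction p with
  | zero => rfl
  | succ p ih => rw [nuN_succ, List.length_append, ih, Finset.sum_range_succ, List.length_replicate]

lemma nuN_countP (p : ℕ) (τ e : ℕ → ℕ) (Q : ℕ → Bool) :
    (nuN p τ e).countP Q = ∑ i ∈ Finset.range p, if Q (τ i) then e i else 0 := by
  induction p with
  | zero => rfl
  | succ p ih => rw [nuN_succ, List.countP_append, ih, Finset.sum_range_succ, List.countP_replicate]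

lemma nuN_mem (p : ℕ) (τ e : ℕ → ℕ) (x : ℕ) (h : x ∈ nuN p τ e) : ∃ i < p, x = τ i := by
  simp only [nuN, List.mem_flatMap, List.mem_range, List.mem_replicate] at h
  obtain ⟨i, h1, _, h2⟩ := h
  exact ⟨i, h1, h2⟩

lemma nuN_sorted (p : ℕ) (τ e : ℕ → ℕ) (hτ : ∀ i j, i < j → j < p → τ i < τ j) :
    (nuN p τ e).Pairwise (· ≤ ·) := by
  induction p with
  | zero => exact List.Pairwise.nil
  | succ p ih =>
    rw [nuN_succ, List.pairwise_append]
    refine ⟨ih (fun i j h1 h2 => hτ i j h1 (by omega)), ?_, ?_⟩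
    · simp [List.pairwise_replicate]
    · intro a ha b hb
      obtain ⟨i, hi, rfl⟩ := nuN_mem _ _ _ _ ha
      rw [(List.mem_replicate.1 hb).2]
      exact (hτ i p hi (by omega)).le

lemma orderedInsert_cast (l : ℕ) (μ : List ℕ) :
    List.orderedInsert (· ≤ ·) (l : ℤ) (μ.map (fun x : ℕ => (x : ℤ))) =
      (List.orderedInsert (· ≤ ·) l μ).map (fun x : ℕ => (x : ℤ)) := by
  induction μ with
  | nil => rfl
  | cons a μ ih =>
    simp only [List.map_cons, List.orderedInsert]
    by_cases h : l ≤ a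
    · rw [if_pos h, if_pos (by exact_mod_cast h)]; rfl
    · rw [if_neg h, if_neg (by exact_mod_cast h), ih]; rfl

lemma sum_decomp (F : ℕ → R) (p : ℕ) (τ : ℕ → ℕ) (hτ : ∀ i j, i < j → j < p + 1 → τ i < τ j) :
    ∑ l ∈ Finset.range (τ p + 1), F l = ∑ i ∈ Finset.range (p+1), F (τ i) +
      ∑ l ∈ Finset.range (τ 0), F l +
      ∑ i ∈ Finset.range p, ∑ l ∈ Finset.Ico (τ i + 1) (τ (i+1)), F l := by
  induction p with
  | zero => simp [Finset.sum_range_succ, add_comm]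
  | succ p ih =>
    have h := hτ p (p+1) (by omega) (by omega)
    rw [Finset.sum_range_succ, ← Finset.sum_range_add_sum_Ico F (show τ p + 1 ≤ τ (p+1) by omega),
      ih (fun i j h1 h2 => hτ i j h1 (by omega)), Finset.sum_range_succ _ (p+1),
      Finset.sum_range_succ _ p]
    rw [Finset.sum_range_succ (fun i => ∑ l ∈ Finset.Ico (τ i + 1) (τ (i+1)), F l) p]
    ring

/-- **Statement 14 (Lemma `t`, first identity).** For `ν = (τ₁^{e₁},…,τ_p^{e_p})` with
`0 ≤ τ₁ < ⋯ < τ_p ≤ n` and all `eᵢ > 0` (here `τ, e : ℕ → ℕ` are indexed from `0`, so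
`τ 0 = τ₁`, …, `τ (p−1) = τ_p`), denoting by `ν(i)` the weakly increasing sequence
obtained from `ν` by inserting one extra entry equal to `i`:
`[n+b+1+Σᵢ eᵢ]_q M_n^ν(b)
 = Σ_{i=1}^{p} q^{τᵢ+Σ_{l<i}e_l}[eᵢ+1]_q M_n^{ν(τᵢ)}(b) + Σ_{l=0}^{τ₁−1} q^l M_n^{ν(l)}(b)
   + Σ_{i=1}^{p−1} Σ_{l=τᵢ+1}^{τ_{i+1}−1} q^{(Σ_{j≤i}e_j)+l} M_n^{ν(l)}(b)
   + Σ_{l=τ_p+1}^{n} q^{(Σ_j e_j)+l} M_n^{ν(l)}(b)`. -/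
theorem Mgen_multiplication_identity (n b p : ℕ) (hp : 0 < p) (τ e : ℕ → ℕ)
    (hτ : ∀ i j, i < j → j < p → τ i < τ j) (he : ∀ i < p, 0 < e i)
    (hτn : τ (p - 1) ≤ n) :
    letI ν : List ℤ := (List.range p).flatMap fun i => List.replicate (e i) ((τ i : ℤ))
    letI ins : ℤ → List ℤ := fun x => List.orderedInsert (· ≤ ·) x ν
    qnum (n + b + 1 + ∑ i ∈ Finset.range p, e i) * Mgen n b ν =
      (∑ i ∈ Finset.range p,
          qv ^ (τ i + ∑ l ∈ Finset.range i, e l) * qnum (e i + 1) *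
            Mgen n b (ins ((τ i : ℤ)))) +
        (∑ l ∈ Finset.range (τ 0), qv ^ l * Mgen n b (ins ((l : ℤ)))) +
        (∑ i ∈ Finset.range (p - 1),
          ∑ l ∈ Finset.Ico (τ i + 1) (τ (i + 1)),
            qv ^ ((∑ j ∈ Finset.range (i + 1), e j) + l) * Mgen n b (ins ((l : ℤ)))) +
        (∑ l ∈ Finset.Ico (τ (p - 1) + 1) (n + 1),
          qv ^ ((∑ j ∈ Finset.range p, e j) + l) * Mgen n b (ins ((l : ℤ)))) := by
  simp only
  obtain ⟨p, rfl⟩ : ∃ p', p = p' + 1 := ⟨p - 1, by omega⟩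
  have hpp : p + 1 - 1 = p := rfl
  rw [hpp] at hτn ⊢
  rw [← nuN_map]
  simp only [orderedInsert_cast]
  have hmono : ∀ i j, i ≤ j → j < p + 1 → τ i ≤ τ j := by
    intro i j h1 h2
    rcases Nat.lt_or_ge i j with h | h
    · exact (hτ i j h h2).le
    · rw [show i = j by omega]
  have hlt : ∀ i j, i < p + 1 → τ i < τ j → i < j := by
    intro i j h1 h2
    by_contra h
    have := hmono j i (by omega) h1
    omega
  have hle : ∀ l ∈ nuN (p+1) τ e, l ≤ n := by
    intro l hl
    obtain ⟨i, hi, rfl⟩ := nuN_mem _ _ _ _ hl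
    exact (hmono i p (by omega) (by omega)).trans hτn
  have main := Mgen_ident_nat n b (nuN (p+1) τ e) (nuN_sorted _ _ _ hτ) hle
  rw [nuN_length] at main
  rw [← main]
  -- counting lemmas
  have hcp : ∀ l k, k ≤ p + 1 → (∀ i < k, τ i < l) → (∀ i, k ≤ i → i < p + 1 → l ≤ τ i) →
      (nuN (p+1) τ e).countP (· < l) = ∑ j ∈ Finset.range k, e j := by
    intro l k hk h1 h2
    rw [nuN_countP, ← Finset.sum_range_add_sum_Ico _ hk]
    rw [Finset.sum_eq_zero (s := Finset.Ico k (p+1)), add_zero]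
    · apply Finset.sum_congr rfl
      intro i hi
      rw [if_pos (by simpa using h1 i (by simpa using hi))]
    · intro i hi
      rw [Finset.mem_Ico] at hi
      rw [if_neg (by simpa using h2 i hi.1 hi.2)]
  have hc0 : ∀ l, (∀ i < p + 1, τ i ≠ l) → (nuN (p+1) τ e).count l = 0 := by
    intro l h
    rw [List.count_eq_zero]
    intro hm
    obtain ⟨i, hi, h2⟩ := nuN_mem _ _ _ _ hm
    exact h i hi h2.symm
  have hcτ : ∀ i < p + 1, (nuN (p+1) τ e).count (τ i) = e i := by
    intro i hi
    rw [List.count, nuN_countP, Finset.sum_eq_single i]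
    · simp
    · intro j hj hne
      rw [Finset.mem_range] at hj
      rw [if_neg]
      simp only [beq_iff_eq]
      intro h
      rcases Nat.lt_or_gt_of_ne hne with h1 | h1
      · have := hτ j i h1 hi; omega
      · have := hτ i j h1 hj; omega
    · intro h; simp at h; omega
  have hsplit : ∀ l k, k ≤ p + 1 → (∀ i < k, τ i < l) → (∀ i, k ≤ i → i < p + 1 → l < τ i) →
      (nuN (p+1) τ e).countP (· < l) = ∑ j ∈ Finset.range k, e j ∧
      (nuN (p+1) τ e).count l = 0 := by
    intro l k hk h1 h2
    refine ⟨hcp l k hk h1 (fun i h3 h4 => (h2 i h3 h4).le), hc0 l ?_⟩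
    intro i hi h
    rcases Nat.lt_or_ge i k with h3 | h3
    · have := h1 i h3; omega
    · have := h2 i h3 hi; omega
  rw [← Finset.sum_range_add_sum_Ico _ (show τ p + 1 ≤ n + 1 by omega), sum_decomp _ p τ hτ]
  refine congrArg₂ (fun x y : R => x + y) ?_ ?_
  · refine congrArg₂ (fun x y : R => x + y) ?_ ?_
    · refine congrArg₂ (fun x y : R => x + y) ?_ ?_
      · apply Finset.sum_congr rfl
        intro i hi
        rw [Finset.mem_range] at hi
        rw [hcτ i hi, hcp (τ i) i (by omega) (fun j hj => hτ j i hj hi)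
          (fun j h1 h2 => hmono i j h1 h2)]
      · apply Finset.sum_congr rfl
        intro l hl
        rw [Finset.mem_range] at hl
        obtain ⟨h1, h2⟩ := hsplit l 0 (by omega) (by omega)
          (fun i _ h => lt_of_lt_of_le hl (hmono 0 i (by omega) h))
        rw [h1, h2]
        simp [qnum_one]
    · apply Finset.sum_congr rfl
      intro i hi
      rw [Finset.mem_range] at hi
      apply Finset.sum_congr rfl
      intro l hl
      rw [Finset.mem_Ico] at hl
      obtain ⟨h1, h2⟩ := hsplit l (i+1) (by omega)
          (fun j h => by have := hmono j i (by omega) (by omega); omega)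
          (fun j h h' => by have := hmono (i+1) j h h'; omega)
      rw [h1, h2, zero_add, qnum_one, mul_one, add_comm l]
  · apply Finset.sum_congr rfl
    intro l hl
    rw [Finset.mem_Ico] at hl
    obtain ⟨h1, h2⟩ := hsplit l (p+1) (by omega)
        (fun j h => by have := hmono j p (by omega) (by omega); omega)
        (fun j h h' => by omega)
    rw [h1, h2, zero_add, qnum_one, mul_one, add_comm l]
end
end

section
/- Let g_{m,i} denote the coefficient of x^i in the transformed Al-Salam–Chihara polynomial p̂_m(x). For all nonnegative integers n, a and b, g_{n+a+b, n+a} · g_{n+a, n} ⪰ g_{n+a+b, n}; that is, the polynomial g_{n+a+b,n+a} · g_{n+a,n} − g_{n+a+b,n} in α, β, ε₁, ε₂, q has nonnegative coefficients. -/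
noncomputable section

open Finset

/-- Coefficientwise nonnegativity. -/
def Nn (f : R) : Prop := ∀ d : Fin 5 →₀ ℕ, 0 ≤ MvPolynomial.coeff d f

lemma Nn.add {f h : R} (hf : Nn f) (hh : Nn h) : Nn (f + h) := by
  intro d
  rw [MvPolynomial.coeff_add]
  exact add_nonneg (hf d) (hh d)

lemma Nn.mul {f h : R} (hf : Nn f) (hh : Nn h) : Nn (f * h) := by
  intro d
  rw [MvPolynomial.coeff_mul]
  exact Finset.sum_nonneg fun x _ => mul_nonneg (hf _) (hh _)

lemma Nn.zero : Nn 0 := by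
  intro d
  simp

lemma Nn.one : Nn 1 := by
  intro d
  rw [MvPolynomial.coeff_one]
  split_ifs <;> simp

lemma Nn.pow {f : R} (hf : Nn f) (n : ℕ) : Nn (f ^ n) := by
  induction n with
  | zero => simpa using Nn.one
  | succ n ih => rw [pow_succ]; exact ih.mul hf

lemma Nn.var (i : Fin 5) : Nn (MvPolynomial.X i) := by
  intro d
  rw [MvPolynomial.coeff_X]
  split_ifs <;> simp

lemma nn_av : Nn av := Nn.var 0
lemma nn_bv : Nn bv := Nn.var 1
lemma nn_e1 : Nn e1v := Nn.var 2
lemma nn_e2 : Nn e2v := Nn.var 3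
lemma nn_q : Nn qv := Nn.var 4

lemma qnum_succ (n : ℕ) : qnum (n + 1) = qnum n + qv ^ n := by
  simp [qnum, Finset.sum_range_succ]

lemma nn_qnum (n : ℕ) : Nn (qnum n) := by
  induction n with
  | zero => rw [qnum_zero]; exact Nn.zero
  | succ n ih => rw [qnum_succ]; exact ih.add (nn_q.pow n)

lemma nn_qnum_sub_one (n : ℕ) : Nn (qnum (n + 1) - 1) := by
  induction n with
  | zero => simpa [qnum_succ, qnum_zero] using Nn.zero
  | succ n ih =>
    have h : qnum (n + 1 + 1) - 1 = (qnum (n + 1) - 1) + qv ^ (n + 1) := by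
      rw [qnum_succ (n + 1)]; ring
    rw [h]; exact ih.add (nn_q.pow _)

lemma qnum_geom (n : ℕ) : (qv - 1) * qnum n = qv ^ n - 1 := by
  induction n with
  | zero => simp [qnum_zero]
  | succ n ih => rw [qnum_succ, pow_succ]; linear_combination ih

/-- The previous column. -/
def gp (N : ℕ) : ℕ → R
  | 0 => 0
  | k + 1 => g N k

lemma coeff_X_mul_gp (N k : ℕ) : (Polynomial.X * phat N).coeff k = gp N k := by
  cases k with
  | zero => simp [gp]
  | succ k => simp [gp, g, Polynomial.coeff_X_mul]

lemma g_one (k : ℕ) : g 1 k = gp 0 k + bcoef 0 * g 0 k := by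
  have h : phat 1 = Polynomial.X * phat 0 + Polynomial.C (bcoef 0) * phat 0 := by
    simp [phat]
  rw [g, h, Polynomial.coeff_add, coeff_X_mul_gp, Polynomial.coeff_C_mul]; rfl

lemma g_rec (N k : ℕ) :
    g (N + 2) k = gp (N + 1) k + bcoef (N + 1) * g (N + 1) k - lcoef (N + 1) * g N k := by
  have h : phat (N + 2) = Polynomial.X * phat (N + 1) + Polynomial.C (bcoef (N + 1)) * phat (N + 1)
      - Polynomial.C (lcoef (N + 1)) * phat N := by
    rw [phat]; ring
  rw [g, h, Polynomial.coeff_sub, Polynomial.coeff_add, coeff_X_mul_gp, Polynomial.coeff_C_mul,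
    Polynomial.coeff_C_mul]; rfl

lemma g_zero_zero : g 0 0 = 1 := by simp [g, phat]

lemma g_zero_succ (k : ℕ) : g 0 (k + 1) = 0 := by simp [g, phat, Polynomial.coeff_one]

lemma g_tri (N : ℕ) : (∀ k, N < k → g N k = 0) ∧ (∀ k, N + 1 < k → g (N + 1) k = 0) := by
  induction N with
  | zero =>
    have h0 : ∀ k, 0 < k → g 0 k = 0 := by
      intro k hk
      obtain ⟨k, rfl⟩ := Nat.exists_eq_succ_of_ne_zero hk.ne'
      exact g_zero_succ k
    refine ⟨h0, ?_⟩
    intro k hk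
    obtain ⟨k, rfl⟩ : ∃ j, k = j + 1 := ⟨k - 1, by omega⟩
    rw [g_one, gp, h0 k (by omega), h0 (k + 1) (by omega)]; ring
  | succ N ih =>
    refine ⟨ih.2, ?_⟩
    intro k hk
    obtain ⟨k, rfl⟩ : ∃ j, k = j + 1 := ⟨k - 1, by omega⟩
    rw [g_rec, gp, ih.2 k (by omega), ih.2 (k + 1) (by omega), ih.1 (k + 1) (by omega)]; ring

lemma g_lt {N k : ℕ} (h : N < k) : g N k = 0 := (g_tri N).1 k h

lemma g_diag (N : ℕ) : g N N = 1 := by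
  induction N with
  | zero => exact g_zero_zero
  | succ N ih =>
    cases N with
    | zero => rw [g_one, gp, ih, g_lt (by omega)]; ring
    | succ N => rw [g_rec, gp, ih, g_lt (by omega), g_lt (by omega)]; ring

lemma g_sub (L : ℕ) : Nn (g (L + 1) L - av * qnum (L + 1)) := by
  induction L with
  | zero =>
    have h : g (0 + 1) 0 - av * qnum (0 + 1) = bv := by
      rw [g_one, gp, g_zero_zero, bcoef, qnum_succ, qnum_zero]; ring
    rw [h]; exact nn_bv
  | succ L ih =>
    have h : g (L + 1 + 1) (L + 1) - av * qnum (L + 1 + 1) =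
        (g (L + 1) L - av * qnum (L + 1)) + bv * qv ^ (L + 1) + (e1v + e2v) * qnum (L + 1) := by
      rw [g_rec, gp, g_diag, g_lt (show L < L + 1 by omega), bcoef, qnum_succ (L + 1)]; ring
    rw [h]
    exact (ih.add (nn_bv.mul (nn_q.pow _))).add ((nn_e1.add nn_e2).mul (nn_qnum _))

def Vs (k : ℕ) : ℕ → R
  | 0 => bv * g 0 k
  | N + 1 => bv * qv ^ (N + 1) * g (N + 1) k + e2v * qnum (N + 1) * Vs k N

def gam (k : ℕ) : ℕ → R
  | 0 => g 0 k
  | N + 1 => qv ^ (N + 1) * (g (N + 1) k - Vs k N) + Vs k N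

def As (k : ℕ) : ℕ → R
  | 0 => av * gam k 0
  | N + 1 => av * gam k (N + 1) + e1v * qnum (N + 1) * As k N

def W1 (k : ℕ) : ℕ → R
  | 0 => gp 0 k
  | N + 1 => gp (N + 1) k + e1v * qnum (N + 1) * W1 k N

def Ws (k : ℕ) : ℕ → R
  | 0 => W1 k 0
  | N + 1 => W1 k (N + 1) + e2v * qnum (N + 1) * Ws k N

lemma lcoef_succ (n : ℕ) : lcoef (n + 1) =
    e1v * e2v * qnum (n + 1) * qnum n + (av * e2v + bv * e1v) * qv ^ n * qnum (n + 1)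
    + av * bv * qv ^ n * (qv - 1) * qnum (n + 1) := by
  have h : 2 * (n + 1) - 1 = n + (n + 1) := by omega
  rw [lcoef, h, Nat.add_sub_cancel, pow_add]
  linear_combination (-av * bv * qv ^ n) * qnum_geom (n + 1)

lemma sys (k N : ℕ) : g (N + 1) k = As k N + Ws k N + Vs k N ∧
    g (N + 2) k = As k (N + 1) + Ws k (N + 1) + Vs k (N + 1) := by
  induction N with
  | zero =>
    have h0 : g (0 + 1) k = As k 0 + Ws k 0 + Vs k 0 := by
      rw [zero_add, g_one]
      simp only [As, Ws, Vs, W1, gam, bcoef, qnum_zero]; ring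
    refine ⟨h0, ?_⟩
    rw [g_rec, lcoef_succ]
    simp only [As, Ws, Vs, W1, gam, bcoef, qnum_zero, qnum_succ, zero_add] at h0 ⊢
    linear_combination (e1v + e2v) * h0
  | succ N ih =>
    refine ⟨ih.2, ?_⟩
    obtain ⟨h0, h1⟩ := ih
    have hq := qnum_geom (N + 2)
    have hq1 := qnum_geom (N + 1)
    rw [show N + 1 + 2 = (N + 1) + 2 from rfl, g_rec, lcoef_succ]
    simp only [As, Ws, Vs, W1, gam, bcoef] at h0 h1 ⊢
    rw [show N + 1 + 1 = N + 2 from rfl] at *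
    generalize qnum (N + 2) = c at *
    generalize qnum (N + 1) = b at *
    have e2 : qv ^ (N + 2) = 1 + (qv - 1) * c := by linear_combination -hq
    rw [e2] at *
    linear_combination (e1v + e2v) * c * h1 - e1v * e2v * c * b * h0
      + av * e2v * c * Vs k N * hq1

lemma g_succ (k N : ℕ) : g (N + 1) k = As k N + Ws k N + Vs k N := (sys k N).1

lemma gam_succ (k N : ℕ) :
    gam k (N + 1) = qv ^ (N + 1) * (As k N + Ws k N) + Vs k N := by
  rw [gam, g_succ]; ring

lemma nn_all (N : ℕ) : ∀ k, Nn (g N k) ∧ Nn (As k N) ∧ Nn (W1 k N) ∧ Nn (Ws k N) ∧ Nn (Vs k N) := by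
  induction N with
  | zero =>
    have hg : ∀ k, Nn (g 0 k) := by
      intro k
      cases k with
      | zero => rw [g_zero_zero]; exact Nn.one
      | succ k => rw [g_zero_succ]; exact Nn.zero
    have hp : ∀ k, Nn (gp 0 k) := by
      intro k
      cases k with
      | zero => exact Nn.zero
      | succ k => exact hg k
    intro k
    exact ⟨hg k, nn_av.mul (hg k), hp k, hp k, nn_bv.mul (hg k)⟩
  | succ N ih =>
    have hg : ∀ k, Nn (g (N + 1) k) := by
      intro k
      obtain ⟨_, h2, _, h4, h5⟩ := ih k
      rw [g_succ]; exact (h2.add h4).add h5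
    have hp : ∀ k, Nn (gp (N + 1) k) := by
      intro k
      cases k with
      | zero => exact Nn.zero
      | succ k => exact hg k
    intro k
    obtain ⟨_, h2, h3, h4, h5⟩ := ih k
    have hw : Nn (W1 k (N + 1)) := (hp k).add ((nn_e1.mul (nn_qnum _)).mul h3)
    refine ⟨hg k, ?_, hw, hw.add ((nn_e2.mul (nn_qnum _)).mul h4), 
      ((nn_bv.mul (nn_q.pow _)).mul (hg k)).add ((nn_e2.mul (nn_qnum _)).mul h5)⟩
    rw [As, gam_succ]
    exact (nn_av.mul (((nn_q.pow _).mul (h2.add h4)).add h5)).add ((nn_e1.mul (nn_qnum _)).mul h2)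

lemma nn_g (N k : ℕ) : Nn (g N k) := (nn_all N k).1
lemma nn_As (k N : ℕ) : Nn (As k N) := (nn_all N k).2.1
lemma nn_W1 (k N : ℕ) : Nn (W1 k N) := (nn_all N k).2.2.1
lemma nn_Ws (k N : ℕ) : Nn (Ws k N) := (nn_all N k).2.2.2.1
lemma nn_Vs (k N : ℕ) : Nn (Vs k N) := (nn_all N k).2.2.2.2

lemma low_VA (L : ℕ) : ∀ N, N ≤ L → Vs (L + 1) N = 0 ∧ As (L + 1) N = 0 := by
  intro N
  induction N with
  | zero => intro _; simp [Vs, As, gam, g_zero_succ]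
  | succ N ih =>
    intro h
    obtain ⟨h1, h2⟩ := ih (by omega)
    simp [Vs, As, gam, h1, h2, g_lt (show N + 1 < L + 1 by omega)]

lemma low_W (L : ℕ) : ∀ N, N < L → W1 (L + 1) N = 0 ∧ Ws (L + 1) N = 0 := by
  intro N
  induction N with
  | zero => intro h; simp [W1, Ws, gp, g_lt h]
  | succ N ih =>
    intro h
    obtain ⟨h1, h2⟩ := ih (by omega)
    simp [W1, Ws, gp, h1, h2, g_lt h]

lemma diag_W (L : ℕ) : W1 (L + 1) L = 1 ∧ Ws (L + 1) L = 1 := by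
  cases L with
  | zero => simp [W1, Ws, gp, g_diag]
  | succ L =>
    obtain ⟨h1, h2⟩ := low_W (L + 1) L (by omega)
    simp [W1, Ws, gp, h1, h2, g_diag]

/-- `[L+1] ⋯ [L+n]`. -/
def Phi (L : ℕ) : ℕ → R
  | 0 => 1
  | n + 1 => qnum (L + n + 1) * Phi L n

/-- Complete homogeneous symmetric polynomial in `ε₁, ε₂`. -/
def ss : ℕ → R
  | 0 => 1
  | n + 1 => e2v * ss n + e1v ^ (n + 1)

lemma ss_succ' (n : ℕ) : ss (n + 1) = e1v * ss n + e2v ^ (n + 1) := by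
  induction n with
  | zero => simp [ss]; ring
  | succ n ih =>
    have hd : ss (n + 1) = e2v * ss n + e1v ^ (n + 1) := rfl
    rw [ss]
    linear_combination e2v * ih - e1v * hd

def FF (L : ℕ) : ℕ → R
  | 0 => 0
  | n + 1 => e1v * qnum (L + n + 1) * FF L n + av * (e2v ^ n * Phi L n)

def SS (L : ℕ) : ℕ → R
  | 0 => 1
  | n + 1 => e1v ^ (n + 1) * Phi L (n + 1) + e2v * qnum (L + n + 1) * SS L n

lemma nn_Phi (L n : ℕ) : Nn (Phi L n) := by
  induction n with
  | zero => exact Nn.one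
  | succ n ih => exact (nn_qnum _).mul ih

lemma nn_gp (N k : ℕ) : Nn (gp N k) := by
  cases k with
  | zero => exact Nn.zero
  | succ k => exact nn_g N k

lemma nn_e1q (n : ℕ) : Nn (e1v * qnum n) := nn_e1.mul (nn_qnum n)
lemma nn_e2q (n : ℕ) : Nn (e2v * qnum n) := nn_e2.mul (nn_qnum n)

lemma W1_phi (L n : ℕ) : Nn (W1 (L + 1) (L + n) - e1v ^ n * Phi L n) := by
  induction n with
  | zero => simpa [(diag_W L).1, Phi] using Nn.zero
  | succ n ih =>
    have h : W1 (L + 1) (L + (n + 1)) - e1v ^ (n + 1) * Phi L (n + 1) =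
      gp (L + n + 1) (L + 1) + e1v * qnum (L + n + 1) * (W1 (L + 1) (L + n) - e1v ^ n * Phi L n) := by
      rw [← add_assoc, W1, Phi]; ring
    rw [h]; exact (nn_gp _ _).add ((nn_e1q _).mul ih)

lemma Ws_SS (L n : ℕ) : Nn (Ws (L + 1) (L + n) - SS L n) := by
  induction n with
  | zero => simpa [(diag_W L).2, SS] using Nn.zero
  | succ n ih =>
    have h : Ws (L + 1) (L + (n + 1)) - SS L (n + 1) =
      (W1 (L + 1) (L + (n + 1)) - e1v ^ (n + 1) * Phi L (n + 1)) +
        e2v * qnum (L + n + 1) * (Ws (L + 1) (L + n) - SS L n) := by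
      rw [← add_assoc, Ws, SS]; ring
    rw [h]; exact (W1_phi _ _).add ((nn_e2q _).mul ih)

lemma Ws_phi (L n : ℕ) : Nn (Ws (L + 1) (L + n) - e1v ^ n * Phi L n) := by
  cases n with
  | zero => simpa [(diag_W L).2, Phi] using Nn.zero
  | succ n =>
    have h : Ws (L + 1) (L + (n + 1)) - e1v ^ (n + 1) * Phi L (n + 1) =
      (W1 (L + 1) (L + (n + 1)) - e1v ^ (n + 1) * Phi L (n + 1)) +
        e2v * qnum (L + n + 1) * Ws (L + 1) (L + n) := by
      rw [← add_assoc, Ws]; ring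
    rw [h]; exact (W1_phi _ _).add ((nn_e2q _).mul (nn_Ws _ _))

lemma W1_alpha (L n : ℕ) :
    Nn (W1 (L + 1) (L + n + 1) - av * e1v ^ n * Phi L (n + 1)) := by
  induction n with
  | zero =>
    have h : W1 (L + 1) (L + 0 + 1) - av * e1v ^ 0 * Phi L (0 + 1) =
        (g (L + 1) L - av * qnum (L + 1)) + e1v * qnum (L + 1) * W1 (L + 1) L := by
      simp only [W1, gp, Phi, add_zero]; ring
    rw [h]; exact (g_sub L).add ((nn_e1q _).mul (nn_W1 _ _))
  | succ n ih =>
    have h : W1 (L + 1) (L + (n + 1) + 1) - av * e1v ^ (n + 1) * Phi L (n + 1 + 1) =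
      gp (L + (n + 1) + 1) (L + 1) + e1v * qnum (L + (n + 1) + 1) *
        (W1 (L + 1) (L + n + 1) - av * e1v ^ n * Phi L (n + 1)) := by
      rw [W1, Phi, ← add_assoc]; ring
    rw [h]; exact (nn_gp _ _).add ((nn_e1q _).mul ih)

lemma Ws_alpha (L n : ℕ) :
    Nn (Ws (L + 1) (L + n + 1) - e2v ^ (n + 1) * Phi L (n + 1) - av * Phi L (n + 1) * ss n) := by
  induction n with
  | zero =>
    have h : Ws (L + 1) (L + 0 + 1) - e2v ^ (0 + 1) * Phi L (0 + 1) - av * Phi L (0 + 1) * ss 0 =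
        (W1 (L + 1) (L + 0 + 1) - av * e1v ^ 0 * Phi L (0 + 1)) := by
      simp only [Ws, Phi, ss, add_zero, (diag_W L).2]; ring
    rw [h]; exact W1_alpha L 0
  | succ n ih =>
    have h : Ws (L + 1) (L + (n + 1) + 1) - e2v ^ (n + 1 + 1) * Phi L (n + 1 + 1)
        - av * Phi L (n + 1 + 1) * ss (n + 1) =
      (W1 (L + 1) (L + (n + 1) + 1) - av * e1v ^ (n + 1) * Phi L (n + 1 + 1)) +
        e2v * qnum (L + (n + 1) + 1) *
        (Ws (L + 1) (L + n + 1) - e2v ^ (n + 1) * Phi L (n + 1) - av * Phi L (n + 1) * ss n) := by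
      rw [Ws, Phi, ss, ← add_assoc]; ring
    rw [h]; exact (W1_alpha _ _).add ((nn_e2q _).mul ih)

lemma FF_bound (L n : ℕ) : Nn (av * Phi L (n + 1) * ss n - FF L (n + 1)) := by
  induction n with
  | zero =>
    have h : av * Phi L (0 + 1) * ss 0 - FF L (0 + 1) = av * (qnum (L + 1) - 1) := by
      simp only [Phi, ss, FF, add_zero]; ring
    rw [h]; exact nn_av.mul (nn_qnum_sub_one _)
  | succ n ih =>
    have h : av * Phi L (n + 1 + 1) * ss (n + 1) - FF L (n + 1 + 1) =
        e1v * qnum (L + (n + 1) + 1) * (av * Phi L (n + 1) * ss n - FF L (n + 1)) +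
        av * e2v ^ (n + 1) * Phi L (n + 1) * (qnum (L + (n + 1) + 1) - 1) := by
      rw [Phi, FF, ss_succ']; ring
    rw [h]
    exact ((nn_e1q _).mul ih).add
      (((nn_av.mul (nn_e2.pow _)).mul (nn_Phi _ _)).mul (nn_qnum_sub_one _))

lemma Ws_FF (L n : ℕ) : Nn (Ws (L + 1) (L + n) - e2v ^ n * Phi L n - FF L n) := by
  cases n with
  | zero => simpa [(diag_W L).2, Phi, FF] using Nn.zero
  | succ n =>
    have h : Ws (L + 1) (L + (n + 1)) - e2v ^ (n + 1) * Phi L (n + 1) - FF L (n + 1) =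
      (Ws (L + 1) (L + n + 1) - e2v ^ (n + 1) * Phi L (n + 1) - av * Phi L (n + 1) * ss n) +
      (av * Phi L (n + 1) * ss n - FF L (n + 1)) := by
      rw [← add_assoc]; ring
    rw [h]; exact (Ws_alpha _ _).add (FF_bound _ _)

lemma nn_h (k L : ℕ) : Nn (W1 k L - gp L k) := by
  cases L with
  | zero => simpa [W1] using Nn.zero
  | succ L =>
    rw [W1, add_sub_cancel_left]; exact (nn_e1q _).mul (nn_W1 _ _)

lemma nn_lh (k L : ℕ) : Nn (Ws k L - W1 k L) := by
  cases L with
  | zero => simpa [Ws] using Nn.zero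
  | succ L =>
    rw [Ws, add_sub_cancel_left]; exact (nn_e2q _).mul (nn_Ws _ _)

lemma nn_l (k L : ℕ) : Nn (Ws k L - gp L k) := by
  have h : Ws k L - gp L k = (Ws k L - W1 k L) + (W1 k L - gp L k) := by ring
  rw [h]; exact (nn_lh k L).add (nn_h k L)

/-- The joint induction statement. -/
def St (L k n : ℕ) : Prop :=
  Nn (Vs (L + 1) (L + n) * g (L + 1) k + e2v ^ n * Phi L n * Vs k L - Vs k (L + n)) ∧
  Nn (As (L + 1) (L + n) * g (L + 1) k + e1v ^ n * Phi L n * As k L + FF L n * Vs k L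
    - As k (L + n)) ∧
  Nn (W1 (L + 1) (L + n) * gp L k + e1v ^ n * Phi L n * (W1 k L - gp L k) - W1 k (L + n)) ∧
  Nn (Ws (L + 1) (L + n) * gp L k + SS L n * (Ws k L - gp L k) - Ws k (L + n))

lemma St_u {L k n : ℕ} (h : St L k n) :
    Nn ((As (L + 1) (L + n) + Ws (L + 1) (L + n)) * g (L + 1) k
      - (As k (L + n) + Ws k (L + n)) - e2v ^ n * Phi L n * Vs k L) := by
  obtain ⟨_, ha, _, hw⟩ := h
  have key := (((ha.add hw).add ((Ws_phi L n).mul (nn_As k L))).add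
    ((Ws_SS L n).mul (nn_l k L))).add ((Ws_FF L n).mul (nn_Vs k L))
  convert key using 1
  linear_combination (Ws (L + 1) (L + n)) * g_succ k L

lemma St_g {L k n : ℕ} (h : St L k n) :
    Nn (g (L + n + 1) (L + 1) * g (L + 1) k - g (L + n + 1) k) := by
  have key := (St_u h).add h.1
  convert key using 1
  rw [g_succ (L + 1) (L + n), g_succ k (L + n)]; ring

lemma St_gam {L k n : ℕ} (h : St L k n) :
    Nn (gam (L + 1) (L + n + 1) * g (L + 1) k + e2v ^ n * Phi L n * Vs k L
      - gam k (L + n + 1)) := by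
  have key := ((nn_q.pow (L + n + 1)).mul ((St_u h).add
    (((nn_e2.pow n).mul (nn_Phi L n)).mul (nn_Vs k L)))).add h.1
  convert key using 1
  rw [gam_succ, gam_succ]; ring

lemma St_all (L k : ℕ) (H : ∀ n, Nn (g (L + n) L * gp L k - gp (L + n) k)) (n : ℕ) :
    St L k n := by
  induction n with
  | zero =>
    have h1 := (low_VA L L le_rfl).1
    have h2 := (low_VA L L le_rfl).2
    have h3 := (diag_W L).1
    have h4 := (diag_W L).2
    refine ⟨?_, ?_, ?_, ?_⟩ <;> simpa [h1, h2, h3, h4, Phi, FF, SS] using Nn.zero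
  | succ n ih =>
    have hg := St_g ih
    have hgam := St_gam ih
    obtain ⟨hv, ha, hw1, hw⟩ := ih
    have hw1' : Nn (W1 (L + 1) (L + (n + 1)) * gp L k
        + e1v ^ (n + 1) * Phi L (n + 1) * (W1 k L - gp L k) - W1 k (L + (n + 1))) := by
      convert (H (n + 1)).add ((nn_e1q (L + n + 1)).mul hw1) using 1
      rw [← add_assoc, W1, W1, Phi, gp]; ring
    refine ⟨?_, ?_, hw1', ?_⟩
    · convert ((nn_bv.mul (nn_q.pow (L + n + 1))).mul hg).add
        ((nn_e2q (L + n + 1)).mul hv) using 1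
      rw [← add_assoc, Vs, Vs, Phi]; ring
    · convert (nn_av.mul hgam).add ((nn_e1q (L + n + 1)).mul ha) using 1
      rw [← add_assoc, As, As, Phi, FF]; ring
    · convert (hw1'.add ((nn_e2q (L + n + 1)).mul hw)).add
        (((nn_e1.pow (n + 1)).mul (nn_Phi L (n + 1))).mul (nn_lh k L)) using 1
      rw [← add_assoc, Ws, Ws, SS]; ring

lemma main_pos (M : ℕ) : ∀ k, k ≤ M → ∀ n, Nn (g (M + n) M * g M k - g (M + n) k) := by
  induction M with
  | zero =>
    intro k hk n
    obtain rfl : k = 0 := by omega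
    simpa [g_zero_zero] using Nn.zero
  | succ L ih =>
    intro k hk n
    have H : ∀ n, Nn (g (L + n) L * gp L k - gp (L + n) k) := by
      intro n
      cases k with
      | zero => simpa [gp] using Nn.zero
      | succ k => exact ih k (by omega) n
    have h := St_g (St_all L k H n)
    rwa [show L + 1 + n = L + n + 1 by omega]

/-- **Statement 17 (Theorem `2pos`).** For all nonnegative integers `n, a, b`,
`g_{n+a+b,n+a} · g_{n+a,n} − g_{n+a+b,n}` is a polynomial in `α, β, ε₁, ε₂, q`
with nonnegative coefficients. -/
theorem two_by_two_minor_positivity (n a b : ℕ) :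
    ∀ d : Fin 5 →₀ ℕ,
      0 ≤ MvPolynomial.coeff d (g (n + a + b) (n + a) * g (n + a) n - g (n + a + b) n) := by
  exact main_pos (n + a) n (Nat.le_add_right n a) b
end
end
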